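/- arXiv:2109.11438 — 2 statements merged into one kernel-verified Lean document; each statement's English description precedes it below -/
import Mathlib

section
/- For every C > 0 and ε > 0 there exists D₃ such that the following holds for all D ≥ D₃. Under the standing setup (nearly disjoint finite graphs G₁, …, G_m with union G; every vertex of G in exactly C of the graphs; a list assignment L with |L(v)| = Λ for all v, where (1 + ε)D ≤ Λ ≤ 10CD; d_{G_i, L}(v, c) = D for every i ∈ [m], v ∈ V(G_i), c ∈ L(v); uv ∈ E(G) only if L(u) ∩ L(v) ≠ ∅; and the random pair (A, ψ) where each vertex lies in A independently with probability p, where log⁻¹ D ≥ p ≥ log⁻² D, and ψ(v) is chosen uniformly and independently from L(v)), every vertex v ∈ V(G) satisfies P(|R_v − E[R_v]| > D^{2/3}) ≤ exp(−D^{1/4}); moreover, for every i ∈ [m] with v ∈ V(G_i) and every c ∈ L(v), P(|U_{v,c,i} − E[U_{v,c,i}]| > D^{2/3}) ≤ exp(−D^{1/4}) and P(|K_{v,c,i} − E[K_{v,c,i}]| > D^{2/3}) ≤ exp(−D^{1/4}). -/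
open Finset

open Classical in
/-- The probability of an event `E` of outcomes `(A, ψ)`, where `A ⊆ V` contains each
vertex independently with probability `p` and, independently, `ψ v` is uniform in `L v`. -/
noncomputable def prEvent {V : Type} [Fintype V] [DecidableEq V]
    (L : V → Finset ℕ) (p : ℝ) (E : Finset V → (V → ℕ) → Prop) : ℝ :=
  ∑ A : Finset V, ∑ ψ ∈ Fintype.piFinset (fun v => L v),
    if E A ψ then
      p ^ A.card * (1 - p) ^ (Fintype.card V - A.card) * ∏ v : V, ((L v).card : ℝ)⁻¹
    else 0

open Classical in
/-- The expectation of a random variable `X` of outcomes `(A, ψ)`. -/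
noncomputable def expVal {V : Type} [Fintype V] [DecidableEq V]
    (L : V → Finset ℕ) (p : ℝ) (X : Finset V → (V → ℕ) → ℝ) : ℝ :=
  ∑ A : Finset V, ∑ ψ ∈ Fintype.piFinset (fun v => L v),
    X A ψ * (p ^ A.card * (1 - p) ^ (Fintype.card V - A.card) * ∏ v : V, ((L v).card : ℝ)⁻¹)

open Classical in
/-- `L_{A,ψ}(v) = L(v) \ {ψ(u) : u ∈ N_G(v) ∩ A}`. -/
noncomputable def keptList {V : Type} [Fintype V] [DecidableEq V] (Gu : SimpleGraph V)
    (L : V → Finset ℕ) (A : Finset V) (ψ : V → ℕ) (v : V) : Finset ℕ :=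
  (L v).filter fun c => ∀ u, Gu.Adj v u → u ∈ A → ψ u ≠ c

open Classical in
/-- `X_{A,ψ} = {v ∈ A : ψ(v) ∈ L_{A,ψ}(v)}`. -/
noncomputable def keptSet {V : Type} [Fintype V] [DecidableEq V] (Gu : SimpleGraph V)
    (L : V → Finset ℕ) (A : Finset V) (ψ : V → ℕ) : Finset V :=
  A.filter fun v => ψ v ∈ keptList Gu L A ψ v

open Classical in
/-- `R_v(A, ψ) = |L_{A,ψ}(v)|`. -/
noncomputable def rvR {V : Type} [Fintype V] [DecidableEq V] (Gu : SimpleGraph V)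
    (L : V → Finset ℕ) (v : V) (A : Finset V) (ψ : V → ℕ) : ℝ :=
  ((keptList Gu L A ψ v).card : ℝ)

open Classical in
/-- `U_{v,c,i}(A, ψ) = |{u ∈ N_{Gᵢ}(v) ∩ A : c ∈ L(u)} \ X_{A,ψ}|`. -/
noncomputable def rvU {V : Type} [Fintype V] [DecidableEq V] (Gu Gi : SimpleGraph V)
    [DecidableRel Gi.Adj] (L : V → Finset ℕ) (v : V) (c : ℕ)
    (A : Finset V) (ψ : V → ℕ) : ℝ :=
  (((Gi.neighborFinset v).filter fun u =>
      c ∈ L u ∧ u ∈ A ∧ u ∉ keptSet Gu L A ψ).card : ℝ)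

open Classical in
/-- `K_{v,c,i}(A, ψ) = |{u ∈ N_{Gᵢ}(v) \ A : c ∈ L(u)}
      \ ⋃_{w ∈ A \ V(Gᵢ) : ψ(w) = c} N_G(w)|`. -/
noncomputable def rvK {V : Type} [Fintype V] [DecidableEq V] (Gu Gi : SimpleGraph V)
    [DecidableRel Gi.Adj] (L : V → Finset ℕ) (Si : Finset V) (v : V) (c : ℕ)
    (A : Finset V) (ψ : V → ℕ) : ℝ :=
  (((Gi.neighborFinset v).filter fun u =>
      c ∈ L u ∧ u ∉ A ∧ ¬∃ w, w ∈ A ∧ w ∉ Si ∧ ψ w = c ∧ Gu.Adj w u).card : ℝ)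

section ProductExpectation

variable {V α : Type} [Fintype V] [DecidableEq V]

/-- The expectation of `F` under the product of the finitely supported weights `μ v` on `Ω v`. -/
noncomputable def prodExp (Ω : V → Finset α) (μ : V → α → ℝ) (F : (V → α) → ℝ) : ℝ :=
  ∑ x ∈ Fintype.piFinset Ω, (∏ v, μ v (x v)) * F x

/-- The partial average of `f` over the coordinates in `S`. -/
noncomputable def partAvg (Ω : V → Finset α) (μ : V → α → ℝ) (S : Finset V)
    (f : (V → α) → ℝ) (x : V → α) : ℝ :=
  prodExp Ω μ fun y => f (S.piecewise y x)

variable {Ω : V → Finset α} {μ : V → α → ℝ}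

lemma prodExp_const (hμ1 : ∀ v, ∑ a ∈ Ω v, μ v a = 1) (c : ℝ) :
    prodExp Ω μ (fun _ => c) = c := by
  unfold prodExp
  rw [← Finset.sum_mul, ← Finset.prod_univ_sum]
  simp [hμ1]

lemma prodExp_mono (hμ0 : ∀ v a, 0 ≤ μ v a) {F H : (V → α) → ℝ}
    (h : ∀ x ∈ Fintype.piFinset Ω, F x ≤ H x) : prodExp Ω μ F ≤ prodExp Ω μ H :=
  Finset.sum_le_sum fun x hx =>
    mul_le_mul_of_nonneg_left (h x hx) (Finset.prod_nonneg fun v _ => hμ0 v _)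

lemma prodExp_congr {F H : (V → α) → ℝ}
    (h : ∀ x ∈ Fintype.piFinset Ω, F x = H x) : prodExp Ω μ F = prodExp Ω μ H :=
  Finset.sum_congr rfl fun x hx => by rw [h x hx]

lemma prodExp_add (F H : (V → α) → ℝ) :
    prodExp Ω μ (fun x => F x + H x) = prodExp Ω μ F + prodExp Ω μ H := by
  simp [prodExp, mul_add, Finset.sum_add_distrib]

lemma prodExp_sub (F H : (V → α) → ℝ) :
    prodExp Ω μ (fun x => F x - H x) = prodExp Ω μ F - prodExp Ω μ H := by
  simp [prodExp, mul_sub, Finset.sum_sub_distrib]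

lemma prodExp_neg (F : (V → α) → ℝ) :
    prodExp Ω μ (fun x => - F x) = - prodExp Ω μ F := by
  simp [prodExp]

lemma prodExp_const_mul (c : ℝ) (F : (V → α) → ℝ) :
    prodExp Ω μ (fun x => c * F x) = c * prodExp Ω μ F := by
  simp only [prodExp, Finset.mul_sum]
  exact Finset.sum_congr rfl fun x _ => by ring

lemma prodExp_sum {ι : Type*} (s : Finset ι) (F : ι → (V → α) → ℝ) :
    prodExp Ω μ (fun x => ∑ i ∈ s, F i x) = ∑ i ∈ s, prodExp Ω μ (F i) := by
  simp only [prodExp, Finset.mul_sum]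
  exact Finset.sum_comm

lemma prodExp_prod (F : V → α → ℝ) :
    prodExp Ω μ (fun x => ∏ v, F v (x v)) = ∏ v, ∑ a ∈ Ω v, μ v a * F v a := by
  unfold prodExp
  rw [Finset.prod_univ_sum]
  exact Finset.sum_congr rfl fun x _ => (Finset.prod_mul_distrib).symm

lemma prodExp_resample (hμ1 : ∀ v, ∑ a ∈ Ω v, μ v a = 1) (v : V) (F : (V → α) → ℝ) :
    prodExp Ω μ F = ∑ a ∈ Ω v, μ v a * prodExp Ω μ fun y => F (Function.update y v a) := by
  classical
  have h1 : prodExp Ω μ F = ∑ a ∈ Ω v, μ v a * prodExp Ω μ F := by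
    rw [← Finset.sum_mul, hμ1, one_mul]
  rw [h1]
  simp only [prodExp, Finset.mul_sum]
  rw [← Finset.sum_product', ← Finset.sum_product']
  have hmem : ∀ q : α × (V → α), q ∈ Ω v ×ˢ Fintype.piFinset Ω →
      (q.2 v, Function.update q.2 v q.1) ∈ Ω v ×ˢ Fintype.piFinset Ω := by
    rintro ⟨a, y⟩ h
    simp only [Finset.mem_product, Fintype.mem_piFinset] at h ⊢
    refine ⟨h.2 v, fun w => ?_⟩
    by_cases hw : w = v
    · subst hw; simpa using h.1
    · simpa [hw] using h.2 w
  refine Finset.sum_nbij' (fun q => (q.2 v, Function.update q.2 v q.1))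
    (fun q => (q.2 v, Function.update q.2 v q.1)) hmem hmem ?_ ?_ ?_
  · rintro ⟨a, y⟩ _; simp
  · rintro ⟨a, y⟩ _; simp
  · rintro ⟨a, y⟩ _
    have e1 : ∏ w, μ w (y w) = μ v (y v) * ∏ w ∈ univ.erase v, μ w (y w) :=
      (Finset.mul_prod_erase _ _ (Finset.mem_univ v)).symm
    have e2 : ∏ w, μ w (Function.update y v a w)
        = μ v a * ∏ w ∈ univ.erase v, μ w (y w) := by
      rw [← Finset.mul_prod_erase _ _ (Finset.mem_univ v)]
      simp only [Function.update_self]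
      congr 1
      refine Finset.prod_congr rfl fun w hw => ?_
      rw [Function.update_of_ne (Finset.ne_of_mem_erase hw)]
    simp only [Function.update_idem, Function.update_eq_self]
    rw [e1, e2]; ring

lemma abs_prodExp_sub_le (hμ0 : ∀ v a, 0 ≤ μ v a) (hμ1 : ∀ v, ∑ a ∈ Ω v, μ v a = 1)
    {F H : (V → α) → ℝ} {c : ℝ} (h : ∀ x, |F x - H x| ≤ c) :
    |prodExp Ω μ F - prodExp Ω μ H| ≤ c := by
  rw [← prodExp_sub, abs_le]
  constructor
  · rw [← prodExp_const hμ1 (-c)]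
    exact prodExp_mono hμ0 fun x _ => (abs_le.1 (h x)).1
  · rw [← prodExp_const hμ1 c]
    exact prodExp_mono hμ0 fun x _ => (abs_le.1 (h x)).2

lemma partAvg_empty (hμ1 : ∀ v, ∑ a ∈ Ω v, μ v a = 1) (f : (V → α) → ℝ) (x : V → α) :
    partAvg Ω μ ∅ f x = f x := by
  simp [partAvg, prodExp_const hμ1]

lemma partAvg_univ (f : (V → α) → ℝ) (x : V → α) :
    partAvg Ω μ univ f x = prodExp Ω μ f := by
  simp [partAvg]

lemma partAvg_insert (hμ1 : ∀ v, ∑ a ∈ Ω v, μ v a = 1) {S : Finset V} {v : V} (hv : v ∉ S)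
    (f : (V → α) → ℝ) (x : V → α) :
    partAvg Ω μ (insert v S) f x
      = ∑ a ∈ Ω v, μ v a * partAvg Ω μ S f (Function.update x v a) := by
  unfold partAvg
  rw [prodExp_resample hμ1 v]
  refine Finset.sum_congr rfl fun a _ => ?_
  congr 2
  funext y
  congr 1
  funext w
  by_cases hw : w = v
  · subst hw; simp [Finset.piecewise, hv]
  · by_cases hS : w ∈ S <;> simp [Finset.piecewise, hw, hS]

/-- A Bernstein bound for the exponential moment of a single bounded variable. -/
lemma sum_exp_le_of_abs_sub_le (s : Finset α) (m φ h : α → ℝ) (c b l : ℝ)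
    (hm0 : ∀ a, 0 ≤ m a) (hm1 : ∑ a ∈ s, m a = 1) (h0 : ∀ a, 0 ≤ h a) (h1 : ∀ a, h a ≤ 1)
    (hb : 0 ≤ b) (hl : 0 ≤ l) (hlb : 2 * l * b ≤ 1) (hφ : ∀ a, |φ a - c| ≤ b * h a) :
    ∑ a ∈ s, m a * Real.exp (l * φ a)
      ≤ Real.exp (l * ∑ a ∈ s, m a * φ a + 4 * l ^ 2 * b ^ 2 * ∑ a ∈ s, m a * h a) := by
  set e := ∑ a ∈ s, m a * φ a with he
  set q := ∑ a ∈ s, m a * h a with hq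
  have hq0 : 0 ≤ q := Finset.sum_nonneg fun a _ => mul_nonneg (hm0 a) (h0 a)
  have hq1 : q ≤ 1 := by
    rw [← hm1]
    exact Finset.sum_le_sum fun a _ => mul_le_of_le_one_right (hm0 a) (h1 a)
  have hec : |e - c| ≤ b * q := by
    have : e - c = ∑ a ∈ s, m a * (φ a - c) := by
      simp only [mul_sub, Finset.sum_sub_distrib, ← Finset.sum_mul, hm1, one_mul, he]
    rw [this, hq, Finset.mul_sum]
    refine (Finset.abs_sum_le_sum_abs _ _).trans (Finset.sum_le_sum fun a _ => ?_)
    rw [abs_mul, abs_of_nonneg (hm0 a)]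
    nlinarith [mul_le_mul_of_nonneg_left (hφ a) (hm0 a)]
  have hd : ∀ a, |φ a - e| ≤ b * (h a + q) := fun a => by
    have := abs_sub_le (φ a) c e
    rw [abs_sub_comm c e] at this
    linarith [hφ a]
  have hpt : ∀ a, Real.exp (l * (φ a - e))
      ≤ 1 + l * (φ a - e) + l ^ 2 * b ^ 2 * ((1 + 2 * q) * h a + q ^ 2) := fun a => by
    have hz : |l * (φ a - e)| ≤ 1 := by
      rw [abs_mul, abs_of_nonneg hl]
      nlinarith [mul_le_mul_of_nonneg_left (hd a) hl, mul_nonneg hl hb, h1 a, hq1]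
    have h2 := Real.abs_exp_sub_one_sub_id_le hz
    have h3 : (φ a - e) ^ 2 ≤ (b * (h a + q)) ^ 2 := sq_le_sq' (by linarith [(abs_le.1 (hd a)).1])
      (abs_le.1 (hd a)).2
    have h4 : (h a + q) ^ 2 ≤ (1 + 2 * q) * h a + q ^ 2 := by nlinarith [h0 a, h1 a]
    have h5 : l ^ 2 * (φ a - e) ^ 2 ≤ l ^ 2 * (b ^ 2 * ((1 + 2 * q) * h a + q ^ 2)) := by
      refine mul_le_mul_of_nonneg_left (h3.trans ?_) (sq_nonneg l)
      rw [mul_pow]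
      exact mul_le_mul_of_nonneg_left h4 (sq_nonneg b)
    have := (abs_le.1 h2).2
    nlinarith
  have hsum : ∑ a ∈ s, m a * Real.exp (l * (φ a - e)) ≤ 1 + 4 * l ^ 2 * b ^ 2 * q := by
    calc _ ≤ ∑ a ∈ s, m a * (1 + l * (φ a - e) + l ^ 2 * b ^ 2 * ((1 + 2 * q) * h a + q ^ 2)) :=
          Finset.sum_le_sum fun a _ => mul_le_mul_of_nonneg_left (hpt a) (hm0 a)
      _ = ∑ a ∈ s, (m a * (1 - l * e + l ^ 2 * b ^ 2 * q ^ 2) + l * (m a * φ a)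
            + (l ^ 2 * b ^ 2 * (1 + 2 * q)) * (m a * h a)) :=
          Finset.sum_congr rfl fun a _ => by ring
      _ = 1 + l ^ 2 * b ^ 2 * (q + 3 * q ^ 2) := by
          rw [Finset.sum_add_distrib, Finset.sum_add_distrib, ← Finset.sum_mul, ← Finset.mul_sum,
            ← Finset.mul_sum, hm1, ← he, ← hq]; ring
      _ ≤ _ := by
          have : l ^ 2 * b ^ 2 * (q + 3 * q ^ 2) ≤ l ^ 2 * b ^ 2 * (4 * q) :=
            mul_le_mul_of_nonneg_left (by nlinarith) (by positivity)
          linarith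
  calc ∑ a ∈ s, m a * Real.exp (l * φ a)
      = Real.exp (l * e) * ∑ a ∈ s, m a * Real.exp (l * (φ a - e)) := by
        rw [Finset.mul_sum]
        refine Finset.sum_congr rfl fun a _ => ?_
        rw [mul_left_comm, ← Real.exp_add]; ring_nf
    _ ≤ Real.exp (l * e) * Real.exp (4 * l ^ 2 * b ^ 2 * q) := by
        refine mul_le_mul_of_nonneg_left (hsum.trans ?_) (Real.exp_pos _).le
        linarith [Real.add_one_le_exp (4 * l ^ 2 * b ^ 2 * q)]
    _ = _ := (Real.exp_add _ _).symm

lemma partAvg_insert_exp_le (hμ0 : ∀ v a, 0 ≤ μ v a) (hμ1 : ∀ v, ∑ a ∈ Ω v, μ v a = 1)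
    {S : Finset V} {v : V} (hv : v ∉ S) (f : (V → α) → ℝ) (x : V → α) (a₀ : α) (h : α → ℝ)
    (h0 : ∀ a, 0 ≤ h a) (h1 : ∀ a, h a ≤ 1) {b l B : ℝ}
    (hb : 0 ≤ b) (hl : 0 ≤ l) (hlb : 2 * l * b ≤ 1)
    (hB : ∀ a, partAvg Ω μ S (fun z => Real.exp (l * f z)) (Function.update x v a)
      ≤ Real.exp (l * partAvg Ω μ S f (Function.update x v a) + B))
    (hf : ∀ y a, |f (Function.update (S.piecewise y x) v a)
      - f (Function.update (S.piecewise y x) v a₀)| ≤ b * h a) :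
    partAvg Ω μ (insert v S) (fun z => Real.exp (l * f z)) x
      ≤ Real.exp (l * partAvg Ω μ (insert v S) f x
          + (B + 4 * l ^ 2 * b ^ 2 * ∑ a ∈ Ω v, μ v a * h a)) := by
  rw [partAvg_insert hμ1 hv, partAvg_insert hμ1 hv]
  have hφ : ∀ a, |partAvg Ω μ S f (Function.update x v a)
      - partAvg Ω μ S f (Function.update x v a₀)| ≤ b * h a := fun a => by
    refine abs_prodExp_sub_le hμ0 hμ1 fun y => ?_
    simp only [← Finset.update_piecewise_of_notMem S y x hv]
    exact hf y a
  have key := sum_exp_le_of_abs_sub_le (Ω v) (μ v)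
    (fun a => partAvg Ω μ S f (Function.update x v a)) h _ b l (hμ0 v) (hμ1 v) h0 h1 hb hl hlb hφ
  calc _ ≤ ∑ a ∈ Ω v, μ v a * (Real.exp (l * partAvg Ω μ S f (Function.update x v a))
            * Real.exp B) :=
        Finset.sum_le_sum fun a _ => by
          rw [← Real.exp_add]; exact mul_le_mul_of_nonneg_left (hB a) (hμ0 v a)
    _ = (∑ a ∈ Ω v, μ v a * Real.exp (l * partAvg Ω μ S f (Function.update x v a)))
          * Real.exp B := by
        rw [Finset.sum_mul]; exact Finset.sum_congr rfl fun a _ => by ring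
    _ ≤ _ := by
        refine (mul_le_mul_of_nonneg_right key (Real.exp_pos B).le).trans_eq ?_
        rw [← Real.exp_add]; ring_nf

/-- Exponential moments of a function of independent variables: changing a coordinate in `N`
moves `f` by at most `b`, and the influence `b * h v x a` of a coordinate outside `N` is governed
by the values on `N`. -/
lemma prodExp_exp_le (hμ0 : ∀ v a, 0 ≤ μ v a) (hμ1 : ∀ v, ∑ a ∈ Ω v, μ v a = 1)
    (f : (V → α) → ℝ) (N : Finset V) (a₀ : α) (h : V → (V → α) → α → ℝ)
    (h0 : ∀ v x a, 0 ≤ h v x a) (h1 : ∀ v x a, h v x a ≤ 1)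
    (hN : ∀ v x y a, (∀ u ∈ N, x u = y u) → h v x a = h v y a) {b l M : ℝ}
    (hb : 0 ≤ b) (hl : 0 ≤ l) (hlb : 2 * l * b ≤ 1)
    (hfN : ∀ v ∈ N, ∀ x a, |f (Function.update x v a) - f (Function.update x v a₀)| ≤ b)
    (hf : ∀ v ∉ N, ∀ x a,
      |f (Function.update x v a) - f (Function.update x v a₀)| ≤ b * h v x a)
    (hM : ∀ x, ∑ v ∈ Nᶜ, ∑ a ∈ Ω v, μ v a * h v x a ≤ M) :
    prodExp Ω μ (fun z => Real.exp (l * f z))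
      ≤ Real.exp (l * prodExp Ω μ f + 4 * l ^ 2 * b ^ 2 * (M + N.card)) := by
  have outer : ∀ S : Finset V, S ⊆ Nᶜ → ∀ x,
      partAvg Ω μ S (fun z => Real.exp (l * f z)) x
        ≤ Real.exp (l * partAvg Ω μ S f x
          + 4 * l ^ 2 * b ^ 2 * ∑ v ∈ S, ∑ a ∈ Ω v, μ v a * h v x a) := by
    intro S
    induction S using Finset.induction_on with
    | empty => intro _ x; simp [partAvg_empty hμ1]
    | insert v S hv ih =>
      intro hS x
      have hS' : S ⊆ Nᶜ := (Finset.subset_insert v S).trans hS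
      have hvN : v ∉ N := Finset.mem_compl.1 (hS (Finset.mem_insert_self v S))
      have := partAvg_insert_exp_le hμ0 hμ1 hv f x a₀ (h v x) (h0 v x) (h1 v x) hb hl hlb
        (B := 4 * l ^ 2 * b ^ 2 * ∑ v ∈ S, ∑ a ∈ Ω v, μ v a * h v x a)
        (fun a => by
          refine (ih hS' _).trans_eq ?_
          congr 3
          refine Finset.sum_congr rfl fun w _ => Finset.sum_congr rfl fun a' _ => ?_
          rw [hN w _ x a']
          intro u hu
          rw [Function.update_of_ne]
          rintro rfl
          exact hvN hu)
        (fun y a => by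
          rw [← hN v (S.piecewise y x) x a]
          · exact hf v hvN _ a
          · intro u hu
            rw [Finset.piecewise_eq_of_notMem]
            intro huS
            exact Finset.mem_compl.1 (hS' huS) hu)
      refine this.trans_eq ?_
      rw [Finset.sum_insert hv]; ring_nf
  have inner : ∀ T : Finset V, T ⊆ N → ∀ x,
      partAvg Ω μ (T ∪ Nᶜ) (fun z => Real.exp (l * f z)) x
        ≤ Real.exp (l * partAvg Ω μ (T ∪ Nᶜ) f x + 4 * l ^ 2 * b ^ 2 * (M + T.card)) := by
    intro T
    induction T using Finset.induction_on with
    | empty =>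
      intro _ x
      rw [Finset.empty_union]
      refine (outer _ subset_rfl x).trans (Real.exp_le_exp.2 ?_)
      have := mul_le_mul_of_nonneg_left (hM x) (by positivity : 0 ≤ 4 * l ^ 2 * b ^ 2)
      simp only [Finset.card_empty, Nat.cast_zero, add_zero]
      linarith
    | insert v T hv ih =>
      intro hT x
      have hvN : v ∈ N := hT (Finset.mem_insert_self v T)
      have hv' : v ∉ T ∪ Nᶜ := by simp [hv, hvN]
      rw [Finset.insert_union]
      have := partAvg_insert_exp_le hμ0 hμ1 hv' f x a₀ (fun _ => 1) (by simp) (by simp) hb hl hlb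
        (fun a => ih ((Finset.subset_insert v T).trans hT) _)
        (fun y a => by simpa using hfN v hvN _ a)
      refine this.trans_eq ?_
      rw [Finset.card_insert_of_notMem hv]
      simp only [mul_one, hμ1]
      push_cast
      ring_nf
  by_cases hV : (Fintype.piFinset Ω).Nonempty
  · obtain ⟨x, -⟩ := hV
    have := inner N subset_rfl x
    rwa [Finset.union_compl, partAvg_univ, partAvg_univ] at this
  · rw [Finset.not_nonempty_iff_eq_empty] at hV
    simp only [prodExp, hV, Finset.sum_empty]
    positivity

open Classical in
/-- The probability of `E` under the product weight. -/
noncomputable def prodProb (Ω : V → Finset α) (μ : V → α → ℝ) (E : (V → α) → Prop) : ℝ :=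
  prodExp Ω μ fun x => if E x then 1 else 0

lemma prodProb_le_prodExp (hμ0 : ∀ v a, 0 ≤ μ v a) {E : (V → α) → Prop} {F : (V → α) → ℝ}
    (h0 : ∀ x ∈ Fintype.piFinset Ω, 0 ≤ F x) (h1 : ∀ x ∈ Fintype.piFinset Ω, E x → 1 ≤ F x) :
    prodProb Ω μ E ≤ prodExp Ω μ F := by
  refine prodExp_mono hμ0 fun x hx => ?_
  split_ifs with h
  exacts [h1 x hx h, h0 x hx]

lemma prodProb_le_add (hμ0 : ∀ v a, 0 ≤ μ v a) {E E₁ E₂ : (V → α) → Prop}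
    (h : ∀ x ∈ Fintype.piFinset Ω, E x → E₁ x ∨ E₂ x) :
    prodProb Ω μ E ≤ prodProb Ω μ E₁ + prodProb Ω μ E₂ := by
  classical
  unfold prodProb
  rw [← prodExp_add]
  refine prodExp_mono hμ0 fun x hx => ?_
  by_cases h1 : E₁ x <;> by_cases h2 : E₂ x <;> by_cases h3 : E x <;> simp [h1, h2, h3]
  exact absurd (h x hx h3) (by simp [h1, h2])

lemma prodProb_lt_le_exp (hμ0 : ∀ v a, 0 ≤ μ v a) (f : (V → α) → ℝ) (t : ℝ) {l : ℝ}
    (hl : 0 ≤ l) :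
    prodProb Ω μ (fun x => t < f x) ≤ Real.exp (-(l * t)) * prodExp Ω μ fun x => Real.exp (l * f x) := by
  rw [← prodExp_const_mul]
  refine prodProb_le_prodExp hμ0 (fun x _ => by positivity) fun x _ hx => ?_
  rw [← Real.exp_add]
  refine Real.one_le_exp ?_
  nlinarith

lemma prodProb_abs_sub_le (hμ0 : ∀ v a, 0 ≤ μ v a) (hμ1 : ∀ v, ∑ a ∈ Ω v, μ v a = 1)
    (f : (V → α) → ℝ) (N : Finset V) (a₀ : α) (h : V → (V → α) → α → ℝ)
    (h0 : ∀ v x a, 0 ≤ h v x a) (h1 : ∀ v x a, h v x a ≤ 1)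
    (hN : ∀ v x y a, (∀ u ∈ N, x u = y u) → h v x a = h v y a) {b l M t : ℝ}
    (hb : 0 ≤ b) (hl : 0 ≤ l) (hlb : 2 * l * b ≤ 1)
    (hfN : ∀ v ∈ N, ∀ x a, |f (Function.update x v a) - f (Function.update x v a₀)| ≤ b)
    (hf : ∀ v ∉ N, ∀ x a,
      |f (Function.update x v a) - f (Function.update x v a₀)| ≤ b * h v x a)
    (hM : ∀ x, ∑ v ∈ Nᶜ, ∑ a ∈ Ω v, μ v a * h v x a ≤ M) :
    prodProb Ω μ (fun x => t < |f x - prodExp Ω μ f|)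
      ≤ 2 * Real.exp (-(l * t) + 4 * l ^ 2 * b ^ 2 * (M + N.card)) := by
  have tail : ∀ g : (V → α) → ℝ,
      (∀ v ∈ N, ∀ x a, |g (Function.update x v a) - g (Function.update x v a₀)| ≤ b) →
      (∀ v ∉ N, ∀ x a,
        |g (Function.update x v a) - g (Function.update x v a₀)| ≤ b * h v x a) →
      prodProb Ω μ (fun x => t < g x - prodExp Ω μ g)
        ≤ Real.exp (-(l * t) + 4 * l ^ 2 * b ^ 2 * (M + N.card)) := by
    intro g hgN hg
    refine (prodProb_lt_le_exp hμ0 _ t hl).trans ?_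
    have e : (fun x => Real.exp (l * (g x - prodExp Ω μ g)))
        = fun x => Real.exp (-(l * prodExp Ω μ g)) * Real.exp (l * g x) := by
      funext x; rw [← Real.exp_add]; ring_nf
    rw [e, prodExp_const_mul, ← mul_assoc, ← Real.exp_add]
    refine (mul_le_mul_of_nonneg_left
      (prodExp_exp_le hμ0 hμ1 g N a₀ h h0 h1 hN hb hl hlb hgN hg hM) (Real.exp_pos _).le).trans_eq ?_
    rw [← Real.exp_add]; ring_nf
  have hneg : ∀ x v a, |(-f (Function.update x v a)) - (-f (Function.update x v a₀))|
      = |f (Function.update x v a) - f (Function.update x v a₀)| := fun x v a => by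
    rw [← abs_neg]; ring_nf
  have t1 := tail f hfN hf
  have t2 := tail (fun x => - f x) (fun v hv x a => by rw [hneg]; exact hfN v hv x a)
    (fun v hv x a => by rw [hneg]; exact hf v hv x a)
  refine (prodProb_le_add hμ0 (E₁ := fun x => t < f x - prodExp Ω μ f)
    (E₂ := fun x => t < - f x - prodExp Ω μ (fun x => - f x)) fun x _ hx => ?_).trans
      (by linarith)
  rw [prodExp_neg]
  rcases lt_abs.1 hx with h | h
  · exact Or.inl h
  · exact Or.inr (by linarith)

end ProductExpectation

section Outcomes

variable {V : Type} [Fintype V] [DecidableEq V]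

/-- The possible values of a single vertex: whether it is activated, and its color. -/
def vertexOutcomes (L : V → Finset ℕ) (v : V) : Finset (Bool × ℕ) := univ ×ˢ L v

/-- The probability weight of a single vertex outcome. -/
noncomputable def vertexWeight (L : V → Finset ℕ) (p : ℝ) (v : V) (a : Bool × ℕ) : ℝ :=
  (if a.1 then p else 1 - p) * ((L v).card : ℝ)⁻¹

/-- The set `A` determined by a combined outcome. -/
def activeSet (x : V → Bool × ℕ) : Finset V := univ.filter fun v => (x v).1 = true

omit [DecidableEq V] in
@[simp]
lemma mem_activeSet {x : V → Bool × ℕ} {v : V} : v ∈ activeSet x ↔ (x v).1 = true := by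
  simp [activeSet]

variable {L : V → Finset ℕ} {p : ℝ}

lemma mem_piFinset_vertexOutcomes {x : V → Bool × ℕ} :
    x ∈ Fintype.piFinset (vertexOutcomes L) ↔ ∀ v, (x v).2 ∈ L v := by
  simp [vertexOutcomes]

lemma expVal_eq_prodExp (X : Finset V → (V → ℕ) → ℝ) :
    expVal L p X = prodExp (vertexOutcomes L) (vertexWeight L p)
      fun x => X (activeSet x) fun v => (x v).2 := by
  unfold expVal prodExp
  rw [← Finset.sum_product']
  refine Finset.sum_nbij' (fun q v => (decide (v ∈ q.1), q.2 v))
    (fun x => (activeSet x, fun v => (x v).2)) ?_ ?_ ?_ ?_ ?_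
  · rintro ⟨A, ψ⟩ h
    rw [mem_piFinset_vertexOutcomes]
    simpa using h
  · intro x h
    simpa [vertexOutcomes] using h
  · rintro ⟨A, ψ⟩ _
    ext <;> simp
  · intro x _
    ext v <;> simp
  · rintro ⟨A, ψ⟩ _
    dsimp only
    have e1 : activeSet (fun v => (decide (v ∈ A), ψ v)) = A := by ext; simp
    rw [e1]
    simp only [vertexWeight, Finset.prod_mul_distrib, decide_eq_true_eq, Finset.prod_ite,
      Finset.prod_const, Finset.filter_mem_eq_inter, Finset.univ_inter]
    rw [show (univ.filter fun v => v ∉ A) = Aᶜ by ext; simp, Finset.card_compl]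
    ring

lemma prEvent_eq_prodProb (E : Finset V → (V → ℕ) → Prop) :
    prEvent L p E = prodProb (vertexOutcomes L) (vertexWeight L p)
      fun x => E (activeSet x) fun v => (x v).2 := by
  classical
  unfold prodProb
  rw [← expVal_eq_prodExp (L := L) (p := p) fun A ψ => if E A ψ then 1 else 0]
  unfold prEvent expVal
  refine Finset.sum_congr rfl fun A _ => Finset.sum_congr rfl fun ψ _ => ?_
  by_cases h : E A ψ <;> simp [h]

omit [Fintype V] [DecidableEq V] in
lemma vertexWeight_nonneg (hp0 : 0 ≤ p) (hp1 : p ≤ 1) (v : V) (a : Bool × ℕ) :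
    0 ≤ vertexWeight L p v a := by
  unfold vertexWeight
  split_ifs
  · positivity
  · have : 0 ≤ 1 - p := by linarith
    positivity

omit [Fintype V] [DecidableEq V] in
lemma sum_vertexWeight_mul (v : V) (g : ℕ → ℝ) :
    ∑ a ∈ vertexOutcomes L v, vertexWeight L p v a * g a.2
      = ((L v).card : ℝ)⁻¹ * ∑ c ∈ L v, g c := by
  rw [vertexOutcomes, Finset.sum_product, Fintype.sum_bool, ← Finset.sum_add_distrib,
    Finset.mul_sum]
  refine Finset.sum_congr rfl fun c _ => ?_
  simp [vertexWeight]; ring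

omit [Fintype V] [DecidableEq V] in
lemma sum_vertexWeight {Λ : ℕ} (hΛ : 0 < Λ) (hL : ∀ v, (L v).card = Λ) (v : V) :
    ∑ a ∈ vertexOutcomes L v, vertexWeight L p v a = 1 := by
  have := sum_vertexWeight_mul (L := L) (p := p) v fun _ => 1
  simp only [mul_one] at this
  rw [this, Finset.sum_const, hL]
  have : (Λ : ℝ) ≠ 0 := by positivity
  simp [this]

/-- Concentration of a function of `(A, ψ)` that moves by at most `b` when a vertex of `N`
changes, and, when a vertex `v` outside of `N` changes, only if its color lies in `Q v`. -/
lemma prodProb_abs_sub_le_exp (hp0 : 0 ≤ p) (hp1 : p ≤ 1) {Λ : ℕ} (hΛ : 0 < Λ)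
    (hL : ∀ v, (L v).card = Λ) (f : (V → Bool × ℕ) → ℝ) (N : Finset V) (a₀ : Bool × ℕ)
    (Q : V → (V → Bool × ℕ) → Finset ℕ)
    (hQ : ∀ v x y, (∀ u ∈ N, x u = y u) → Q v x = Q v y) {b M t : ℝ}
    (hb : 0 < b) (hM : 0 < M) (ht : 0 ≤ t) (htM : t ≤ 8 * b * M)
    (hfN : ∀ v ∈ N, ∀ x a, |f (Function.update x v a) - f (Function.update x v a₀)| ≤ b)
    (hf : ∀ v ∉ N, ∀ x a,
      |f (Function.update x v a) - f (Function.update x v a₀)| ≤ if a.2 ∈ Q v x then b else 0)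
    (hQM : ∀ x, ∑ v ∈ Nᶜ, ((L v ∩ Q v x).card : ℝ) ≤ M * Λ) (hNM : (N.card : ℝ) ≤ M) :
    prodProb (vertexOutcomes L) (vertexWeight L p)
        (fun x => t < |f x - prodExp (vertexOutcomes L) (vertexWeight L p) f|)
      ≤ 2 * Real.exp (-(t ^ 2 / (32 * b ^ 2 * M))) := by
  have hΛ' : (0 : ℝ) < Λ := by exact_mod_cast hΛ
  set l := t / (16 * b ^ 2 * M) with hl
  have hl0 : 0 ≤ l := by positivity
  have hlb : 2 * l * b ≤ 1 := by
    have : 2 * l * b = t / (8 * b * M) := by rw [hl]; field_simp; ring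
    rw [this]
    exact div_le_one_of_le₀ htM (by positivity)
  refine (prodProb_abs_sub_le (vertexWeight_nonneg hp0 hp1) (sum_vertexWeight hΛ hL) f N a₀
    (fun v x a => if a.2 ∈ Q v x then 1 else 0) ?_ ?_ ?_ hb.le hl0 hlb hfN ?_ (M := M) ?_).trans ?_
  · intro v x a; split_ifs <;> norm_num
  · intro v x a; split_ifs <;> norm_num
  · intro v x y a h; rw [hQ v x y h]
  · intro v hv x a
    simpa using hf v hv x a
  · intro x
    have : ∀ v, ∑ a ∈ vertexOutcomes L v, vertexWeight L p v a * (if a.2 ∈ Q v x then 1 else 0)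
        = (Λ : ℝ)⁻¹ * (L v ∩ Q v x).card := fun v => by
      rw [sum_vertexWeight_mul v fun c => if c ∈ Q v x then 1 else 0, hL]
      simp
    simp only [this, ← Finset.mul_sum]
    rw [inv_mul_le_iff₀ hΛ', mul_comm]
    exact hQM x
  · refine mul_le_mul_of_nonneg_left (Real.exp_le_exp.2 ?_) (by norm_num)
    have h1 : 4 * l ^ 2 * b ^ 2 * (M + N.card) ≤ 4 * l ^ 2 * b ^ 2 * (M + M) :=
      mul_le_mul_of_nonneg_left (by linarith) (by positivity)
    have h2 : -(l * t) + 4 * l ^ 2 * b ^ 2 * (M + M) = -(t ^ 2 / (32 * b ^ 2 * M)) := by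
      rw [hl]; field_simp; ring
    linarith

/-- The number of vertices in excess of `k` in the color classes of `N`. -/
def colorExcess (N : Finset V) (Γ : Finset ℕ) (k : ℕ) (x : V → Bool × ℕ) : ℕ :=
  ∑ c ∈ Γ, ((N.filter fun u => (x u).2 = c).card - k)

lemma prodExp_exp_colorExcess_le (hp0 : 0 ≤ p) (hp1 : p ≤ 1) {Λ : ℕ} (hΛ : 0 < Λ)
    (hL : ∀ v, (L v).card = Λ) (N : Finset V) (hN : N.card ≤ Λ) (Γ : Finset ℕ) (k : ℕ) :
    prodExp (vertexOutcomes L) (vertexWeight L p) (fun x => Real.exp (colorExcess N Γ k x))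
      ≤ Real.exp (Γ.card * Real.exp (2 - k)) := by
  have hΛ' : (0 : ℝ) < Λ := by exact_mod_cast hΛ
  have hprod : ∀ T : Finset ℕ, ∀ x : V → Bool × ℕ,
      ∏ c ∈ T, Real.exp ((N.filter fun u => (x u).2 = c).card)
        = ∏ v, if v ∈ N ∧ (x v).2 ∈ T then Real.exp 1 else 1 := by
    intro T x
    have h1 : ∀ c, Real.exp ((N.filter fun u => (x u).2 = c).card)
        = ∏ u ∈ N, if (x u).2 = c then Real.exp 1 else 1 := fun c => by
      rw [Finset.prod_ite, Finset.prod_const, Finset.prod_const_one, mul_one, ← Real.exp_nat_mul,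
        mul_one]
    simp only [h1, ite_and]
    rw [Finset.prod_comm, Finset.prod_ite_mem, Finset.univ_inter]
    exact Finset.prod_congr rfl fun u _ => Finset.prod_ite_eq T _ _
  have hmean : ∀ T : Finset ℕ, prodExp (vertexOutcomes L) (vertexWeight L p)
      (fun x => ∏ c ∈ T, Real.exp ((N.filter fun u => (x u).2 = c).card))
        ≤ Real.exp 2 ^ T.card := by
    intro T
    simp only [hprod]
    rw [prodExp_prod fun v (a : Bool × ℕ) => if v ∈ N ∧ a.2 ∈ T then Real.exp 1 else 1]
    have hv : ∀ v, ∑ a ∈ vertexOutcomes L v, vertexWeight L p v a *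
        (if v ∈ N ∧ a.2 ∈ T then Real.exp 1 else 1)
          ≤ if v ∈ N then Real.exp (2 * T.card / Λ) else 1 := by
      intro v
      rw [sum_vertexWeight_mul v fun c => if v ∈ N ∧ c ∈ T then Real.exp 1 else 1, hL]
      by_cases hvN : v ∈ N
      · simp only [hvN, true_and, if_true]
        have h1 : ∑ c ∈ L v, (if c ∈ T then Real.exp 1 else 1)
            = Λ + (Real.exp 1 - 1) * (L v ∩ T).card := by
          have : ∀ c, (if c ∈ T then Real.exp 1 else 1)
              = 1 + (if c ∈ T then Real.exp 1 - 1 else 0) := fun c => by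
            split_ifs <;> ring
          simp only [this, Finset.sum_add_distrib, ← Finset.sum_filter,
            Finset.filter_mem_eq_inter, Finset.sum_const, hL]
          simp; ring
        have h2 : ((L v ∩ T).card : ℝ) ≤ T.card := by
          exact_mod_cast Finset.card_le_card Finset.inter_subset_right
        have h3 : (Real.exp 1 - 1) * ((L v ∩ T).card : ℝ) ≤ 2 * T.card := by
          have := Real.exp_one_lt_d9
          nlinarith [Nat.cast_nonneg (α := ℝ) (L v ∩ T).card]
        rw [h1]
        calc (Λ : ℝ)⁻¹ * (Λ + (Real.exp 1 - 1) * (L v ∩ T).card)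
            ≤ (Λ : ℝ)⁻¹ * (Λ + 2 * T.card) := by gcongr
          _ = 2 * T.card / Λ + 1 := by field_simp; ring
          _ ≤ _ := Real.add_one_le_exp _
      · simp [hvN, hL, hΛ'.ne']
    calc _ ≤ ∏ v, (if v ∈ N then Real.exp (2 * T.card / Λ) else 1) := by
          refine Finset.prod_le_prod (fun v _ => Finset.sum_nonneg fun a _ =>
            mul_nonneg (vertexWeight_nonneg hp0 hp1 v a) ?_) fun v _ => hv v
          split_ifs <;> positivity
      _ = Real.exp (N.card * (2 * T.card / Λ)) := by
          rw [Finset.prod_ite_mem, Finset.univ_inter, Finset.prod_const, Real.exp_nat_mul]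
      _ ≤ Real.exp (T.card * 2) := by
          refine Real.exp_le_exp.2 ?_
          have : (N.card : ℝ) ≤ Λ := by exact_mod_cast hN
          rw [mul_div_assoc', div_le_iff₀ hΛ']
          nlinarith [Nat.cast_nonneg (α := ℝ) T.card]
      _ = _ := Real.exp_nat_mul _ _
  have hpt : ∀ x : V → Bool × ℕ, Real.exp (colorExcess N Γ k x)
      ≤ ∑ T ∈ Γ.powerset, Real.exp (-k) ^ T.card *
          ∏ c ∈ T, Real.exp ((N.filter fun u => (x u).2 = c).card) := by
    intro x
    have : ∀ T : Finset ℕ, Real.exp (-k) ^ T.card *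
          ∏ c ∈ T, Real.exp ((N.filter fun u => (x u).2 = c).card)
        = ∏ c ∈ T, Real.exp (-k) * Real.exp ((N.filter fun u => (x u).2 = c).card) := fun T => by
      rw [Finset.prod_mul_distrib, Finset.prod_const]
    simp only [this]
    rw [← Finset.prod_one_add, colorExcess, Nat.cast_sum, Real.exp_sum]
    refine Finset.prod_le_prod (fun _ _ => (Real.exp_pos _).le) fun c _ => ?_
    set n := (N.filter fun u => (x u).2 = c).card
    rw [← Real.exp_add]
    rcases le_total n k with h | h
    · simp [Nat.sub_eq_zero_of_le h, (Real.exp_pos _).le]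
    · rw [Nat.cast_sub h, neg_add_eq_sub]
      linarith
  calc _ ≤ ∑ T ∈ Γ.powerset, Real.exp (-k) ^ T.card *
          prodExp (vertexOutcomes L) (vertexWeight L p) (fun x =>
            ∏ c ∈ T, Real.exp ((N.filter fun u => (x u).2 = c).card)) := by
        simp only [← prodExp_const_mul, ← prodExp_sum]
        exact prodExp_mono (vertexWeight_nonneg hp0 hp1) fun x _ => hpt x
    _ ≤ ∑ T ∈ Γ.powerset, ∏ c ∈ T, Real.exp (2 - k) := by
        refine Finset.sum_le_sum fun T _ => ?_
        rw [Finset.prod_const, sub_eq_neg_add, Real.exp_add, mul_pow]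
        exact mul_le_mul_of_nonneg_left (hmean T) (by positivity)
    _ = (1 + Real.exp (2 - k)) ^ Γ.card := by
        rw [← Finset.prod_one_add, Finset.prod_const]
    _ ≤ Real.exp (Real.exp (2 - k)) ^ Γ.card := by
        gcongr
        linarith [Real.add_one_le_exp (Real.exp (2 - k))]
    _ = _ := (Real.exp_nat_mul _ _).symm

end Outcomes

section GraphVariables

lemma abs_card_sub_card_le {β : Type*} [DecidableEq β] {A B T : Finset β} (h₁ : A ⊆ B ∪ T)
    (h₂ : B ⊆ A ∪ T) : |(A.card : ℝ) - B.card| ≤ T.card := by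
  have h1 : (A.card : ℝ) ≤ B.card + T.card := by
    exact_mod_cast (Finset.card_le_card h₁).trans (Finset.card_union_le _ _)
  have h2 : (B.card : ℝ) ≤ A.card + T.card := by
    exact_mod_cast (Finset.card_le_card h₂).trans (Finset.card_union_le _ _)
  rw [abs_le]
  constructor <;> linarith

variable {V : Type} [Fintype V] [DecidableEq V] {L : V → Finset ℕ} {p : ℝ} {Λ M : ℕ}
  {Gu Gi : SimpleGraph V}

omit [DecidableEq V] in
open Classical in
lemma sum_card_filter_adj_le
    (hdeg : ∀ u, ∀ c ∈ L u, (univ.filter fun w => Gu.Adj w u ∧ c ∈ L w).card ≤ M)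
    (N : Finset V) (col : V → ℕ) :
    ∑ w, (N.filter fun u => Gu.Adj w u ∧ col u ∈ L u ∧ col u ∈ L w).card ≤ N.card * M := by
  simp only [Finset.card_filter]
  rw [Finset.sum_comm]
  refine Finset.sum_le_card_nsmul _ _ _ fun u _ => ?_
  rw [← Finset.card_filter]
  by_cases hu : col u ∈ L u
  · refine (Finset.card_le_card ?_).trans (hdeg u _ hu)
    intro w
    simp only [Finset.mem_filter]
    tauto
  · simp [hu]

open Classical in
lemma rvR_prob_le (hp0 : 0 ≤ p) (hp1 : p ≤ 1) (hΛ : 0 < Λ) (hL : ∀ v, (L v).card = Λ)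
    (hdeg : ∀ u, ∀ c ∈ L u, (univ.filter fun w => Gu.Adj w u ∧ c ∈ L w).card ≤ M)
    (hM : 0 < M) {b t : ℝ} (hb : 1 ≤ b) (ht : 0 ≤ t) (htM : t ≤ 8 * b * M) (v : V) :
    prEvent L p (fun A ψ => t < |rvR Gu L v A ψ - expVal L p (rvR Gu L v)|)
      ≤ 2 * Real.exp (-(t ^ 2 / (32 * b ^ 2 * M))) := by
  rw [prEvent_eq_prodProb, expVal_eq_prodExp]
  refine prodProb_abs_sub_le_exp hp0 hp1 hΛ hL
    (fun x => rvR Gu L v (activeSet x) fun v => (x v).2) ∅ (false, 0)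
    (fun w _ => if Gu.Adj w v then L v else ∅) (by simp) (by linarith) (by exact_mod_cast hM)
    ht htM (by simp) ?_ ?_ (by simp)
  · intro w _ x a
    unfold rvR keptList
    refine (abs_card_sub_card_le
      (T := if a.2 ∈ (if Gu.Adj w v then L v else ∅) then {a.2} else ∅) ?_ ?_).trans ?_
    · intro c hc
      simp only [Finset.mem_filter, Finset.mem_union, mem_activeSet] at hc ⊢
      refine Or.inl ⟨hc.1, fun u huv hu => ?_⟩
      by_cases h : u = w
      · subst h; simp at hu
      · have := hc.2 u huv
        simp only [Function.update_of_ne h] at this hu ⊢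
        exact this hu
    · intro c hc
      simp only [Finset.mem_filter, Finset.mem_union, mem_activeSet] at hc ⊢
      by_contra! hcon
      obtain ⟨h1, h2⟩ := hcon
      obtain ⟨u, huv, hu, huc⟩ := h1 hc.1
      by_cases h : u = w
      · subst h
        simp only [Function.update_self] at huc
        subst huc
        simp [hc.1, huv.symm] at h2
      · have := hc.2 u huv
        simp only [Function.update_of_ne h] at this hu huc
        exact this hu huc
    · split_ifs <;> simp <;> linarith
  · intro x
    have h1 : ∀ w, (L w ∩ if Gu.Adj w v then L v else ∅).card
        = ∑ c ∈ L v, if Gu.Adj w v ∧ c ∈ L w then 1 else 0 := fun w => by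
      rw [← Finset.card_filter]
      congr 1
      ext c
      by_cases h : Gu.Adj w v <;> simp [h, and_comm]
    have h2 : ∑ w, (L w ∩ if Gu.Adj w v then L v else ∅).card ≤ M * Λ := by
      simp only [h1]
      rw [Finset.sum_comm, ← hL v, mul_comm]
      refine Finset.sum_le_card_nsmul _ _ _ fun c hc => ?_
      rw [← Finset.card_filter]
      exact hdeg v c hc
    rw [Finset.compl_empty]
    exact_mod_cast h2

open Classical in
lemma rvK_prob_le [DecidableRel Gi.Adj] (hp0 : 0 ≤ p) (hp1 : p ≤ 1) (hΛ : 0 < Λ)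
    (hL : ∀ v, (L v).card = Λ)
    (hdeg : ∀ u, ∀ c ∈ L u, (univ.filter fun w => Gu.Adj w u ∧ c ∈ L w).card ≤ M)
    (hM : 0 < M) {b t : ℝ} (hb : 1 ≤ b) (ht : 0 ≤ t) (htM : t ≤ 8 * b * M) (Si : Finset V)
    (v : V) (c : ℕ) (hSi : ∀ u, Gi.Adj v u → u ∈ Si)
    (hout : ∀ w ∉ Si, ((Si.filter fun u => Gu.Adj w u).card : ℝ) ≤ b)
    (hNΛ : ((Gi.neighborFinset v).filter fun u => c ∈ L u).card ≤ Λ)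
    (hNM : ((Gi.neighborFinset v).filter fun u => c ∈ L u).card ≤ M) :
    prEvent L p (fun A ψ => t < |rvK Gu Gi L Si v c A ψ - expVal L p (rvK Gu Gi L Si v c)|)
      ≤ 2 * Real.exp (-(t ^ 2 / (32 * b ^ 2 * M))) := by
  rw [prEvent_eq_prodProb, expVal_eq_prodExp]
  set N := (Gi.neighborFinset v).filter fun u => c ∈ L u with hN
  have hNS : N ⊆ Si := fun u hu => hSi u (by simpa using (Finset.mem_filter.1 hu).1)
  have hNc : ∀ u ∈ N, c ∈ L u := fun u hu => (Finset.mem_filter.1 hu).2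
  have hK : ∀ x : V → Bool × ℕ, rvK Gu Gi L Si v c (activeSet x) (fun v => (x v).2)
      = (N.filter fun u => (x u).1 = false ∧
          ¬∃ w, (x w).1 = true ∧ w ∉ Si ∧ (x w).2 = c ∧ Gu.Adj w u).card := fun x => by
    unfold rvK
    rw [hN, Finset.filter_filter]
    simp only [mem_activeSet, Bool.not_eq_true]
  simp only [hK]
  refine prodProb_abs_sub_le_exp hp0 hp1 hΛ hL
    (fun x => ((N.filter fun u => (x u).1 = false ∧
          ¬∃ w, (x w).1 = true ∧ w ∉ Si ∧ (x w).2 = c ∧ Gu.Adj w u).card : ℝ)) N (false, 0)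
    (fun w _ => if w ∉ Si ∧ ∃ u ∈ N, Gu.Adj w u then {c} else ∅) (by simp) (by linarith)
    (by exact_mod_cast hM) ht htM ?_ ?_ ?_ (by exact_mod_cast hNM)
  · intro u hu x a
    have hne : ∀ w ∉ Si, w ≠ u := by rintro w hw rfl; exact hw (hNS hu)
    have hex : ∀ a u', (∃ w, (Function.update x u a w).1 = true ∧ w ∉ Si ∧
        (Function.update x u a w).2 = c ∧ Gu.Adj w u') ↔
        (∃ w, (x w).1 = true ∧ w ∉ Si ∧ (x w).2 = c ∧ Gu.Adj w u') := fun a u' => by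
      refine exists_congr fun w => ?_
      by_cases hw : w ∈ Si
      · simp [hw]
      · rw [Function.update_of_ne (hne w hw)]
    simp only [hex]
    refine (abs_card_sub_card_le (T := {u}) ?_ ?_).trans (by simpa using hb)
    all_goals
      intro u' hu'
      by_cases h : u' = u
      · simp [h]
      · simpa [h] using hu'
  · intro w hw x a
    have hself : ∀ a, ∀ u ∈ N, Function.update x w a u = x u := fun a u hu => by
      rw [Function.update_of_ne]
      rintro rfl
      exact hw hu
    refine (abs_card_sub_card_le
      (T := if a.2 = c ∧ w ∉ Si then N.filter fun u => Gu.Adj w u else ∅) ?_ ?_).trans ?_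
    · intro u hu
      simp only [Finset.mem_filter, Finset.mem_union] at hu ⊢
      refine Or.inl ⟨hu.1, by simpa only [hself _ u hu.1] using hu.2.1, ?_⟩
      rintro ⟨w', h1, h2⟩
      by_cases h : w' = w
      · subst h; simp at h1
      · refine hu.2.2 ⟨w', ?_⟩
        rw [Function.update_of_ne h] at h1 h2 ⊢
        exact ⟨h1, h2⟩
    · intro u hu
      rw [Finset.mem_union, or_iff_not_imp_right]
      intro hT
      simp only [Finset.mem_filter] at hu ⊢
      refine ⟨hu.1, by simpa only [hself _ u hu.1] using hu.2.1, ?_⟩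
      rintro ⟨w', h1, h2, h3, h4⟩
      by_cases h : w' = w
      · subst h
        rw [Function.update_self] at h3
        simp [h3, h2, hu.1, h4] at hT
      · refine hu.2.2 ⟨w', ?_⟩
        rw [Function.update_of_ne h] at h1 h3 ⊢
        exact ⟨h1, h2, h3, h4⟩
    · by_cases h : a.2 = c ∧ w ∉ Si
      · rw [if_pos h]
        by_cases h' : ∃ u ∈ N, Gu.Adj w u
        · simp only [h.1, h.2, h', not_false_eq_true, and_self, if_true, Finset.mem_singleton]
          refine le_trans ?_ (hout w h.2)
          exact_mod_cast Finset.card_le_card (Finset.filter_subset_filter _ hNS)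
        · have : (N.filter fun u => Gu.Adj w u) = ∅ := by
            rw [Finset.filter_eq_empty_iff]
            exact fun u hu hadj => h' ⟨u, hu, hadj⟩
          rw [this]
          simp [h']
      · rw [if_neg h]
        simp only [Finset.card_empty, Nat.cast_zero]
        split_ifs <;> linarith
  · intro x
    have h1 : ∀ w, (L w ∩ if w ∉ Si ∧ ∃ u ∈ N, Gu.Adj w u then {c} else ∅).card
        ≤ (N.filter fun u => Gu.Adj w u ∧ c ∈ L u ∧ c ∈ L w).card := fun w => by
      split_ifs with h
      · by_cases hc : c ∈ L w
        · obtain ⟨u, hu, hadj⟩ := h.2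
          refine (Finset.card_le_card Finset.inter_subset_right).trans ?_
          rw [Finset.card_singleton, Nat.one_le_iff_ne_zero, ← Nat.pos_iff_ne_zero,
            Finset.card_pos]
          exact ⟨u, by simp [hu, hadj, hc, hNc u hu]⟩
        · simp [hc]
      · simp
    have h2 : ∑ w ∈ Nᶜ, (L w ∩ if w ∉ Si ∧ ∃ u ∈ N, Gu.Adj w u then {c} else ∅).card
        ≤ M * Λ := by
      refine (Finset.sum_le_univ_sum_of_nonneg fun _ => Nat.zero_le _).trans ?_
      refine (Finset.sum_le_sum fun w _ => h1 w).trans ?_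
      refine (sum_card_filter_adj_le hdeg N fun _ => c).trans ?_
      rw [mul_comm]
      exact Nat.mul_le_mul_left M hNΛ
    exact_mod_cast h2

open Classical in
/-- The activated vertices of `N` with color `c` in their list that receive `c` and lose it to
an activated neighbor. -/
noncomputable def uncoloredIn (Gu : SimpleGraph V) (L : V → Finset ℕ) (N : Finset V) (c : ℕ)
    (x : V → Bool × ℕ) : Finset V :=
  N.filter fun u => c ∈ L u ∧ (x u).1 = true ∧ (x u).2 = c ∧
    ∃ w, Gu.Adj w u ∧ (x w).1 = true ∧ (x w).2 = c

/-- The number of vertices counted by `uncoloredIn`, with each color counted at most `k` times. -/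
noncomputable def truncUncolored (Gu : SimpleGraph V) (L : V → Finset ℕ) (N : Finset V)
    (Γ : Finset ℕ) (k : ℕ) (x : V → Bool × ℕ) : ℝ :=
  ∑ c ∈ Γ, ((min k (uncoloredIn Gu L N c x).card : ℕ) : ℝ)

lemma uncoloredIn_update (N : Finset V) {c : ℕ} {w : V} (x : V → Bool × ℕ) {a : Bool × ℕ}
    (h : a.2 = c → w ∉ N ∧ ∀ u ∈ N, Gu.Adj w u → c ∈ L u → (x u).2 ≠ c) :
    uncoloredIn Gu L N c (Function.update x w a)
      = uncoloredIn Gu L N c (Function.update x w (false, 0)) := by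
  ext u
  simp only [uncoloredIn, Finset.mem_filter]
  refine and_congr_right fun hu => and_congr_right fun hc => ?_
  by_cases hac : a.2 = c
  · obtain ⟨hw, h⟩ := h hac
    have hne : u ≠ w := by rintro rfl; exact hw hu
    rw [Function.update_of_ne hne, Function.update_of_ne hne]
    refine and_congr_right fun _ => and_congr_right fun huc => exists_congr fun w' => ?_
    by_cases hw' : w' = w
    · subst hw'
      have : ¬ Gu.Adj w' u := fun hadj => h u hu hadj hc huc
      simp [this]
    · rw [Function.update_of_ne hw', Function.update_of_ne hw']
  · have key : ∀ w', ((Function.update x w a w').1 = true ∧ (Function.update x w a w').2 = c) ↔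
        ((Function.update x w (false, 0) w').1 = true ∧
          (Function.update x w (false, 0) w').2 = c) := fun w' => by
      by_cases hw' : w' = w
      · subst hw'; simp [hac]
      · rw [Function.update_of_ne hw', Function.update_of_ne hw']
    rw [← and_assoc, ← and_assoc, key]
    refine and_congr_right fun _ => exists_congr fun w' => and_congr_right fun _ => key w'

lemma abs_truncUncolored_update_sub_le (N : Finset V) (Γ : Finset ℕ) (k : ℕ) (w : V)
    (x : V → Bool × ℕ) (a : Bool × ℕ) :
    |truncUncolored Gu L N Γ k (Function.update x w a)
      - truncUncolored Gu L N Γ k (Function.update x w (false, 0))| ≤ k := by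
  unfold truncUncolored
  rw [← Finset.sum_sub_distrib]
  refine (Finset.abs_sum_le_sum_abs _ _).trans ?_
  refine (Finset.sum_le_sum (g := fun c => if a.2 = c then (k : ℝ) else 0) fun c _ => ?_).trans ?_
  · split_ifs with h
    · rw [abs_le]
      have h1 : ((min k (uncoloredIn Gu L N c (Function.update x w a)).card : ℕ) : ℝ) ≤ k := by
        exact_mod_cast min_le_left _ _
      have h2 : ((min k (uncoloredIn Gu L N c (Function.update x w (false, 0))).card : ℕ) : ℝ)
          ≤ k := by
        exact_mod_cast min_le_left _ _
      constructor <;> linarith [Nat.cast_nonneg (α := ℝ)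
        (min k (uncoloredIn Gu L N c (Function.update x w a)).card), Nat.cast_nonneg (α := ℝ)
        (min k (uncoloredIn Gu L N c (Function.update x w (false, 0))).card)]
    · rw [uncoloredIn_update N x fun h' => absurd h' h]
      simp
  · rw [Finset.sum_ite_eq]
    split_ifs <;> simp

open Classical in
lemma abs_truncUncolored_update_sub_le_ite {N : Finset V} (Γ : Finset ℕ) (k : ℕ) {w : V}
    (hw : w ∉ N) (x : V → Bool × ℕ) (a : Bool × ℕ) :
    |truncUncolored Gu L N Γ k (Function.update x w a)
      - truncUncolored Gu L N Γ k (Function.update x w (false, 0))|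
      ≤ if a.2 ∈ (N.filter fun u => Gu.Adj w u ∧ (x u).2 ∈ L u).image (fun u => (x u).2)
        then (k : ℝ) else 0 := by
  split_ifs with h
  · exact abs_truncUncolored_update_sub_le N Γ k w x a
  · have : ∀ c, uncoloredIn Gu L N c (Function.update x w a)
        = uncoloredIn Gu L N c (Function.update x w (false, 0)) := fun c => by
      refine uncoloredIn_update N x ?_
      rintro rfl
      refine ⟨hw, fun u hu hadj hL hx => h ?_⟩
      exact Finset.mem_image.2 ⟨u, by simp [hu, hadj, hx, hL], hx⟩
    simp [truncUncolored, this]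

open Classical in
lemma truncUncolored_prob_le (hp0 : 0 ≤ p) (hp1 : p ≤ 1) (hΛ : 0 < Λ) (hL : ∀ v, (L v).card = Λ)
    (hdeg : ∀ u, ∀ c ∈ L u, (univ.filter fun w => Gu.Adj w u ∧ c ∈ L w).card ≤ M)
    (hM : 0 < M) {k : ℕ} {t : ℝ} (hk : 0 < k) (ht : 0 ≤ t) (htM : t ≤ 8 * k * M)
    {N : Finset V} (Γ : Finset ℕ) (hNΛ : N.card ≤ Λ) (hNM : N.card ≤ M) :
    prodProb (vertexOutcomes L) (vertexWeight L p) (fun x => t < |truncUncolored Gu L N Γ k x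
        - prodExp (vertexOutcomes L) (vertexWeight L p) (truncUncolored Gu L N Γ k)|)
      ≤ 2 * Real.exp (-(t ^ 2 / (32 * k ^ 2 * M))) := by
  refine prodProb_abs_sub_le_exp hp0 hp1 hΛ hL _ N (false, 0)
    (fun w x => (N.filter fun u => Gu.Adj w u ∧ (x u).2 ∈ L u).image fun u => (x u).2) ?_
    (by exact_mod_cast hk) (by exact_mod_cast hM) ht htM
    (fun w _ x a => abs_truncUncolored_update_sub_le N Γ k w x a)
    (fun w hw x a => abs_truncUncolored_update_sub_le_ite Γ k hw x a) ?_ (by exact_mod_cast hNM)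
  · intro w x y hxy
    rw [Finset.filter_congr (q := fun u => Gu.Adj w u ∧ (y u).2 ∈ L u)
      fun u hu => by rw [hxy u hu]]
    exact Finset.image_congr fun u hu => by rw [hxy u (Finset.mem_filter.1 hu).1]
  · intro x
    have h1 : ∀ w, (L w ∩ (N.filter fun u => Gu.Adj w u ∧ (x u).2 ∈ L u).image
        fun u => (x u).2).card
        ≤ (N.filter fun u => Gu.Adj w u ∧ (x u).2 ∈ L u ∧ (x u).2 ∈ L w).card := fun w => by
      refine (Finset.card_le_card ?_).trans
        (Finset.card_image_le (f := fun u => (x u).2))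
      intro c hc
      simp only [Finset.mem_inter, Finset.mem_image, Finset.mem_filter] at hc ⊢
      obtain ⟨hcw, u, hu, rfl⟩ := hc
      exact ⟨u, ⟨hu.1, hu.2.1, hu.2.2, hcw⟩, rfl⟩
    have h2 : ∑ w ∈ Nᶜ, (L w ∩ (N.filter fun u => Gu.Adj w u ∧ (x u).2 ∈ L u).image
        fun u => (x u).2).card ≤ M * Λ := by
      refine (Finset.sum_le_univ_sum_of_nonneg fun _ => Nat.zero_le _).trans ?_
      refine (Finset.sum_le_sum fun w _ => h1 w).trans ?_
      refine (sum_card_filter_adj_le hdeg N fun u => (x u).2).trans ?_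
      rw [mul_comm]
      exact Nat.mul_le_mul_left M hNΛ
    exact_mod_cast h2

lemma rvU_eq_sum_uncoloredIn [DecidableRel Gi.Adj] (v : V) (c : ℕ) {x : V → Bool × ℕ}
    (hx : ∀ u, (x u).2 ∈ L u) {N : Finset V}
    (hN : N = (Gi.neighborFinset v).filter fun u => c ∈ L u) :
    rvU Gu Gi L v c (activeSet x) (fun u => (x u).2)
      = ∑ c' ∈ N.biUnion L, ((uncoloredIn Gu L N c' x).card : ℝ) := by
  classical
  have h1 : rvU Gu Gi L v c (activeSet x) (fun u => (x u).2)
      = (N.filter fun u => (x u).1 = true ∧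
          ∃ w, Gu.Adj w u ∧ (x w).1 = true ∧ (x w).2 = (x u).2).card := by
    unfold rvU
    rw [hN, Finset.filter_filter]
    congr 2
    refine Finset.filter_congr fun u _ => ?_
    simp only [keptSet, keptList, mem_activeSet, Finset.mem_filter, hx u, true_and]
    refine and_congr_right fun _ => and_congr_right fun hu => ?_
    simp only [hu, true_and]
    push Not
    simp only [Gu.adj_comm]
  rw [h1, Finset.card_eq_sum_card_fiberwise (t := N.biUnion L) (f := fun u => (x u).2)]
  · push_cast
    refine Finset.sum_congr rfl fun c' _ => ?_
    congr 2
    ext u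
    simp only [uncoloredIn, Finset.mem_filter]
    constructor
    · rintro ⟨⟨h1, h2, h3⟩, rfl⟩
      exact ⟨h1, hx u, h2, rfl, h3⟩
    · rintro ⟨h1, -, h2, rfl, h3⟩
      exact ⟨⟨h1, h2, h3⟩, rfl⟩
  · intro u hu
    have hu' := (Finset.mem_filter.1 (Finset.mem_coe.1 hu)).1
    exact Finset.mem_coe.2 (Finset.mem_biUnion.2 ⟨u, hu', hx u⟩)

omit [DecidableEq V] in
lemma truncUncolored_le_sum (N : Finset V) (Γ : Finset ℕ) (k : ℕ) (x : V → Bool × ℕ) :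
    truncUncolored Gu L N Γ k x ≤ ∑ c ∈ Γ, ((uncoloredIn Gu L N c x).card : ℝ) :=
  Finset.sum_le_sum fun _ _ => by exact_mod_cast min_le_right _ _

omit [DecidableEq V] in
lemma sum_le_truncUncolored_add (N : Finset V) (Γ : Finset ℕ) (k : ℕ) (x : V → Bool × ℕ) :
    ∑ c ∈ Γ, ((uncoloredIn Gu L N c x).card : ℝ)
      ≤ truncUncolored Gu L N Γ k x + colorExcess N Γ k x := by
  unfold truncUncolored colorExcess
  rw [Nat.cast_sum, ← Finset.sum_add_distrib]
  refine Finset.sum_le_sum fun c _ => ?_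
  have : (uncoloredIn Gu L N c x).card ≤ (N.filter fun u => (x u).2 = c).card := by
    refine Finset.card_le_card fun u hu => ?_
    simp only [uncoloredIn, Finset.mem_filter] at hu ⊢
    exact ⟨hu.1, hu.2.2.2.1⟩
  norm_cast
  omega

open Classical in
lemma rvU_prob_le [DecidableRel Gi.Adj] (hp0 : 0 ≤ p) (hp1 : p ≤ 1) (hΛ : 0 < Λ)
    (hL : ∀ v, (L v).card = Λ)
    (hdeg : ∀ u, ∀ c ∈ L u, (univ.filter fun w => Gu.Adj w u ∧ c ∈ L w).card ≤ M)
    (hM : 0 < M) {k : ℕ} {t : ℝ} (hk : 0 < k) (ht : 0 ≤ t) (htM : t ≤ 8 * k * M)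
    (v : V) (c : ℕ)
    (hNΛ : ((Gi.neighborFinset v).filter fun u => c ∈ L u).card ≤ Λ)
    (hNM : ((Gi.neighborFinset v).filter fun u => c ∈ L u).card ≤ M)
    (hkΛ : (Λ : ℝ) * Λ * Real.exp (2 - k) ≤ 1) :
    prEvent L p (fun A ψ => 2 * t < |rvU Gu Gi L v c A ψ - expVal L p (rvU Gu Gi L v c)|)
      ≤ 2 * Real.exp (-(t ^ 2 / (32 * k ^ 2 * M))) + Real.exp (4 - t) := by
  rw [prEvent_eq_prodProb, expVal_eq_prodExp]
  set N := (Gi.neighborFinset v).filter fun u => c ∈ L u with hN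
  set Γ := N.biUnion L
  set f := truncUncolored Gu L N Γ k with hf
  set Ef := prodExp (vertexOutcomes L) (vertexWeight L p) f with hEf
  set U : (V → Bool × ℕ) → ℝ := fun x => rvU Gu Gi L v c (activeSet x) fun u => (x u).2 with hU
  set Z : (V → Bool × ℕ) → ℝ := fun x => colorExcess N Γ k x with hZ
  have hμ0 := vertexWeight_nonneg (L := L) hp0 hp1
  have hfU : ∀ x ∈ Fintype.piFinset (vertexOutcomes L), f x ≤ U x := fun x hx => by
    rw [hU]
    dsimp only
    rw [rvU_eq_sum_uncoloredIn v c (mem_piFinset_vertexOutcomes.1 hx) hN]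
    exact truncUncolored_le_sum N Γ k x
  have hUf : ∀ x ∈ Fintype.piFinset (vertexOutcomes L), U x ≤ f x + Z x := fun x hx => by
    rw [hU]
    dsimp only
    rw [rvU_eq_sum_uncoloredIn v c (mem_piFinset_vertexOutcomes.1 hx) hN]
    exact sum_le_truncUncolored_add N Γ k x
  have hΓ : (Γ.card : ℝ) ≤ Λ * Λ := by
    have : Γ.card ≤ N.card * Λ := Finset.card_biUnion_le_card_mul _ _ _ fun u _ => (hL u).le
    exact_mod_cast this.trans (Nat.mul_le_mul_right Λ hNΛ)
  have hexp : prodExp (vertexOutcomes L) (vertexWeight L p) (fun x => Real.exp (Z x))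
      ≤ Real.exp 1 := by
    refine (prodExp_exp_colorExcess_le hp0 hp1 hΛ hL N hNΛ Γ k).trans (Real.exp_le_exp.2 ?_)
    exact (mul_le_mul_of_nonneg_right hΓ (Real.exp_pos _).le).trans hkΛ
  have hEZ : prodExp (vertexOutcomes L) (vertexWeight L p) Z ≤ 3 := by
    refine (prodExp_mono hμ0 fun x _ => ?_).trans (hexp.trans ?_)
    · linarith [Real.add_one_le_exp (Z x)]
    · linarith [Real.exp_one_lt_d9]
  have hEU1 : Ef ≤ prodExp (vertexOutcomes L) (vertexWeight L p) U := prodExp_mono hμ0 hfU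
  have hEU2 : prodExp (vertexOutcomes L) (vertexWeight L p) U ≤ Ef + 3 := by
    refine (prodExp_mono hμ0 hUf).trans ?_
    rw [prodExp_add]
    linarith
  refine (prodProb_le_add hμ0 (E₁ := fun x => t < |f x - Ef|) (E₂ := fun x => t - 3 < Z x)
    fun x hx hbig => ?_).trans (add_le_add
      (truncUncolored_prob_le hp0 hp1 hΛ hL hdeg hM hk ht htM Γ hNΛ hNM) ?_)
  · by_contra! hcon
    obtain ⟨h1, h2⟩ := hcon
    have h3 := abs_le.1 h1
    have h4 := hfU x hx
    have h5 := hUf x hx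
    have h6 : |U x - prodExp (vertexOutcomes L) (vertexWeight L p) U| ≤ 2 * t := by
      have hZ0 : 0 ≤ Z x := Nat.cast_nonneg _
      rw [abs_le]
      constructor <;> linarith
    exact absurd hbig (not_lt.2 h6)
  · refine (prodProb_lt_le_exp hμ0 Z (t - 3) zero_le_one).trans ?_
    simp only [one_mul]
    refine (mul_le_mul_of_nonneg_left hexp (Real.exp_pos _).le).trans_eq ?_
    rw [← Real.exp_add]
    ring_nf

end GraphVariables

section Parameters

open Filter in
lemma eventually_truncation_bounds (C : ℕ) (hC : 0 < C) :
    ∀ᶠ D : ℕ in atTop, 1 ≤ Real.log D ∧ 30 * (C : ℝ) ≤ D ∧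
      128 * C * ((⌈4 * Real.log D⌉₊ + C : ℕ) : ℝ) ^ 2 * ((D : ℝ) ^ ((1 : ℝ) / 4) + 2)
        ≤ (D : ℝ) ^ ((1 : ℝ) / 3) := by
  have hlog : ∀ᶠ x : ℝ in atTop, Real.log x ≤ 1 / 8 * x ^ ((1 : ℝ) / 48) := by
    have := (isLittleO_log_rpow_atTop (r := (1 : ℝ) / 48) (by norm_num)).bound
      (c := 1 / 8) (by norm_num)
    filter_upwards [this, eventually_ge_atTop 1] with x hx hx1
    rwa [Real.norm_of_nonneg (Real.log_nonneg hx1),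
      Real.norm_of_nonneg (by positivity)] at hx
  have hp1 := (tendsto_rpow_atTop (y := (1 : ℝ) / 48) (by norm_num)).eventually_ge_atTop
    (2 * (1 + C : ℝ))
  have hp2 := (tendsto_rpow_atTop (y := (1 : ℝ) / 24) (by norm_num)).eventually_ge_atTop
    (384 * C : ℝ)
  have hl1 := Real.tendsto_log_atTop.eventually_ge_atTop 1
  have hreal : ∀ᶠ x : ℝ in atTop, 1 ≤ Real.log x ∧ 30 * (C : ℝ) ≤ x ∧
      128 * C * ((⌈4 * Real.log x⌉₊ + C : ℕ) : ℝ) ^ 2 * (x ^ ((1 : ℝ) / 4) + 2)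
        ≤ x ^ ((1 : ℝ) / 3) := by
    filter_upwards [hlog, hp1, hp2, hl1, eventually_ge_atTop (30 * (C : ℝ)),
      eventually_ge_atTop 1] with x h1 h2 h3 h4 h5 hx
    refine ⟨h4, h5, ?_⟩
    have hx0 : 0 < x := by linarith
    have hk : ((⌈4 * Real.log x⌉₊ + C : ℕ) : ℝ) ≤ x ^ ((1 : ℝ) / 48) := by
      have := Nat.ceil_lt_add_one (show 0 ≤ 4 * Real.log x by linarith)
      push_cast
      linarith
    have hk2 : ((⌈4 * Real.log x⌉₊ + C : ℕ) : ℝ) ^ 2 ≤ x ^ ((1 : ℝ) / 24) := by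
      refine (pow_le_pow_left₀ (Nat.cast_nonneg _) hk 2).trans_eq ?_
      rw [← Real.rpow_natCast, ← Real.rpow_mul hx0.le]
      norm_num
    have h6 : 1 ≤ x ^ ((1 : ℝ) / 4) := Real.one_le_rpow hx (by norm_num)
    calc 128 * C * ((⌈4 * Real.log x⌉₊ + C : ℕ) : ℝ) ^ 2 * (x ^ ((1 : ℝ) / 4) + 2)
        ≤ 128 * C * x ^ ((1 : ℝ) / 24) * (3 * x ^ ((1 : ℝ) / 4)) := by
          gcongr
          linarith
      _ = 384 * C * (x ^ ((1 : ℝ) / 24) * x ^ ((1 : ℝ) / 4)) := by ring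
      _ ≤ x ^ ((1 : ℝ) / 24) * (x ^ ((1 : ℝ) / 24) * x ^ ((1 : ℝ) / 4)) := by gcongr
      _ = x ^ ((1 : ℝ) / 3) := by
          rw [← Real.rpow_add hx0, ← Real.rpow_add hx0]
          norm_num
  exact tendsto_natCast_atTop_atTop.eventually hreal

end Parameters

section UnionGraph

variable {V : Type} [Fintype V] [DecidableEq V] {m : ℕ} {G : Fin m → SimpleGraph V}
  {S : Fin m → Finset V} {L : V → Finset ℕ} {C D : ℕ}

open Classical in
lemma card_filter_iSup_adj_le [∀ i, DecidableRel (G i).Adj]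
    (hS : ∀ i u v, (G i).Adj u v → u ∈ S i ∧ v ∈ S i)
    (hC : ∀ v : V, (univ.filter fun i => v ∈ S i).card = C)
    (hD : ∀ i, ∀ v ∈ S i, ∀ c ∈ L v,
      (((G i).neighborFinset v).filter fun u => c ∈ L u).card = D)
    (u : V) (c : ℕ) (hc : c ∈ L u) :
    (univ.filter fun w => (⨆ i, G i).Adj w u ∧ c ∈ L w).card ≤ C * D := by
  rw [← hC u]
  refine (Finset.card_le_card (t := (univ.filter fun i => u ∈ S i).biUnion fun i =>
    ((G i).neighborFinset u).filter fun w => c ∈ L w) fun w hw => ?_).trans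
    (Finset.card_biUnion_le_card_mul _ _ _ fun i hi => ?_)
  · simp only [Finset.mem_filter, SimpleGraph.iSup_adj, Finset.mem_biUnion, Finset.mem_univ,
      true_and, SimpleGraph.mem_neighborFinset] at hw ⊢
    obtain ⟨⟨i, hi⟩, hcw⟩ := hw
    exact ⟨i, (hS i w u hi).2, hi.symm, hcw⟩
  · exact (hD i u (Finset.mem_filter.1 hi).2 c hc).le

omit [Fintype V] in
open Classical in
lemma card_filter_adj_of_notMem_le
    (hS : ∀ i u v, (G i).Adj u v → u ∈ S i ∧ v ∈ S i)
    (hdisj : ∀ i j, i ≠ j → (S i ∩ S j).card ≤ 1)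
    (hC : ∀ v : V, (univ.filter fun i => v ∈ S i).card = C)
    {i : Fin m} {w : V} (hw : w ∉ S i) :
    ((S i).filter fun u => (⨆ j, G j).Adj w u).card ≤ C := by
  rw [← hC w]
  refine (Finset.card_le_card (t := (univ.filter fun j => w ∈ S j).biUnion fun j =>
    S i ∩ S j) fun u hu => ?_).trans
    ((Finset.card_biUnion_le_card_mul _ _ 1 fun j hj => ?_).trans_eq (mul_one _))
  · simp only [Finset.mem_filter, SimpleGraph.iSup_adj, Finset.mem_biUnion, Finset.mem_univ,
      true_and, Finset.mem_inter] at hu ⊢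
    obtain ⟨hui, j, hj⟩ := hu
    exact ⟨j, (hS j w u hj).1, hui, (hS j w u hj).2⟩
  · refine hdisj i j ?_
    rintro rfl
    exact hw (Finset.mem_filter.1 hj).2

end UnionGraph

open Classical in
/-- **Concentration of the key random variables.**  Under the standing setup, for `C > 0`,
`ε > 0` and sufficiently large `D`, with `(1 + ε)D ≤ Λ ≤ 10CD` and
`(log D)⁻¹ ≥ p ≥ (log D)⁻²`, each of `R_v`, `U_{v,c,i}`, `K_{v,c,i}` deviates from its
expectation by more than `D^{2/3}` with probability at most `exp(-D^{1/4})`. -/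
theorem concentration_lemma (C : ℕ) (hC : 0 < C) (ε : ℝ) (hε : 0 < ε) :
    ∃ D₃ : ℕ, ∀ D : ℕ, D₃ ≤ D →
      ∀ (V : Type) [Fintype V] [DecidableEq V] (m : ℕ) (G : Fin m → SimpleGraph V)
        [∀ i, DecidableRel (G i).Adj] (S : Fin m → Finset V) (L : V → Finset ℕ)
        (Λ : ℕ) (p : ℝ),
        p ≤ (Real.log D)⁻¹ → ((Real.log D) ^ 2)⁻¹ ≤ p →
        (∀ i u v, (G i).Adj u v → u ∈ S i ∧ v ∈ S i) →
        (∀ i j, i ≠ j → (S i ∩ S j).card ≤ 1) →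
        (∀ v : V, (univ.filter fun i => v ∈ S i).card = C) →
        (∀ v : V, (L v).card = Λ) →
        (1 + ε) * D ≤ (Λ : ℝ) → (Λ : ℝ) ≤ 10 * C * D →
        (∀ i, ∀ v ∈ S i, ∀ c ∈ L v,
          (((G i).neighborFinset v).filter fun u => c ∈ L u).card = D) →
        (∀ u w : V, (∃ i, (G i).Adj u w) → (L u ∩ L w).Nonempty) →
        (∀ v : V,
          prEvent L p (fun A ψ =>
              (D : ℝ) ^ ((2 : ℝ) / 3) <
                |rvR (⨆ i, G i) L v A ψ - expVal L p (rvR (⨆ i, G i) L v)|)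
            ≤ Real.exp (-(D : ℝ) ^ ((1 : ℝ) / 4))) ∧
        (∀ i : Fin m, ∀ v ∈ S i, ∀ c ∈ L v,
          prEvent L p (fun A ψ =>
              (D : ℝ) ^ ((2 : ℝ) / 3) <
                |rvU (⨆ j, G j) (G i) L v c A ψ - expVal L p (rvU (⨆ j, G j) (G i) L v c)|)
            ≤ Real.exp (-(D : ℝ) ^ ((1 : ℝ) / 4))) ∧
        (∀ i : Fin m, ∀ v ∈ S i, ∀ c ∈ L v,
          prEvent L p (fun A ψ =>
              (D : ℝ) ^ ((2 : ℝ) / 3) <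
                |rvK (⨆ j, G j) (G i) L (S i) v c A ψ -
                  expVal L p (rvK (⨆ j, G j) (G i) L (S i) v c)|)
            ≤ Real.exp (-(D : ℝ) ^ ((1 : ℝ) / 4))) := by
  obtain ⟨D₃, hD₃⟩ := Filter.eventually_atTop.1 (eventually_truncation_bounds C hC)
  refine ⟨D₃, ?_⟩
  intro D hDD V _ _ m G _ S L Λ p hp1 hp0 hS hdisj hSC hL hΛ1 hΛ2 hdeg _
  obtain ⟨hlog, hDC, hmain⟩ := hD₃ D hDD
  set k := ⌈4 * Real.log D⌉₊ + C with hk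
  have hC1 : (1 : ℝ) ≤ C := by exact_mod_cast hC
  have hD1 : (1 : ℝ) ≤ D := by linarith
  have hD0 : (0 : ℝ) < D := by linarith
  have hDpos : 0 < D := by exact_mod_cast hD0
  have hDΛ : D ≤ Λ := by
    have : (D : ℝ) ≤ Λ := by nlinarith
    exact_mod_cast this
  have hΛ : 0 < Λ := hDpos.trans_le hDΛ
  have hM : 0 < C * D := Nat.mul_pos hC hDpos
  have hDM : D ≤ C * D := Nat.le_mul_of_pos_left D hC
  have hk0 : 0 < k := by omega
  have hkC : (C : ℝ) ≤ k := by
    rw [hk]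
    push_cast
    linarith [Nat.cast_nonneg (α := ℝ) ⌈4 * Real.log D⌉₊]
  have hk1 : (1 : ℝ) ≤ k := hC1.trans hkC
  have hp0' : 0 ≤ p := le_trans (by positivity) hp0
  have hp1' : p ≤ 1 := hp1.trans (inv_le_one_of_one_le₀ hlog)
  set Y := (D : ℝ) ^ ((1 : ℝ) / 4) with hY
  set t := (D : ℝ) ^ ((2 : ℝ) / 3) / 2 with ht
  have hY0 : 0 ≤ Y := by positivity
  have ht0 : 0 ≤ t := by positivity
  have htD : (D : ℝ) ^ ((2 : ℝ) / 3) = 2 * t := by rw [ht]; ring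
  have htM : t ≤ 8 * k * ((C * D : ℕ) : ℝ) := by
    have h1 : (D : ℝ) ^ ((2 : ℝ) / 3) ≤ D := by
      simpa using Real.rpow_le_rpow_of_exponent_le hD1 (show (2 : ℝ) / 3 ≤ 1 by norm_num)
    have h2 : (1 : ℝ) * (1 * D) ≤ k * (C * D) := by gcongr
    push_cast
    linarith
  have ht2 : t ^ 2 = (D : ℝ) ^ ((1 : ℝ) / 3) * D / 4 := by
    rw [ht, div_pow, ← Real.rpow_natCast ((D : ℝ) ^ ((2 : ℝ) / 3)) 2, ← Real.rpow_mul hD0.le,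
      ← Real.rpow_add_one hD0.ne']
    norm_num
  have hX : Y + 2 ≤ t ^ 2 / (32 * (k : ℝ) ^ 2 * ((C * D : ℕ) : ℝ)) := by
    rw [le_div_iff₀ (by positivity), ht2]
    push_cast
    have := mul_le_mul_of_nonneg_right hmain hD0.le
    linarith
  have htY : Y + 5 ≤ t - 4 := by
    have h1 : (D : ℝ) ^ ((1 : ℝ) / 3) ≤ (D : ℝ) ^ ((2 : ℝ) / 3) :=
      Real.rpow_le_rpow_of_exponent_le hD1 (by norm_num)
    have h2 : 128 * (1 : ℝ) * 1 ^ 2 * (Y + 2) ≤ 128 * C * (k : ℝ) ^ 2 * (Y + 2) := by gcongr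
    linarith
  have he2 : (4 : ℝ) ≤ Real.exp 2 := by
    have h1 : Real.exp 2 = Real.exp 1 ^ 2 := by rw [← Real.exp_nat_mul]; norm_num
    rw [h1]
    nlinarith [Real.exp_one_gt_d9]
  have hhalf : ∀ z : ℝ, Y + 2 ≤ z → Real.exp (-z) ≤ Real.exp (-Y) / 4 := fun z hz => by
    rw [le_div_iff₀ (by norm_num)]
    calc Real.exp (-z) * 4 ≤ Real.exp (-z) * Real.exp 2 := by gcongr
      _ = Real.exp (-z + 2) := (Real.exp_add _ _).symm
      _ ≤ _ := Real.exp_le_exp.2 (by linarith)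
  have hfirst : 2 * Real.exp (-(t ^ 2 / (32 * (k : ℝ) ^ 2 * ((C * D : ℕ) : ℝ))))
      ≤ Real.exp (-Y) / 2 := by linarith [hhalf _ hX]
  have hsecond : Real.exp (4 - t) ≤ Real.exp (-Y) / 2 := by
    have := hhalf (t - 4) (by linarith)
    rw [neg_sub] at this
    linarith [Real.exp_pos (-Y)]
  have hkΛ : (Λ : ℝ) * Λ * Real.exp (2 - k) ≤ 1 := by
    have h1 : Real.exp (2 - k) ≤ Real.exp 2 * ((D : ℝ) ^ 4)⁻¹ := by
      have h2 : (D : ℝ) ^ 4 ≤ Real.exp k := by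
        have h3 : (D : ℝ) ^ 4 = Real.exp (4 * Real.log D) := by
          rw [mul_comm, Real.exp_mul, Real.exp_log hD0]; norm_cast
        rw [h3, Real.exp_le_exp, hk]
        push_cast
        linarith [Nat.le_ceil (4 * Real.log D)]
      rw [sub_eq_add_neg, Real.exp_add, Real.exp_neg]
      gcongr
    have h2 : Real.exp 2 ≤ 9 := by
      have h1 : Real.exp 2 = Real.exp 1 ^ 2 := by rw [← Real.exp_nat_mul]; norm_num
      rw [h1]
      nlinarith [Real.exp_one_lt_d9, Real.exp_pos 1]
    calc (Λ : ℝ) * Λ * Real.exp (2 - k)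
        ≤ (10 * C * D) * (10 * C * D) * (9 * ((D : ℝ) ^ 4)⁻¹) := by
          gcongr
          exact h1.trans (by gcongr)
      _ = (30 * C / D) ^ 2 := by field_simp; ring
      _ ≤ 1 := pow_le_one₀ (by positivity) (div_le_one_of_le₀ hDC hD0.le)
  have hGdeg := card_filter_iSup_adj_le hS hSC hdeg
  have hmono : ∀ X : Finset V → (V → ℕ) → ℝ,
      prEvent L p (fun A ψ => 2 * t < X A ψ) ≤ prEvent L p (fun A ψ => t < X A ψ) := by
    intro X
    rw [prEvent_eq_prodProb, prEvent_eq_prodProb]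
    refine prodExp_mono (vertexWeight_nonneg hp0' hp1') fun x _ => ?_
    split_ifs with h1 h2
    · exact le_rfl
    · linarith
    · exact zero_le_one
    · exact le_rfl
  have hN : ∀ i, ∀ v ∈ S i, ∀ c ∈ L v,
      (((G i).neighborFinset v).filter fun u => c ∈ L u).card ≤ D :=
    fun i v hv c hc => (hdeg i v hv c hc).le
  rw [htD]
  refine ⟨fun v => ?_, fun i v hv c hc => ?_, fun i v hv c hc => ?_⟩
  · refine (hmono _).trans ((rvR_prob_le hp0' hp1' hΛ hL hGdeg hM hk1 ht0 htM v).trans ?_)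
    linarith [Real.exp_pos (-Y)]
  · refine (rvU_prob_le hp0' hp1' hΛ hL hGdeg hM hk0 ht0 htM v c ((hN i v hv c hc).trans hDΛ)
      ((hN i v hv c hc).trans hDM) hkΛ).trans ?_
    linarith
  · refine (hmono _).trans ((rvK_prob_le hp0' hp1' hΛ hL hGdeg hM hk1 ht0 htM (S i) v c
      (fun u hu => (hS i v u hu).2) (fun w hw => ?_) ((hN i v hv c hc).trans hDΛ)
      ((hN i v hv c hc).trans hDM)).trans ?_)
    · refine le_trans ?_ hkC
      exact_mod_cast card_filter_adj_of_notMem_le hS hdisj hSC hw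
    · linarith [Real.exp_pos (-Y)]
end

section
/- For every C > 0 and ε > 0, there exists D₄ = D₄(C, ε) such that the following holds for every D ≥ D₄. Let G₁, …, G_m be graphs, and let (L, M) be a correspondence assignment for G := ⋃_{i=1}^m G_i such that: the G_i are nearly disjoint; |{i ∈ [m] : v ∈ V(G_i)}| ≤ C for every v ∈ V(G); Δ(G_i, (L|_{V(G_i)}, M|_{E(G_i)})) ≤ D for every i ∈ [m]; and |L(v)| = ⌈Λ⌉ for every v ∈ V(G), where (1 + ε)D ≤ Λ ≤ 10CD. If log⁻¹ D ≥ p ≥ log⁻² D, then there exist X ⊆ V(G), an (L|_X, M|_{E(G[X])})-coloring φ of G[X], and a list assignment L' for G − X satisfying L'(v) ⊆ {c ∈ L(v) : (v, c) ∉ ⋃_{u ∈ X} N_{G,(L,M)}(u, φ(u))} for every v ∈ V(G) \ X, such that (1) |L'(v)| = ⌈λ'(Λ, D, C, p) − Λ^{4/5}⌉ for every v ∈ V(G) \ X, and (2) Δ(G_i − X, (L'|_{V(G_i − X)}, M|_{E(G_i − X)})) ≤ D'(Λ, D, C, p) + D^{4/5} for every i ∈ [m]. -/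
open Finset

/-- `λ'(Λ, D, C, p) = (1 - p/Λ)^{DC} Λ` (real exponents). -/
noncomputable def lamNew (Λ D C p : ℝ) : ℝ := (1 - p / Λ) ^ (D * C) * Λ

/-- `D'(Λ, D, C, p) = ((1 - p)(1 - p/Λ)^{D(C-1)} + p(1 - (1 - p/Λ)^{DC})) D`. -/
noncomputable def degNew (Λ D C p : ℝ) : ℝ :=
  ((1 - p) * (1 - p / Λ) ^ (D * (C - 1)) + p * (1 - (1 - p / Λ) ^ (D * C))) * D

namespace Nibble

section FiniteProduct

variable {ι α : Type*} [Fintype ι] [DecidableEq ι] [Fintype α]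

/-- Expectation of `f` under the product of the weights `P i` on `ι → α`. -/
noncomputable def expect (P : ι → α → ℝ) (f : (ι → α) → ℝ) : ℝ :=
  ∑ ω, (∏ i, P i (ω i)) * f ω

/-- Conditional expectation of `f` when the coordinates in `s` are resampled. -/
noncomputable def condExpect (P : ι → α → ℝ) (s : Finset ι) (f : (ι → α) → ℝ) (ω : ι → α) : ℝ :=
  expect P fun η => f (s.piecewise η ω)

open Classical in
/-- Probability of the event `A` under the product of the weights `P i`. -/
noncomputable def prob (P : ι → α → ℝ) (A : (ι → α) → Prop) : ℝ :=
  expect P fun ω => if A ω then 1 else 0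

/-- Each `P i` is a probability vector. -/
structure IsWeight (P : ι → α → ℝ) : Prop where
  nonneg : ∀ i x, 0 ≤ P i x
  sum_eq : ∀ i, ∑ x, P i x = 1

variable {P : ι → α → ℝ}

theorem expect_prod (g : ι → α → ℝ) :
    expect P (fun ω => ∏ i, g i (ω i)) = ∏ i, ∑ x, P i x * g i x := by
  rw [Finset.prod_univ_sum, Fintype.piFinset_univ]
  simp only [expect, Finset.prod_mul_distrib]

theorem expect_add (f g : (ι → α) → ℝ) :
    expect P (fun ω => f ω + g ω) = expect P f + expect P g := by
  simp only [expect, mul_add, Finset.sum_add_distrib]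

theorem expect_sub (f g : (ι → α) → ℝ) :
    expect P (fun ω => f ω - g ω) = expect P f - expect P g := by
  simp only [expect, mul_sub, Finset.sum_sub_distrib]

theorem expect_neg (f : (ι → α) → ℝ) :
    expect P (fun ω => -f ω) = -expect P f := by
  simp only [expect, mul_neg, Finset.sum_neg_distrib]

theorem expect_const_mul (a : ℝ) (f : (ι → α) → ℝ) :
    expect P (fun ω => a * f ω) = a * expect P f := by
  simp only [expect, Finset.mul_sum]
  exact Finset.sum_congr rfl fun _ _ => by ring

theorem expect_mul_const (a : ℝ) (f : (ι → α) → ℝ) :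
    expect P (fun ω => f ω * a) = expect P f * a := by
  simp only [mul_comm _ a, expect_const_mul]

theorem expect_sum {β : Type*} (t : Finset β) (f : β → (ι → α) → ℝ) :
    expect P (fun ω => ∑ b ∈ t, f b ω) = ∑ b ∈ t, expect P (f b) := by
  simp only [expect, Finset.mul_sum]
  exact Finset.sum_comm

theorem expect_const (hP : IsWeight P) (a : ℝ) : expect P (fun _ => a) = a := by
  have h := expect_prod (P := P) fun _ _ => 1
  simp only [Finset.prod_const_one, mul_one, hP.sum_eq] at h
  calc expect P (fun _ => a) = a * expect P (fun _ => 1) := by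
        rw [← expect_const_mul]; simp
    _ = a := by rw [h, mul_one]

theorem expect_mono (hP : IsWeight P) {f g : (ι → α) → ℝ} (h : ∀ ω, f ω ≤ g ω) :
    expect P f ≤ expect P g :=
  Finset.sum_le_sum fun ω _ =>
    mul_le_mul_of_nonneg_left (h ω) (Finset.prod_nonneg fun i _ => hP.nonneg i _)

theorem expect_nonneg (hP : IsWeight P) {f : (ι → α) → ℝ} (h : ∀ ω, 0 ≤ f ω) :
    0 ≤ expect P f := by
  simpa [expect_const hP] using expect_mono hP (f := fun _ => 0) h

theorem abs_expect_le (hP : IsWeight P) (f : (ι → α) → ℝ) :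
    |expect P f| ≤ expect P fun ω => |f ω| := by
  refine abs_le.2 ⟨?_, expect_mono hP fun ω => le_abs_self _⟩
  rw [← expect_neg]
  exact expect_mono hP fun ω => neg_abs_le _

theorem expect_coord (hP : IsWeight P) (i : ι) (h : α → ℝ) :
    expect P (fun ω => h (ω i)) = ∑ x, P i x * h x := by
  have := expect_prod (P := P) fun j x => if j = i then h x else 1
  simp only [Finset.prod_ite_eq', Finset.mem_univ, if_true] at this
  rw [this, Finset.prod_eq_single i]
  · simp
  · intro j _ hj
    simp [hj, hP.sum_eq]
  · simp

theorem sum_weight_swap (s : Finset ι) (F : (ι → α) → (ι → α) → ℝ) :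
    ∑ η, ∑ ω, (∏ i, P i (η i)) * (∏ i, P i (ω i)) * F (s.piecewise η ω) (s.piecewise ω η) =
      ∑ η, ∑ ω, (∏ i, P i (η i)) * (∏ i, P i (ω i)) * F η ω := by
  rw [← Fintype.sum_prod_type', ← Fintype.sum_prod_type']
  let e : (ι → α) × (ι → α) → (ι → α) × (ι → α) :=
    fun x => (s.piecewise x.1 x.2, s.piecewise x.2 x.1)
  have he : Function.Involutive e := by
    rintro ⟨η, ω⟩
    ext i <;> by_cases hi : i ∈ s <;> simp [e, hi]
  refine Fintype.sum_bijective e he.bijective _ _ ?_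
  rintro ⟨η, ω⟩
  simp only [e]
  congr 1
  rw [← Finset.prod_mul_distrib, ← Finset.prod_mul_distrib]
  refine Finset.prod_congr rfl fun i _ => ?_
  by_cases hi : i ∈ s <;> simp [hi, mul_comm]

theorem expect_mul_expect (f g : (ι → α) → ℝ) :
    expect P f * expect P g =
      ∑ η, ∑ ω, (∏ i, P i (η i)) * (∏ i, P i (ω i)) * (f η * g ω) := by
  simp only [expect, Finset.sum_mul_sum]
  exact Finset.sum_congr rfl fun _ _ => Finset.sum_congr rfl fun _ _ => by ring

theorem expect_condExpect (hP : IsWeight P) (s : Finset ι) (f : (ι → α) → ℝ) :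
    expect P (condExpect P s f) = expect P f := by
  have h1 : expect P (condExpect P s f) =
      ∑ η, ∑ ω, (∏ i, P i (η i)) * (∏ i, P i (ω i)) * f (s.piecewise η ω) := by
    rw [Finset.sum_comm]
    simp only [condExpect, expect, Finset.mul_sum]
    exact Finset.sum_congr rfl fun _ _ => Finset.sum_congr rfl fun _ _ => by ring
  have h2 := expect_mul_expect (P := P) f fun _ => 1
  rw [h1, sum_weight_swap s fun η _ => f η]
  rw [expect_const hP] at h2
  simpa using h2.symm

/-- Functions of disjoint sets of coordinates are independent. -/
theorem expect_mul_of_disjoint (hP : IsWeight P) (s : Finset ι) {f g : (ι → α) → ℝ}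
    (hf : ∀ ω ω', (∀ i ∈ s, ω i = ω' i) → f ω = f ω')
    (hg : ∀ ω ω', (∀ i ∉ s, ω i = ω' i) → g ω = g ω') :
    expect P (fun ω => f ω * g ω) = expect P f * expect P g := by
  rw [expect_mul_expect, ← expect_condExpect hP s, Finset.sum_comm]
  simp only [condExpect, expect, Finset.mul_sum]
  refine Finset.sum_congr rfl fun ω _ => Finset.sum_congr rfl fun η _ => ?_
  rw [hf η (s.piecewise η ω) fun i hi => by simp [hi],
    hg ω (s.piecewise η ω) fun i hi => by simp [hi]]
  ring

theorem expect_update (hP : IsWeight P) (i : ι) (f : (ι → α) → ℝ) :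
    expect P f = ∑ x, P i x * expect P fun ω => f (Function.update ω i x) := by
  have key : ∀ ω, condExpect P {i} f ω = ∑ x, P i x * f (Function.update ω i x) := fun ω => by
    simp only [condExpect, Finset.piecewise_singleton]
    exact expect_coord hP i fun x => f (Function.update ω i x)
  rw [← expect_condExpect hP {i} f, funext key, expect_sum]
  simp only [expect_const_mul]

theorem condExpect_insert (hP : IsWeight P) {s : Finset ι} {i : ι} (hi : i ∉ s)
    (f : (ι → α) → ℝ) (ω : ι → α) :
    condExpect P (insert i s) f ω = ∑ x, P i x * condExpect P s f (Function.update ω i x) := by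
  rw [condExpect, expect_update hP i]
  refine Finset.sum_congr rfl fun x _ => ?_
  congr 2
  ext η
  congr 1
  ext j
  by_cases hj : j = i
  · subst hj; simp [hi]
  · by_cases hjs : j ∈ s <;> simp [hj, hjs]

theorem condExpect_univ (f : (ι → α) → ℝ) (ω : ι → α) :
    condExpect P univ f ω = expect P f := by
  simp [condExpect]

theorem condExpect_piecewise (s : Finset ι) (f : (ι → α) → ℝ) (η ω : ι → α) :
    condExpect P s f (s.piecewise η ω) = condExpect P s f ω := by
  simp [condExpect]

/-- One-step exponential moment bound. -/
theorem sum_exp_le (w Y c : α → ℝ) (hw : ∀ x, 0 ≤ w x) (hw1 : ∑ x, w x = 1) {t : ℝ} (a : ℝ)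
    (hY : ∀ x, |Y x - a| ≤ c x) (hc : ∀ x, |t| * c x ≤ 1) :
    ∑ x, w x * Real.exp (t * Y x) ≤
      Real.exp (t * ∑ x, w x * Y x + t ^ 2 * ∑ x, w x * c x ^ 2) := by
  have h1 : ∀ x, Real.exp (t * (Y x - a)) ≤ 1 + t * (Y x - a) + t ^ 2 * c x ^ 2 := fun x => by
    have hb : |t * (Y x - a)| ≤ 1 := by
      rw [abs_mul]
      exact (mul_le_mul_of_nonneg_left (hY x) (abs_nonneg t)).trans (hc x)
    have h2 := Real.abs_exp_sub_one_sub_id_le hb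
    have h3 : (t * (Y x - a)) ^ 2 ≤ t ^ 2 * c x ^ 2 := by
      rw [mul_pow]
      refine mul_le_mul_of_nonneg_left ?_ (sq_nonneg t)
      rw [← sq_abs (Y x - a)]
      exact pow_le_pow_left₀ (abs_nonneg _) (hY x) 2
    linarith [(abs_le.1 h2).2]
  have h4 : ∑ x, w x * Real.exp (t * Y x) =
      Real.exp (t * a) * ∑ x, w x * Real.exp (t * (Y x - a)) := by
    rw [Finset.mul_sum]
    refine Finset.sum_congr rfl fun x _ => ?_
    have : t * Y x = t * a + t * (Y x - a) := by ring
    rw [this, Real.exp_add]; ring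
  have h5 : ∑ x, w x * (1 + t * (Y x - a) + t ^ 2 * c x ^ 2) =
      1 + (t * (∑ x, w x * Y x - a) + t ^ 2 * ∑ x, w x * c x ^ 2) := by
    have : ∀ x, w x * (1 + t * (Y x - a) + t ^ 2 * c x ^ 2) =
      w x * (1 - t * a) + t * (w x * Y x) + t ^ 2 * (w x * c x ^ 2) := fun x => by ring
    simp only [this, Finset.sum_add_distrib, ← Finset.mul_sum, ← Finset.sum_mul, hw1]
    ring
  have h6 : t * ∑ x, w x * Y x + t ^ 2 * ∑ x, w x * c x ^ 2 =
      t * a + (t * (∑ x, w x * Y x - a) + t ^ 2 * ∑ x, w x * c x ^ 2) := by ring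
  rw [h4, h6, Real.exp_add]
  refine mul_le_mul_of_nonneg_left ?_ (Real.exp_pos _).le
  calc _ ≤ ∑ x, w x * (1 + t * (Y x - a) + t ^ 2 * c x ^ 2) :=
        Finset.sum_le_sum fun x _ => mul_le_mul_of_nonneg_left (h1 x) (hw x)
    _ ≤ _ := by rw [h5, add_comm]; exact Real.add_one_le_exp _

theorem condExpect_exp_le (hP : IsWeight P) (x₀ : α) (c : ι → α → ℝ) {t : ℝ}
    (hc : ∀ i x, |t| * c i x ≤ 1) (f : (ι → α) → ℝ) (s : Finset ι)
    (hf : ∀ i ∈ s, ∀ ω x,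
      |f (Function.update ω i x) - f (Function.update ω i x₀)| ≤ c i x) (ω : ι → α) :
    condExpect P s (fun η => Real.exp (t * f η)) ω ≤
      Real.exp (t * condExpect P s f ω + t ^ 2 * ∑ i ∈ s, ∑ x, P i x * c i x ^ 2) := by
  induction s using Finset.induction_on generalizing ω with
  | empty => simp [condExpect, expect_const hP]
  | insert i s hi ih =>
    rw [condExpect_insert hP hi, condExpect_insert hP hi, Finset.sum_insert hi]
    set v := ∑ i ∈ s, ∑ x, P i x * c i x ^ 2
    have h1 := fun x => ih (fun j hj => hf j (Finset.mem_insert_of_mem hj)) (Function.update ω i x)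
    have h2 : ∀ x, |condExpect P s f (Function.update ω i x) -
        condExpect P s f (Function.update ω i x₀)| ≤ c i x := fun x => by
      rw [condExpect, condExpect, ← expect_sub]
      refine (abs_expect_le hP _).trans ?_
      rw [← expect_const hP (c i x)]
      refine expect_mono hP fun η => ?_
      rw [← Finset.update_piecewise_of_notMem _ _ _ hi,
        ← Finset.update_piecewise_of_notMem _ _ _ hi]
      exact hf i (Finset.mem_insert_self _ _) _ _
    have h3 := sum_exp_le (P i) (fun x => condExpect P s f (Function.update ω i x)) (c i)
      (hP.nonneg i) (hP.sum_eq i) (t := t) _ h2 (hc i)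
    calc _ ≤ ∑ x, P i x * Real.exp (t * condExpect P s f (Function.update ω i x) + t ^ 2 * v) :=
          Finset.sum_le_sum fun x _ => mul_le_mul_of_nonneg_left (h1 x) (hP.nonneg i x)
      _ = (∑ x, P i x * Real.exp (t * condExpect P s f (Function.update ω i x))) *
            Real.exp (t ^ 2 * v) := by
          simp only [Real.exp_add, Finset.sum_mul, mul_assoc]
      _ ≤ _ := by
          refine (mul_le_mul_of_nonneg_right h3 (Real.exp_pos _).le).trans_eq ?_
          rw [← Real.exp_add]; congr 1; ring

end FiniteProduct

section Probability

variable {ι α : Type*} [Fintype ι] [DecidableEq ι] [Fintype α] {P : ι → α → ℝ}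

theorem prob_nonneg (hP : IsWeight P) (A : (ι → α) → Prop) : 0 ≤ prob P A :=
  expect_nonneg hP fun ω => by split_ifs <;> norm_num

theorem prob_mono (hP : IsWeight P) {A B : (ι → α) → Prop} (h : ∀ ω, A ω → B ω) :
    prob P A ≤ prob P B :=
  expect_mono hP fun ω => by
    by_cases hA : A ω
    · simp [hA, h ω hA]
    · by_cases hB : B ω <;> simp [hA, hB]

theorem prob_or_le (hP : IsWeight P) (A B : (ι → α) → Prop) :
    prob P (fun ω => A ω ∨ B ω) ≤ prob P A + prob P B := by
  rw [prob, prob, prob, ← expect_add]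
  refine expect_mono hP fun ω => ?_
  by_cases hA : A ω <;> by_cases hB : B ω <;> simp [hA, hB]

theorem prob_exists_le (hP : IsWeight P) {β : Type*} (t : Finset β)
    (A : β → (ι → α) → Prop) :
    prob P (fun ω => ∃ b ∈ t, A b ω) ≤ ∑ b ∈ t, prob P (A b) := by
  classical
  induction t using Finset.induction_on with
  | empty => simp [prob, expect_const hP]
  | insert b t hb ih =>
    rw [Finset.sum_insert hb]
    refine (prob_mono hP (B := fun ω => A b ω ∨ ∃ b ∈ t, A b ω) fun ω => ?_).trans
      ((prob_or_le hP _ _).trans (add_le_add le_rfl ih))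
    simp

/-- Bernstein-type tail bound for functions of independent coordinates, conditionally on the
coordinates outside `s`. -/
theorem prob_condExpect_add_le (hP : IsWeight P) (x₀ : α) (c : ι → α → ℝ) {t V : ℝ} (l : ℝ)
    (ht : 0 ≤ t) (hc : ∀ i x, t * c i x ≤ 1) (f : (ι → α) → ℝ) (s : Finset ι)
    (hf : ∀ i ∈ s, ∀ ω x,
      |f (Function.update ω i x) - f (Function.update ω i x₀)| ≤ c i x)
    (hV : ∑ i ∈ s, ∑ x, P i x * c i x ^ 2 ≤ V) :
    prob P (fun ω => condExpect P s f ω + l ≤ f ω) ≤ Real.exp (-(t * l) + t ^ 2 * V) := by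
  have h1 : prob P (fun ω => condExpect P s f ω + l ≤ f ω) ≤
      expect P fun ω => Real.exp (t * f ω) * Real.exp (-(t * condExpect P s f ω) - t * l) := by
    refine expect_mono hP fun ω => ?_
    split_ifs with h
    · rw [← Real.exp_add]
      refine Real.one_le_exp ?_
      nlinarith
    · positivity
  refine h1.trans ?_
  rw [← expect_condExpect hP s, ← expect_const hP (P := P) (Real.exp _)]
  refine expect_mono hP fun ω => ?_
  have h2 := condExpect_exp_le hP x₀ c (t := t) (by simpa [abs_of_nonneg ht] using hc) f s hf ω
  have h3 : condExpect P s (fun ω => Real.exp (t * f ω) *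
      Real.exp (-(t * condExpect P s f ω) - t * l)) ω =
      condExpect P s (fun η => Real.exp (t * f η)) ω *
        Real.exp (-(t * condExpect P s f ω) - t * l) := by
    conv_lhs => rw [condExpect]
    simp only [condExpect_piecewise]
    rw [expect_mul_const]
    rfl
  rw [h3]
  refine (mul_le_mul_of_nonneg_right h2 (Real.exp_pos _).le).trans ?_
  rw [← Real.exp_add]
  refine Real.exp_le_exp.2 ?_
  nlinarith [mul_le_mul_of_nonneg_left hV (sq_nonneg t)]

theorem prob_expect_add_le (hP : IsWeight P) (x₀ : α) (c : ι → α → ℝ) {t V : ℝ} (l : ℝ)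
    (ht : 0 ≤ t) (hc : ∀ i x, t * c i x ≤ 1) (f : (ι → α) → ℝ)
    (hf : ∀ i ω x, |f (Function.update ω i x) - f (Function.update ω i x₀)| ≤ c i x)
    (hV : ∑ i, ∑ x, P i x * c i x ^ 2 ≤ V) :
    prob P (fun ω => expect P f + l ≤ f ω) ≤ Real.exp (-(t * l) + t ^ 2 * V) := by
  simpa only [condExpect_univ] using
    prob_condExpect_add_le hP x₀ c l ht hc f univ (fun i _ => hf i) hV

/-- Upper tail bound for a function which is Lipschitz, with respect to resetting coordinates to
the default value, only on a typical event `A`. -/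
theorem prob_condExpect_add_le_of_typical (hP : IsWeight P) (x₀ : α) {t k : ℝ} (l : ℝ)
    (ht : 0 ≤ t) (hk : 0 ≤ k) (htk : t * k ≤ 1) (f : (ι → α) → ℝ) (s : Finset ι)
    (A : (ι → α) → Prop)
    (hA : ∀ ω, A ω → ∀ T ⊆ s, f ω ≤ f (T.piecewise (fun _ => x₀) ω) + k * T.card)
    (hf : ∀ ω, ∀ i ∈ s, f (Function.update ω i x₀) ≤ f ω + k) :
    prob P (fun ω => condExpect P s f ω + l ≤ f ω) ≤
      prob P (fun ω => ¬ A ω) + Real.exp (-(t * l) + t ^ 2 * (s.card * k ^ 2)) := by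
  let g : (ι → α) → ℝ := fun ω =>
    s.powerset.inf' ⟨∅, Finset.empty_mem_powerset s⟩
      fun T => f (T.piecewise (fun _ => x₀) ω) + k * T.card
  have g_le : ∀ ω, g ω ≤ f ω := fun ω =>
    (Finset.inf'_le _ (Finset.empty_mem_powerset s)).trans (by simp)
  have g_eq : ∀ ω, A ω → g ω = f ω := fun ω h =>
    le_antisymm (g_le ω) <| Finset.le_inf' _ _ fun T hT => hA ω h T (Finset.mem_powerset.1 hT)
  have g_up : ∀ ω, ∀ i ∈ s, g ω ≤ g (Function.update ω i x₀) + k := fun ω i hi => by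
    obtain ⟨T, hT, hgT⟩ := Finset.exists_mem_eq_inf' ⟨∅, Finset.empty_mem_powerset s⟩
      fun T => f (T.piecewise (fun _ => x₀) (Function.update ω i x₀)) + k * T.card
    change g _ = _ at hgT
    rw [hgT]
    have hT' : insert i T ∈ s.powerset :=
      Finset.mem_powerset.2 (Finset.insert_subset hi (Finset.mem_powerset.1 hT))
    refine (Finset.inf'_le _ hT').trans ?_
    have h1 : (insert i T).piecewise (fun _ => x₀) ω =
        T.piecewise (fun _ => x₀) (Function.update ω i x₀) := by
      ext j
      by_cases hj : j = i
      · subst hj; by_cases hjT : j ∈ T <;> simp [hjT]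
      · by_cases hjT : j ∈ T <;> simp [hj, hjT]
    have h2 : ((insert i T).card : ℝ) ≤ T.card + 1 := by
      exact_mod_cast Finset.card_insert_le i T
    rw [h1]
    nlinarith
  have g_down : ∀ ω, ∀ i ∈ s, g (Function.update ω i x₀) ≤ g ω + k := fun ω i hi => by
    obtain ⟨T, hT, hgT⟩ := Finset.exists_mem_eq_inf' ⟨∅, Finset.empty_mem_powerset s⟩
      fun T => f (T.piecewise (fun _ => x₀) ω) + k * T.card
    change g _ = _ at hgT
    rw [hgT]
    refine (Finset.inf'_le _ hT).trans ?_
    have h1 : T.piecewise (fun _ => x₀) (Function.update ω i x₀) =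
        Function.update (T.piecewise (fun _ => x₀) ω) i x₀ := by
      ext j
      by_cases hj : j = i
      · subst hj; by_cases hjT : j ∈ T <;> simp [hjT]
      · by_cases hjT : j ∈ T <;> simp [hj, hjT]
    rw [h1]
    linarith [hf (T.piecewise (fun _ => x₀) ω) i hi]
  have h1 := prob_condExpect_add_le hP x₀ (fun _ _ => k) (V := s.card * k ^ 2) l ht
    (fun _ _ => htk) g s
    (fun i hi ω x => by
      have h := g_up (Function.update ω i x) i hi
      have h' := g_down (Function.update ω i x) i hi
      rw [Function.update_idem] at h h'
      exact abs_le.2 ⟨by linarith, by linarith⟩)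
    (by simp [← Finset.sum_mul, hP.sum_eq])
  refine (prob_mono hP fun ω hω => ?_).trans ((prob_or_le hP _ _).trans (add_le_add le_rfl h1))
  by_cases h : A ω
  · right
    rw [g_eq ω h]
    have : condExpect P s g ω ≤ condExpect P s f ω := expect_mono hP fun _ => g_le _
    linarith
  · exact Or.inl h

/-- The symmetric Lovász local lemma in a product space. -/
theorem exists_forall_not_of_prob_le (hP : IsWeight P) {β : Type*} [Fintype β] [DecidableEq β]
    (E : β → (ι → α) → Prop) (T : β → Finset ι)
    (hE : ∀ b ω ω', (∀ i ∈ T b, ω i = ω' i) → (E b ω ↔ E b ω')) {q : ℝ} {d : ℕ}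
    (hq : ∀ b, prob P (E b) ≤ q)
    (hd : ∀ b, (univ.filter fun b' => ¬ Disjoint (T b) (T b')).card ≤ d)
    (hqd : 4 * q * d ≤ 1) (hq4 : 4 * q ≤ 1) : ∃ ω, ∀ b, ¬ E b ω := by
  classical
  rcases isEmpty_or_nonempty β with hβ | ⟨⟨b₀⟩⟩
  · have : (∏ i, ∑ x, P i x) = 1 := by simp [hP.sum_eq]
    rw [Finset.prod_univ_sum] at this
    obtain ⟨ω, -, -⟩ := Finset.exists_ne_zero_of_sum_ne_zero (this.trans_ne one_ne_zero)
    exact ⟨ω, fun b => hβ.elim b⟩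
  have hq0 : 0 ≤ q := (prob_nonneg hP _).trans (hq b₀)
  let av : Finset β → ℝ := fun S => prob P fun ω => ∀ b ∈ S, ¬ E b ω
  have av_nonneg : ∀ S, 0 ≤ av S := fun S => prob_nonneg hP _
  have key : ∀ n (S : Finset β), S.card ≤ n → ∀ b,
      prob P (fun ω => E b ω ∧ ∀ b' ∈ S, ¬ E b' ω) ≤ 2 * q * av S := by
    intro n
    induction n with
    | zero =>
      intro S hS b
      rw [Nat.le_zero, Finset.card_eq_zero] at hS
      subst hS
      have : av ∅ = 1 := by simp [av, prob, expect_const hP]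
      rw [this]
      refine (prob_mono hP fun ω h => h.1).trans ((hq b).trans (by linarith))
    | succ n ih =>
      intro S hS b
      set S1 := S.filter fun b' => ¬ Disjoint (T b) (T b') with hS1
      set S2 := S.filter fun b' => Disjoint (T b) (T b') with hS2
      have hsub : S2 ⊆ S := Finset.filter_subset _ _
      have hindep : prob P (fun ω => E b ω ∧ ∀ b' ∈ S2, ¬ E b' ω) = prob P (E b) * av S2 := by
        have h := expect_mul_of_disjoint hP (T b)
          (f := fun ω => if E b ω then 1 else 0)
          (g := fun ω => if (∀ b' ∈ S2, ¬ E b' ω) then 1 else 0)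
          (fun ω ω' h => by simp only [hE b ω ω' h])
          (fun ω ω' h => by
            have : (∀ b' ∈ S2, ¬ E b' ω) ↔ ∀ b' ∈ S2, ¬ E b' ω' :=
              forall₂_congr fun b' hb' => not_congr <| hE b' ω ω' fun i hi =>
                h i fun hi' => Finset.disjoint_left.1 (Finset.mem_filter.1 hb').2 hi' hi
            simp only [this])
        have h' : prob P (E b) * av S2 = expect P fun ω =>
            (if E b ω then 1 else 0) * (if (∀ b' ∈ S2, ¬ E b' ω) then 1 else 0) := by
          rw [h]
          simp only [av, prob]
          congr!
        rw [h', prob]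
        congr 1
        ext ω
        by_cases h1 : E b ω <;> simp [h1]
      have hnum : prob P (fun ω => E b ω ∧ ∀ b' ∈ S, ¬ E b' ω) ≤ q * av S2 := by
        refine (prob_mono hP (B := fun ω => E b ω ∧ ∀ b' ∈ S2, ¬ E b' ω)
          fun ω h => ⟨h.1, fun b' hb' => h.2 b' (hsub hb')⟩).trans ?_
        rw [hindep]
        exact mul_le_mul_of_nonneg_right (hq b) (av_nonneg _)
      have hden : av S2 ≤ 2 * av S := by
        rcases S1.eq_empty_or_nonempty with h1 | h1
        · have : S2 = S := by
            refine Finset.filter_true_of_mem fun b' hb' => ?_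
            by_contra hcon
            exact Finset.notMem_empty b' (h1 ▸ Finset.mem_filter.2 ⟨hb', hcon⟩)
          rw [this]; linarith [av_nonneg S]
        · have hcard : S2.card ≤ n := by
            have : S2.card + S1.card = S.card := by
              rw [hS1, hS2, ← Finset.card_filter_add_card_filter_not (s := S)
                (fun b' => Disjoint (T b) (T b'))]
            have := h1.card_pos
            omega
          have hS1d : (S1.card : ℝ) ≤ d := by
            exact_mod_cast (Finset.card_le_card
              (Finset.filter_subset_filter _ (Finset.subset_univ S))).trans (hd b)
          have h2 : av S2 ≤ av S + ∑ b' ∈ S1, 2 * q * av S2 := by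
            refine (prob_mono hP (B := fun ω => (∀ b' ∈ S, ¬ E b' ω) ∨
              ∃ b' ∈ S1, E b' ω ∧ ∀ b'' ∈ S2, ¬ E b'' ω) fun ω h => ?_).trans
              ((prob_or_le hP _ _).trans (add_le_add le_rfl ((prob_exists_le hP _ _).trans
                (Finset.sum_le_sum fun b' _ => ih S2 hcard b'))))
            by_cases h3 : ∀ b' ∈ S, ¬ E b' ω
            · exact Or.inl h3
            · push Not at h3
              obtain ⟨b', hb', hEb'⟩ := h3
              refine Or.inr ⟨b', Finset.mem_filter.2 ⟨hb', fun hdis => ?_⟩, hEb', h⟩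
              exact h b' (Finset.mem_filter.2 ⟨hb', hdis⟩) hEb'
          rw [Finset.sum_const, nsmul_eq_mul] at h2
          have h3 : (S1.card : ℝ) * (2 * q * av S2) ≤ d * (2 * q * av S2) :=
            mul_le_mul_of_nonneg_right hS1d (by have := av_nonneg S2; positivity)
          have h4 : d * (2 * q * av S2) ≤ av S2 / 2 := by
            nlinarith [av_nonneg S2]
          linarith
      calc _ ≤ q * av S2 := hnum
        _ ≤ q * (2 * av S) := mul_le_mul_of_nonneg_left hden hq0
        _ = _ := by ring
  have pos : ∀ S : Finset β, 0 < av S := by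
    intro S
    induction S using Finset.induction_on with
    | empty => simp [av, prob, expect_const hP]
    | insert b S hb ih =>
      have h1 : av S ≤ prob P (fun ω => E b ω ∧ ∀ b' ∈ S, ¬ E b' ω) + av (insert b S) := by
        refine (prob_mono hP fun ω h => ?_).trans (prob_or_le hP _ _)
        by_cases hEb : E b ω
        · exact Or.inl ⟨hEb, h⟩
        · right; simpa [hEb] using h
      have h2 := key _ S le_rfl b
      nlinarith
  by_contra hcon
  push Not at hcon
  have : av univ = 0 := by
    have : ∀ ω, ¬ ∀ b ∈ (univ : Finset β), ¬ E b ω := fun ω h => by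
      obtain ⟨b, hb⟩ := hcon ω
      exact h b (Finset.mem_univ b) hb
    simp only [av, prob, this, if_false, expect_const hP]
  exact (pos univ).ne' this

end Probability

section Model

set_option linter.unusedSectionVars false

open scoped Classical

variable {V κ : Type*} [Fintype V] [DecidableEq V] [Fintype κ] [DecidableEq κ]

/-- A correspondence assignment, as a relation on (vertex, color) pairs with finite color set `κ`
and lists `L`. -/
structure IsCorrespondence (M : V → κ → V → κ → Prop) (L : V → Finset κ) : Prop where
  symm : ∀ {v c w b}, M v c w b → M w b v c
  irrefl : ∀ v c b, ¬ M v c v b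
  mem_list : ∀ {v c w b}, M v c w b → b ∈ L w
  unique : ∀ {v c w b b'}, M v c w b → M v c w b' → b = b'

/-- The law of the nibble: coordinate `inl v` is the color tentatively assigned to `v`, if any;
coordinate `inr (v, c)` is `none` if the color `c` passes the equalizing coin flip at `v`. -/
noncomputable def weight (L : V → Finset κ) (q : ℝ) (e : V × κ → ℝ) : V ⊕ V × κ → Option κ → ℝ
  | .inl v, none => 1 - (L v).card * q
  | .inl v, some a => if a ∈ L v then q else 0
  | .inr j, none => e j
  | .inr j, some a => if a = j.2 then 1 - e j else 0

/-- The color `c` at `v` is in conflict with the tentative color of some vertex of `R`. -/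
def HitFrom (M : V → κ → V → κ → Prop) (R : Finset V) (ω : V ⊕ V × κ → Option κ) (v : V) (c : κ) :
    Prop :=
  ∃ w ∈ R, ∃ b, ω (.inl w) = some b ∧ M w b v c

/-- The number of vertices of `R` having a color in conflict with the color `c` at `v`. -/
noncomputable def colorDegree (M : V → κ → V → κ → Prop) (R : Finset V) (v : V) (c : κ) : ℕ :=
  (R.filter fun w => ∃ b, M w b v c).card

variable {M : V → κ → V → κ → Prop} {L : V → Finset κ} {q : ℝ} {e : V × κ → ℝ}

theorem sum_weight_inl (v : V) (F : Option κ → ℝ) :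
    ∑ x, weight L q e (.inl v) x * F x =
      (1 - (L v).card * q) * F none + q * ∑ a ∈ L v, F (some a) := by
  simp [Fintype.sum_option, weight, Finset.mul_sum, Finset.sum_ite_mem]

theorem sum_weight_inr (j : V × κ) (F : Option κ → ℝ) :
    ∑ x, weight L q e (.inr j) x * F x = e j * F none + (1 - e j) * F (some j.2) := by
  simp [Fintype.sum_option, weight]

theorem isWeight_weight (hq : 0 ≤ q) (hLq : ∀ v, (L v).card * q ≤ 1) (he0 : ∀ j, 0 ≤ e j)
    (he1 : ∀ j, e j ≤ 1) : IsWeight (weight L q e) where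
  nonneg i x := by
    rcases i with v | j <;> rcases x with _ | a
    · simpa [weight] using hLq v
    · simp only [weight]; split_ifs <;> simp [hq]
    · exact he0 j
    · simp only [weight]; split_ifs <;> simp [he1]
  sum_eq i := by
    rcases i with v | j
    · have := sum_weight_inl (L := L) (q := q) (e := e) v fun _ => 1
      simp only [mul_one] at this
      rw [this]; simp; ring
    · have := sum_weight_inr (L := L) (q := q) (e := e) j fun _ => 1
      simp only [mul_one] at this
      rw [this]; ring

theorem hitFrom_update_inl (R : Finset V) (ω : V ⊕ V × κ → Option κ) (w : V) (b : κ) (v : V)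
    (c : κ) :
    HitFrom M R (Function.update ω (.inl w) (some b)) v c ↔
      (w ∈ R ∧ M w b v c) ∨ HitFrom M R (Function.update ω (.inl w) none) v c := by
  constructor
  · rintro ⟨w', hw', b', hb', h⟩
    by_cases hww : w' = w
    · subst hww
      simp only [Function.update_self, Option.some.injEq] at hb'
      subst hb'
      exact Or.inl ⟨hw', h⟩
    · refine Or.inr ⟨w', hw', b', ?_, h⟩
      simpa [hww] using hb'
  · rintro (⟨hw, h⟩ | ⟨w', hw', b', hb', h⟩)
    · exact ⟨w, hw, b, by simp, h⟩
    · by_cases hww : w' = w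
      · subst hww; simp at hb'
      · exact ⟨w', hw', b', by simpa [hww] using hb', h⟩

theorem hitFrom_update_inr (R : Finset V) (ω : V ⊕ V × κ → Option κ) (j : V × κ) (x : Option κ)
    (v : V) (c : κ) : HitFrom M R (Function.update ω (.inr j) x) v c ↔ HitFrom M R ω v c := by
  simp [HitFrom]

theorem expect_mul_not_hitFrom (hM : IsCorrespondence M L) (hP : IsWeight (weight L q e))
    (R : Finset V) (v : V) (c : κ) (g k : Option κ → ℝ) :
    expect (weight L q e) (fun ω => g (ω (.inl v)) * k (ω (.inr (v, c))) *
      if HitFrom M R ω v c then 0 else 1) =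
      (∑ x, weight L q e (.inl v) x * g x) * (∑ x, weight L q e (.inr (v, c)) x * k x) *
        (1 - q) ^ colorDegree M R v c := by
  let G : V ⊕ V × κ → Option κ → ℝ
    | .inl w, x => (if w = v then g x else 1) *
        if w ∈ R → ¬ ∃ b, x = some b ∧ M w b v c then 1 else 0
    | .inr j, x => if j = (v, c) then k x else 1
  have h1 : (fun ω : V ⊕ V × κ → Option κ => g (ω (.inl v)) * k (ω (.inr (v, c))) *
      if HitFrom M R ω v c then (0 : ℝ) else 1) = fun ω => ∏ i, G i (ω i) := by
    ext ω
    rw [Fintype.prod_sum_type]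
    simp only [G, Finset.prod_mul_distrib, Finset.prod_ite_eq', Finset.mem_univ, if_true,
      Finset.prod_ite_zero, Finset.prod_const_one]
    have : (∀ w, w ∈ R → ¬ ∃ b, ω (.inl w) = some b ∧ M w b v c) ↔
        ¬ HitFrom M R ω v c := by
      simp only [HitFrom]
      push Not
      rfl
    simp only [true_implies, this]
    by_cases h : HitFrom M R ω v c <;> simp [h]
  rw [h1, expect_prod, Fintype.prod_sum_type]
  have h2 : ∀ w, ∑ x, weight L q e (.inl w) x * G (.inl w) x =
      (if w = v then ∑ x, weight L q e (.inl v) x * g x else 1) *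
        if w ∈ R ∧ ∃ b, M w b v c then 1 - q else 1 := fun w => by
    by_cases hwv : w = v
    · subst hwv
      simp [G, hM.irrefl]
    · by_cases hw : w ∈ R ∧ ∃ b, M w b v c
      · obtain ⟨hwR, b, hb⟩ := hw
        have hbL : b ∈ L w := hM.mem_list (hM.symm hb)
        have huniq : ∀ a, M w a v c ↔ a = b := fun a =>
          ⟨fun ha => hM.unique (hM.symm ha) (hM.symm hb), fun ha => ha ▸ hb⟩
        rw [sum_weight_inl]
        simp only [G, hwv, if_false, one_mul, huniq, hwR, true_implies]
        have : ∀ a, (if (¬ ∃ b', some a = some b' ∧ b' = b) then (1 : ℝ) else 0) =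
            1 - if a = b then 1 else 0 := fun a => by
          by_cases hab : a = b <;> simp [hab]
        simp only [this, Finset.sum_sub_distrib, Finset.sum_ite_eq', hbL]
        simp
        ring
      · have : ∀ x, G (.inl w) x = 1 := fun x => by
          simp only [G, hwv, if_false, one_mul]
          exact if_pos fun hwR ⟨b, _, hb⟩ => hw ⟨hwR, b, hb⟩
        simp only [this, hwv, hw, if_false, mul_one, hP.sum_eq]
  have h3 : ∀ j, ∑ x, weight L q e (.inr j) x * G (.inr j) x =
      if j = (v, c) then ∑ x, weight L q e (.inr (v, c)) x * k x else 1 := fun j => by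
    by_cases hj : j = (v, c)
    · subst hj; simp [G]
    · simp [G, hj, hP.sum_eq]
  simp only [h2, h3, Finset.prod_mul_distrib, Finset.prod_ite_eq', Finset.mem_univ, if_true]
  rw [mul_right_comm, Finset.prod_ite, Finset.prod_const, Finset.prod_const_one, mul_one]
  congr 2
  rw [colorDegree]
  congr 1
  ext w
  simp

theorem sum_conflicts_le (hM : IsCorrespondence M L) (v : V) (c : κ) :
    ∑ w, ∑ b ∈ L w, (if M w b v c then (1 : ℝ) else 0) ≤ colorDegree M univ v c := by
  rw [colorDegree, Finset.card_filter]
  push_cast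
  refine Finset.sum_le_sum fun w _ => ?_
  by_cases h : ∃ b, M w b v c
  · obtain ⟨b, hb⟩ := h
    have huniq : ∀ a, M w a v c ↔ a = b := fun a =>
      ⟨fun ha => hM.unique (hM.symm ha) (hM.symm hb), fun ha => ha ▸ hb⟩
    simp only [huniq, Finset.sum_ite_eq', exists_eq, if_true]
    split_ifs <;> simp
  · have : ∀ b, ¬ M w b v c := fun b hb => h ⟨b, hb⟩
    simp [this]

theorem abs_sum_ite_sub_sum_ite_le {β : Type*} (s : Finset β) (p r : β → Prop) :
    |∑ a ∈ s, (if p a then (1 : ℝ) else 0) - ∑ a ∈ s, (if r a then (1 : ℝ) else 0)| ≤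
      ∑ a ∈ s, if (p a ↔ r a) then (0 : ℝ) else 1 := by
  rw [← Finset.sum_sub_distrib]
  refine (Finset.abs_sum_le_sum_abs _ _).trans (Finset.sum_le_sum fun a _ => ?_)
  by_cases hp : p a <;> by_cases hr : r a <;> simp [hp, hr]

/-- The color `c` stays available at `v`. -/
def Survives (M : V → κ → V → κ → Prop) (v : V) (c : κ) (ω : V ⊕ V × κ → Option κ) : Prop :=
  ω (.inr (v, c)) = none ∧ ¬ HitFrom M univ ω v c

theorem expect_survives (hM : IsCorrespondence M L) (hP : IsWeight (weight L q e)) (v : V) (c : κ) :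
    expect (weight L q e) (fun ω => if Survives M v c ω then 1 else 0) =
      e (v, c) * (1 - q) ^ colorDegree M univ v c := by
  have h := expect_mul_not_hitFrom hM hP univ v c (fun _ => 1) fun x => if x = none then 1 else 0
  rw [sum_weight_inr] at h
  simp only [one_mul, mul_one, hP.sum_eq, if_true] at h
  simp only [reduceCtorEq, if_false, mul_zero, add_zero] at h
  rw [← h]
  congr 1
  ext ω
  by_cases h1 : ω (.inr (v, c)) = none <;> by_cases h2 : HitFrom M univ ω v c <;>
    simp [Survives, h1, h2]

theorem survives_update_inl (ω : V ⊕ V × κ → Option κ) (w : V) (b : κ) (v : V) (c : κ)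
    (h : ¬ M w b v c) :
    Survives M v c (Function.update ω (.inl w) (some b)) ↔
      Survives M v c (Function.update ω (.inl w) none) := by
  simp [Survives, hitFrom_update_inl, h]

theorem prob_card_survives_le (hM : IsCorrespondence M L) (hP : IsWeight (weight L q e))
    (hq : 0 ≤ q) {t s Δ : ℝ} (l : ℝ) (ht : 0 ≤ t) (ht1 : t ≤ 1) (v : V)
    (hs : ∀ c ∈ L v, e (v, c) * (1 - q) ^ colorDegree M univ v c = s)
    (hΔ : ∀ c ∈ L v, (colorDegree M univ v c : ℝ) ≤ Δ) :
    prob (weight L q e)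
        (fun ω => (((L v).filter fun c => Survives M v c ω).card : ℝ) ≤ (L v).card * s - l) ≤
      Real.exp (-(t * l) + t ^ 2 * ((L v).card * (q * Δ) + (L v).card)) := by
  let f : (V ⊕ V × κ → Option κ) → ℝ := fun ω => -∑ c ∈ L v, if Survives M v c ω then (1 : ℝ) else 0
  let C : V ⊕ V × κ → Option κ → ℝ
    | .inl _, none => 0
    | .inl w, some b => if ∃ c, M w b v c then 1 else 0
    | .inr j, _ => if j.1 = v ∧ j.2 ∈ L v then 1 else 0
  have hC : ∀ i x, C i x = 0 ∨ C i x = 1 := fun i x => by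
    rcases i with w | j <;> rcases x with _ | b <;> simp only [C] <;> try split_ifs
    all_goals simp
  have hf : ∀ i ω x, |f (Function.update ω i x) - f (Function.update ω i none)| ≤ C i x := by
    intro i ω x
    have h0 : ∀ a b : ℝ, |-a - -b| = |a - b| := fun a b => by rw [neg_sub_neg, abs_sub_comm]
    simp only [f, h0]
    rcases x with _ | b
    · simp only [sub_self, abs_zero]
      rcases hC i none with h | h <;> simp [h]
    refine (abs_sum_ite_sub_sum_ite_le _ _ _).trans ?_
    rcases i with w | j
    · have h1 : ∀ c, (if (Survives M v c (Function.update ω (.inl w) (some b)) ↔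
          Survives M v c (Function.update ω (.inl w) none)) then (0 : ℝ) else 1) ≤
          if M w b v c then 1 else 0 := fun c => by
        by_cases h : M w b v c
        · simp only [h, if_true]; split_ifs <;> simp
        · rw [if_pos (survives_update_inl _ _ _ _ _ h), if_neg h]
      refine (Finset.sum_le_sum fun c _ => h1 c).trans ?_
      by_cases h : ∃ c, M w b v c
      · obtain ⟨c, hc⟩ := h
        have huniq : ∀ a, M w b v a ↔ a = c := fun a =>
          ⟨fun ha => hM.unique ha hc, fun ha => ha ▸ hc⟩
        simp only [C, huniq, Finset.sum_ite_eq', exists_eq, if_true]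
        split_ifs <;> simp
      · have : ∀ c, ¬ M w b v c := fun b hb => h ⟨b, hb⟩
        simp [this, C]
    · have h1 : ∀ c, (if (Survives M v c (Function.update ω (.inr j) (some b)) ↔
          Survives M v c (Function.update ω (.inr j) none)) then (0 : ℝ) else 1) ≤
          if c = j.2 then (if j.1 = v then 1 else 0) else 0 := fun c => by
        by_cases h : (v, c) = j
        · subst h; simp; split_ifs <;> simp
        · have : (Survives M v c (Function.update ω (.inr j) (some b)) ↔
              Survives M v c (Function.update ω (.inr j) none)) := by
            simp [Survives, hitFrom_update_inr, h]
          simp only [this, if_true]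
          split_ifs <;> simp
      refine (Finset.sum_le_sum fun c _ => h1 c).trans ?_
      simp only [Finset.sum_ite_eq', C]
      by_cases h2 : j.2 ∈ L v <;> by_cases h3 : j.1 = v <;> simp [h2, h3]
  have hsq : ∀ i x, C i x ^ 2 = C i x := fun i x => by rcases hC i x with h | h <;> simp [h]
  have hV : ∑ i, ∑ x, weight L q e i x * C i x ^ 2 ≤ (L v).card * (q * Δ) + (L v).card := by
    simp only [hsq]
    rw [Fintype.sum_sum_type]
    refine add_le_add ?_ ?_
    · simp only [sum_weight_inl, C, mul_zero, zero_add, ← Finset.mul_sum]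
      have h1 : ∑ w, ∑ b ∈ L w, (if ∃ c, M w b v c then (1 : ℝ) else 0) ≤
          ∑ w, ∑ b ∈ L w, ∑ c ∈ L v, if M w b v c then (1 : ℝ) else 0 := by
        refine Finset.sum_le_sum fun w _ => Finset.sum_le_sum fun b _ => ?_
        by_cases h : ∃ c, M w b v c
        · obtain ⟨c, hc⟩ := h
          have huniq : ∀ a, M w b v a ↔ a = c := fun a =>
            ⟨fun ha => hM.unique ha hc, fun ha => ha ▸ hc⟩
          simp [huniq, hM.mem_list hc]
        · simp only [h, if_false]
          exact Finset.sum_nonneg fun c _ => by split_ifs <;> simp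
      have h2 : ∑ w, ∑ b ∈ L w, ∑ c ∈ L v, (if M w b v c then (1 : ℝ) else 0) =
          ∑ c ∈ L v, ∑ w, ∑ b ∈ L w, if M w b v c then (1 : ℝ) else 0 := by
        rw [Finset.sum_comm]
        exact Finset.sum_congr rfl fun w _ => Finset.sum_comm
      have h3 : ∑ c ∈ L v, ∑ w, ∑ b ∈ L w, (if M w b v c then (1 : ℝ) else 0) ≤
          (L v).card * Δ := by
        refine (Finset.sum_le_sum fun c hc => (sum_conflicts_le hM v c).trans (hΔ c hc)).trans ?_
        simp
      nlinarith
    · simp only [C, ← Finset.sum_mul, hP.sum_eq, one_mul]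
      rw [Fintype.sum_prod_type, Finset.sum_eq_single v]
      · simp
      · intro w _ hw; simp [hw]
      · simp
  have key := prob_expect_add_le hP none C l ht (fun i x => by
    rcases hC i x with h | h <;> simp [h, ht1]) f hf hV
  refine le_trans (prob_mono hP fun ω hω => ?_) key
  have hE : expect (weight L q e) f = -((L v).card * s) := by
    simp only [f]
    rw [expect_neg, expect_sum, Finset.sum_congr rfl fun c hc => (expect_survives hM hP v c).trans
      (hs c hc)]
    simp
  rw [hE]
  simp only [f]
  rw [Finset.card_filter] at hω
  push_cast at hω
  linarith

end Model

section Degree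

set_option linter.unusedSectionVars false

open scoped Classical

variable {V κ : Type*} [Fintype V] [DecidableEq V] [Fintype κ] [DecidableEq κ]
  {M : V → κ → V → κ → Prop} {L : V → Finset κ} {q : ℝ} {e : V × κ → ℝ}

/-- The event that `u` remains a neighbor through the color `τ`: either `u` got no tentative
color and `τ` is not removed by a vertex outside `S`, or the tentative color of `u` is in
conflict. -/
def Remains (M : V → κ → V → κ → Prop) (S : Finset V) (u : V) (τ : κ)
    (ω : V ⊕ V × κ → Option κ) : Prop :=
  (ω (.inl u) = none ∧ ω (.inr (u, τ)) = none ∧ ¬ HitFrom M Sᶜ ω u τ) ∨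
    ∃ a, ω (.inl u) = some a ∧ HitFrom M univ ω u a

theorem expect_remains_le (hM : IsCorrespondence M L) (hP : IsWeight (weight L q e))
    (S : Finset V) (u : V) (τ : κ) :
    expect (weight L q e) (fun ω => if Remains M S u τ ω then 1 else 0) ≤
      (1 - (L u).card * q) * (e (u, τ) * (1 - q) ^ colorDegree M Sᶜ u τ) +
        q * ∑ a ∈ L u, (1 - (1 - q) ^ colorDegree M univ u a) := by
  have h1 := expect_mul_not_hitFrom hM hP Sᶜ u τ (fun x => if x = none then 1 else 0)
    fun x => if x = none then 1 else 0
  rw [sum_weight_inr, sum_weight_inl] at h1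
  simp only [reduceCtorEq, if_true, if_false, Finset.sum_const_zero, mul_zero, add_zero,
    mul_one] at h1
  have h2 : ∀ a, expect (weight L q e) (fun ω => (if ω (.inl u) = some a then (1 : ℝ) else 0) *
      (if HitFrom M univ ω u a then 0 else 1)) =
      (if a ∈ L u then q else 0) * (1 - q) ^ colorDegree M univ u a := fun a => by
    have h := expect_mul_not_hitFrom hM hP univ u a (fun x => if x = some a then 1 else 0)
      fun _ => 1
    rw [sum_weight_inl] at h
    simp only [mul_one, hP.sum_eq] at h
    rw [h]
    by_cases ha : a ∈ L u <;> simp [ha]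
  have h3 : ∀ a, expect (weight L q e) (fun ω => if ω (.inl u) = some a then (1 : ℝ) else 0) =
      if a ∈ L u then q else 0 := fun a => by
    have h := expect_coord hP (.inl u) fun x => if x = some a then (1 : ℝ) else 0
    rw [sum_weight_inl] at h
    rw [h]
    by_cases ha : a ∈ L u <;> simp [ha]
  calc _ ≤ expect (weight L q e) (fun ω =>
        ((if ω (.inl u) = none then 1 else 0) * (if ω (.inr (u, τ)) = none then 1 else 0) *
          (if HitFrom M Sᶜ ω u τ then 0 else 1)) +
        ∑ a, ((if ω (.inl u) = some a then (1 : ℝ) else 0) -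
          (if ω (.inl u) = some a then (1 : ℝ) else 0) *
            (if HitFrom M univ ω u a then 0 else 1))) := by
        refine expect_mono hP fun ω => ?_
        rcases hx : ω (.inl u) with _ | a
        · by_cases h4 : ω (.inr (u, τ)) = none <;> by_cases h5 : HitFrom M Sᶜ ω u τ <;>
            simp [Remains, hx, h4, h5]
        · have : ∀ a', (some a = some a') ↔ a' = a := fun a' => by
            rw [Option.some.injEq, eq_comm]
          rw [Finset.sum_eq_single a (fun a' _ h => by simp [this, h]) (by simp)]
          by_cases h4 : HitFrom M univ ω u a <;> simp [Remains, hx, h4]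
    _ = _ := by
        rw [expect_add, h1, expect_sum]
        simp only [expect_sub, h2, h3]
        rw [← mul_assoc, Finset.mul_sum]
        congr 1
        rw [← Finset.sum_subset (Finset.subset_univ (L u))]
        · exact Finset.sum_congr rfl fun a ha => by simp [ha]; ring
        · intro a _ ha; simp [ha]

/-- Number of vertices of `U` that remain neighbors. -/
noncomputable def remainCount (M : V → κ → V → κ → Prop) (S U : Finset V) (τ : V → κ)
    (ω : V ⊕ V × κ → Option κ) : ℝ :=
  ∑ u ∈ U, if Remains M S u (τ u) ω then 1 else 0

theorem hitFrom_update_none {R : Finset V} {ω : V ⊕ V × κ → Option κ} {w u : V} {a : κ}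
    (h : HitFrom M R (Function.update ω (.inl w) none) u a) : HitFrom M R ω u a := by
  obtain ⟨w', hw', b, hb, hM⟩ := h
  refine ⟨w', hw', b, ?_, hM⟩
  by_cases hww : w' = w
  · subst hww; simp at hb
  · simpa [hww] using hb

theorem remains_update_iff {S : Finset V} {ω : V ⊕ V × κ → Option κ} {w u : V} {b τ : κ}
    (hwu : u ≠ w) (h1 : ¬ (w ∉ S ∧ M w b u τ)) (h2 : ∀ a, ω (.inl u) = some a → ¬ M w b u a) :
    Remains M S u τ (Function.update ω (.inl w) (some b)) ↔
      Remains M S u τ (Function.update ω (.inl w) none) := by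
  have h1' : ¬ (w ∈ Sᶜ ∧ M w b u τ) := by simpa using h1
  have hne : (Sum.inl u : V ⊕ V × κ) ≠ Sum.inl w := by simpa using hwu
  unfold Remains
  rw [hitFrom_update_inl, Function.update_of_ne hne, Function.update_of_ne hne,
    Function.update_of_ne (by simp), Function.update_of_ne (by simp)]
  simp only [h1', false_or]
  refine or_congr Iff.rfl (exists_congr fun a => and_congr_right fun ha => ?_)
  rw [hitFrom_update_inl]
  simp [h2 a ha]

theorem prob_expect_condExpect_remainCount_le (hM : IsCorrespondence M L)
    (hP : IsWeight (weight L q e)) (hq : 0 ≤ q) {S U : Finset V} {τ : V → κ}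
    (hLq : ∀ v, (L v).card * q ≤ 1) {Δ C t : ℝ} (hC : 1 ≤ C)
    (hΔ : ∀ v c, (colorDegree M univ v c : ℝ) ≤ Δ) (hqΔ : q * Δ ≤ C) (hUS : U ⊆ S)
    (hS : ∀ w ∉ S, ((S.filter fun u => ∃ b c, M w b u c).card : ℝ) ≤ C)
    (l : ℝ) (ht : 0 ≤ t) (htC : t * (2 * C) ≤ 1) :
    prob (weight L q e) (fun ω => expect (weight L q e) (remainCount M S U τ) + l ≤
      condExpect (weight L q e) (U.image .inl) (remainCount M S U τ) ω) ≤
      Real.exp (-(t * l) + t ^ 2 * ((4 * C ^ 2 + 1) * U.card)) := by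
  set W := weight L q e with hW
  set s : Finset (V ⊕ V × κ) := U.image .inl with hs
  let a1 : V → κ → ℝ := fun w b => ∑ u ∈ U, if w ∉ S ∧ M w b u (τ u) then (1 : ℝ) else 0
  let a2 : V → κ → ℝ := fun w b => ∑ u ∈ U, ∑ a ∈ L u, if M w b u a then (1 : ℝ) else 0
  have a1_nonneg : ∀ w b, 0 ≤ a1 w b := fun w b =>
    Finset.sum_nonneg fun u _ => by split_ifs <;> simp
  have a2_nonneg : ∀ w b, 0 ≤ a2 w b := fun w b =>
    Finset.sum_nonneg fun u _ => Finset.sum_nonneg fun a _ => by split_ifs <;> simp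
  have a1_le : ∀ w b, a1 w b ≤ C := fun w b => by
    by_cases hw : w ∈ S
    · simp [a1, hw]; linarith
    · refine le_trans ?_ (hS w hw)
      simp only [a1, hw, not_false_iff, true_and]
      rw [Finset.card_filter]
      push_cast
      refine (Finset.sum_le_sum fun u _ => ?_).trans
        (Finset.sum_le_sum_of_subset_of_nonneg hUS fun u _ _ => by split_ifs <;> simp)
      by_cases h : M w b u (τ u)
      · rw [if_pos h, if_pos ⟨b, τ u, h⟩]
      · rw [if_neg h]; split_ifs <;> simp
  have a2_le : ∀ w b, a2 w b ≤ Δ := fun w b => by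
    refine le_trans ?_ ((sum_conflicts_le hM w b).trans (hΔ w b))
    refine (Finset.sum_le_sum_of_subset_of_nonneg (Finset.subset_univ U) fun u _ _ =>
      Finset.sum_nonneg fun a _ => by split_ifs <;> simp).trans_eq ?_
    exact Finset.sum_congr rfl fun u _ => Finset.sum_congr rfl fun a _ =>
      if_congr ⟨hM.symm, hM.symm⟩ rfl rfl
  let c : V ⊕ V × κ → Option κ → ℝ
    | .inl _, none => 0
    | .inl w, some b => a1 w b + q * a2 w b
    | .inr j, _ => if j.1 ∈ U ∧ j.2 = τ j.1 then 1 else 0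
  have c_nonneg : ∀ i x, 0 ≤ c i x := fun i x => by
    rcases i with w | j
    · rcases x with _ | b
      · simp [c]
      · have := mul_nonneg hq (a2_nonneg w b)
        simp only [c]; linarith [a1_nonneg w b]
    · simp only [c]; split_ifs <;> simp
  have c_le : ∀ i x, c i x ≤ 2 * C := fun i x => by
    rcases i with w | j
    · rcases x with _ | b
      · simp only [c]; linarith
      · have := mul_le_mul_of_nonneg_left (a2_le w b) hq
        simp only [c]; linarith [a1_le w b]
    · simp only [c]; split_ifs <;> linarith
  have hf : ∀ i ω x, |condExpect W s (remainCount M S U τ) (Function.update ω i x) -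
      condExpect W s (remainCount M S U τ) (Function.update ω i none)| ≤ c i x := by
    intro i ω x
    by_cases his : i ∈ s
    · have : ∀ y, condExpect W s (remainCount M S U τ) (Function.update ω i y) =
          condExpect W s (remainCount M S U τ) ω := fun y => by
        simp only [condExpect]
        congr 1
        ext η
        congr 1
        ext j
        by_cases hj : j ∈ s
        · simp [hj]
        · have : j ≠ i := fun h => hj (h ▸ his)
          simp [hj, this]
      simp [this, c_nonneg]
    rcases x with _ | b
    · simp [c_nonneg]
    simp only [condExpect]
    rw [← expect_sub]
    refine (abs_expect_le hP _).trans ?_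
    simp only [← Finset.update_piecewise_of_notMem _ _ _ his]
    rcases i with w | j
    · have hwU : w ∉ U := fun h => his (Finset.mem_image_of_mem _ h)
      have hpt : ∀ η, |remainCount M S U τ (Function.update (s.piecewise η ω) (.inl w) (some b)) -
          remainCount M S U τ (Function.update (s.piecewise η ω) (.inl w) none)| ≤
          ∑ u ∈ U, ((if w ∉ S ∧ M w b u (τ u) then (1 : ℝ) else 0) +
            ∑ a ∈ L u, (if M w b u a then (1 : ℝ) else 0) *
              (if η (.inl u) = some a then (1 : ℝ) else 0)) := fun η => by
        refine (abs_sum_ite_sub_sum_ite_le _ _ _).trans (Finset.sum_le_sum fun u hu => ?_)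
        have hnn : 0 ≤ ∑ a ∈ L u, (if M w b u a then (1 : ℝ) else 0) *
              (if η (.inl u) = some a then (1 : ℝ) else 0) :=
          Finset.sum_nonneg fun a _ => by split_ifs <;> simp
        by_cases h1 : w ∉ S ∧ M w b u (τ u)
        · rw [if_pos h1]; split_ifs <;> linarith
        by_cases h2 : ∃ a, η (.inl u) = some a ∧ M w b u a
        · obtain ⟨a, ha, hab⟩ := h2
          have : (1 : ℝ) ≤ ∑ a ∈ L u, (if M w b u a then (1 : ℝ) else 0) *
              (if η (.inl u) = some a then (1 : ℝ) else 0) := by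
            refine le_trans ?_ (Finset.single_le_sum (f := fun a =>
              (if M w b u a then (1 : ℝ) else 0) * (if η (.inl u) = some a then (1 : ℝ) else 0))
              (fun a _ => by positivity) (hM.mem_list hab))
            simp [ha, hab]
          rw [if_neg h1]; split_ifs <;> linarith
        · have hus : (Sum.inl u : V ⊕ V × κ) ∈ s := Finset.mem_image_of_mem _ hu
          push Not at h2
          have hne : u ≠ w := fun h => hwU (h ▸ hu)
          rw [if_pos (remains_update_iff hne h1 fun a ha => h2 a (by
            simpa [hus] using ha)), if_neg h1]
          linarith
      refine (expect_mono hP hpt).trans_eq ?_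
      rw [expect_sum]
      simp only [expect_add, expect_const hP, expect_sum, expect_const_mul]
      have h3 : ∀ u, ∀ a ∈ L u, expect W (fun ω => if ω (.inl u) = some a then (1 : ℝ) else 0) =
          q := fun u a ha => by
        have h := expect_coord hP (.inl u) fun x => if x = some a then (1 : ℝ) else 0
        rw [sum_weight_inl] at h
        rw [h]
        simp [ha]
      simp only [c, a1, a2, Finset.sum_add_distrib, Finset.mul_sum]
      congr 1
      refine Finset.sum_congr rfl fun u _ => Finset.sum_congr rfl fun a ha => ?_
      rw [h3 u a ha, mul_comm]
    · rw [← expect_const hP (c (.inr j) (some b))]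
      refine expect_mono hP fun η => ?_
      refine (abs_sum_ite_sub_sum_ite_le _ _ _).trans ?_
      have h1 : ∀ u ∈ U, (if (Remains M S u (τ u)
            (Function.update (s.piecewise η ω) (.inr j) (some b)) ↔
          Remains M S u (τ u) (Function.update (s.piecewise η ω) (.inr j) none))
          then (0 : ℝ) else 1) ≤
          if u = j.1 then (if j.2 = τ j.1 then 1 else 0) else 0 := fun u _ => by
        by_cases h : (u, τ u) = j
        · subst h; simp; split_ifs <;> simp
        · rw [if_pos (by simp [Remains, hitFrom_update_inr, h])]
          split_ifs <;> simp
      refine (Finset.sum_le_sum h1).trans ?_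
      simp only [Finset.sum_ite_eq', c]
      by_cases h2 : j.1 ∈ U <;> by_cases h3 : j.2 = τ j.1 <;> simp [h2, h3]
  have hV : ∑ i, ∑ x, W i x * c i x ^ 2 ≤ (4 * C ^ 2 + 1) * U.card := by
    rw [Fintype.sum_sum_type]
    have hL : ∑ w, ∑ x, W (.inl w) x * c (.inl w) x ^ 2 ≤ 4 * C ^ 2 * U.card := by
      have h1 : ∑ w, ∑ x, W (.inl w) x * c (.inl w) x ^ 2 ≤
          2 * C * ∑ w, ∑ x, W (.inl w) x * c (.inl w) x := by
        rw [Finset.mul_sum]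
        refine Finset.sum_le_sum fun w _ => ?_
        rw [Finset.mul_sum]
        refine Finset.sum_le_sum fun x _ => ?_
        have := mul_nonneg (mul_nonneg (hP.nonneg (.inl w) x) (c_nonneg (.inl w) x))
          (sub_nonneg.2 (c_le (.inl w) x))
        nlinarith
      have h2 : ∑ w, ∑ x, W (.inl w) x * c (.inl w) x =
          q * (∑ w, ∑ b ∈ L w, a1 w b) + q * (q * ∑ w, ∑ b ∈ L w, a2 w b) := by
        simp only [hW, sum_weight_inl, c, mul_zero, zero_add, Finset.sum_add_distrib,
          ← Finset.mul_sum, mul_add]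
      have h3 : ∑ w, ∑ b ∈ L w, a1 w b ≤ U.card * Δ := by
        have : ∑ w, ∑ b ∈ L w, a1 w b =
            ∑ u ∈ U, ∑ w, ∑ b ∈ L w, if w ∉ S ∧ M w b u (τ u) then (1 : ℝ) else 0 := by
          rw [Finset.sum_comm]
          exact Finset.sum_congr rfl fun w _ => Finset.sum_comm
        rw [this, ← nsmul_eq_mul, ← Finset.sum_const]
        refine Finset.sum_le_sum fun u _ => le_trans ?_ ((sum_conflicts_le hM _ _).trans
          (hΔ u (τ u)))
        refine Finset.sum_le_sum fun w _ => Finset.sum_le_sum fun b _ => ?_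
        by_cases h4 : w ∉ S <;> by_cases h5 : M w b u (τ u) <;> simp [h4, h5]
      have h4 : q * ∑ w, ∑ b ∈ L w, a2 w b ≤ U.card * Δ := by
        have : ∑ w, ∑ b ∈ L w, a2 w b =
            ∑ u ∈ U, ∑ a ∈ L u, ∑ w, ∑ b ∈ L w, if M w b u a then (1 : ℝ) else 0 := by
          calc _ = ∑ w, ∑ u ∈ U, ∑ b ∈ L w, ∑ a ∈ L u, (if M w b u a then (1 : ℝ) else 0) :=
                Finset.sum_congr rfl fun w _ => Finset.sum_comm
            _ = ∑ u ∈ U, ∑ w, ∑ b ∈ L w, ∑ a ∈ L u, (if M w b u a then (1 : ℝ) else 0) :=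
                Finset.sum_comm
            _ = ∑ u ∈ U, ∑ w, ∑ a ∈ L u, ∑ b ∈ L w, (if M w b u a then (1 : ℝ) else 0) :=
                Finset.sum_congr rfl fun u _ => Finset.sum_congr rfl fun w _ => Finset.sum_comm
            _ = _ := Finset.sum_congr rfl fun u _ => Finset.sum_comm
        rw [this, ← nsmul_eq_mul, ← Finset.sum_const, Finset.mul_sum]
        refine Finset.sum_le_sum fun u _ => ?_
        have h5 : ∑ a ∈ L u, ∑ w, ∑ b ∈ L w, (if M w b u a then (1 : ℝ) else 0) ≤
            (L u).card * Δ := by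
          refine (Finset.sum_le_sum fun a _ => (sum_conflicts_le hM u a).trans
            (hΔ u a)).trans ?_
          simp
        have hΔ0 : 0 ≤ Δ := (Nat.cast_nonneg _).trans (hΔ u (τ u))
        nlinarith [mul_le_mul_of_nonneg_left h5 hq, mul_le_mul_of_nonneg_right (hLq u) hΔ0]
      have h5 : ∑ w, ∑ x, W (.inl w) x * c (.inl w) x ≤ 2 * C * U.card := by
        rw [h2]
        have hU : (0 : ℝ) ≤ U.card := Nat.cast_nonneg _
        nlinarith [mul_le_mul_of_nonneg_left h3 hq, mul_le_mul_of_nonneg_left h4 hq,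
          mul_le_mul_of_nonneg_right hqΔ hU]
      nlinarith
    have hR : ∑ j, ∑ x, W (.inr j) x * c (.inr j) x ^ 2 = U.card := by
      simp only [c, ← Finset.sum_mul, hP.sum_eq, one_mul]
      rw [Fintype.sum_prod_type]
      have : ∀ u, ∑ a, (if u ∈ U ∧ a = τ u then (1 : ℝ) else 0) ^ 2 = if u ∈ U then 1 else 0 :=
        fun u => by by_cases hu : u ∈ U <;> simp [hu]
      simp only [this]
      simp
    rw [hR]
    linarith
  have key := prob_expect_add_le hP none c l ht (fun i x =>
    (mul_le_mul_of_nonneg_left (c_le i x) ht).trans htC)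
    (condExpect W s (remainCount M S U τ)) hf hV
  rwa [expect_condExpect hP] at key

/-- The number of vertices of `U` whose tentative color is in conflict with `b` at `w`. -/
noncomputable def hitCount (M : V → κ → V → κ → Prop) (U : Finset V) (w : V) (b : κ)
    (ω : V ⊕ V × κ → Option κ) : ℕ :=
  (U.filter fun u => ∃ a, ω (.inl u) = some a ∧ M w b u a).card

theorem prob_lt_hitCount_le (hM : IsCorrespondence M L) (hP : IsWeight (weight L q e))
    (hq : 0 ≤ q) (U : Finset V) (hU : U.card * q ≤ 1) (w : V) (b : κ) (K : ℝ) :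
    prob (weight L q e) (fun ω => K < hitCount M U w b ω) ≤ Real.exp (2 - K) := by
  let G : V ⊕ V × κ → Option κ → ℝ
    | .inl u, x => if u ∈ U ∧ ∃ a, x = some a ∧ M w b u a then Real.exp 1 else 1
    | .inr _, _ => 1
  have h1 : ∀ ω, Real.exp (hitCount M U w b ω) = ∏ i, G i (ω i) := fun ω => by
    rw [Fintype.prod_sum_type]
    simp only [G, Finset.prod_const_one, mul_one, hitCount]
    rw [Finset.prod_ite, Finset.prod_const, Finset.prod_const_one, mul_one, ← Real.exp_nat_mul,
      mul_one]
    congr 3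
    ext u
    simp
  have h2 : ∀ u, ∑ x, weight L q e (.inl u) x * G (.inl u) x ≤
      if u ∈ U then Real.exp (2 * q) else 1 := fun u => by
    by_cases hu : u ∈ U
    · rw [if_pos hu]
      by_cases h : ∃ a, M w b u a
      · obtain ⟨a, ha⟩ := h
        have huniq : ∀ a', M w b u a' ↔ a' = a := fun a' =>
          ⟨fun h => hM.unique h ha, fun h => h ▸ ha⟩
        have h3 : ∀ x, G (.inl u) x = 1 + (Real.exp 1 - 1) * if x = some a then 1 else 0 :=
          fun x => by by_cases hx : x = some a <;> simp [G, hu, huniq, hx]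
        simp only [h3, mul_add, Finset.sum_add_distrib, mul_one, hP.sum_eq]
        have h4 : ∑ x, weight L q e (.inl u) x * ((Real.exp 1 - 1) *
            if x = some a then 1 else 0) = q * (Real.exp 1 - 1) := by
          rw [sum_weight_inl]
          simp [hM.mem_list ha]
        rw [h4]
        have := Real.exp_one_lt_d9
        have := Real.add_one_le_exp (2 * q)
        nlinarith
      · have h3 : ∀ x, G (.inl u) x = 1 := fun x => by
          simp only [G]
          exact if_neg fun ⟨_, a, _, ha⟩ => h ⟨a, ha⟩
        simp only [h3, mul_one, hP.sum_eq]
        exact Real.one_le_exp (by linarith)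
    · have h3 : ∀ x, G (.inl u) x = 1 := fun x => by simp [G, hu]
      simp only [h3, mul_one, hP.sum_eq, if_neg hu, le_refl]
  have h3 : expect (weight L q e) (fun ω => Real.exp (hitCount M U w b ω)) ≤ Real.exp 2 := by
    simp only [h1]
    rw [expect_prod, Fintype.prod_sum_type]
    have h4 : ∀ j, ∑ x, weight L q e (.inr j) x * G (.inr j) x = 1 := fun j => by
      simp [G, hP.sum_eq]
    simp only [h4, Finset.prod_const_one, mul_one]
    have hG : ∀ u x, 0 ≤ G (.inl u) x := fun u x => by
      simp only [G]; split_ifs <;> positivity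
    refine (Finset.prod_le_prod (fun u _ => Finset.sum_nonneg fun x _ =>
      mul_nonneg (hP.nonneg _ _) (hG u x)) fun u _ => h2 u).trans ?_
    rw [Finset.prod_ite_mem, Finset.univ_inter, Finset.prod_const, ← Real.exp_nat_mul]
    exact Real.exp_le_exp.2 (by linarith)
  calc _ ≤ expect (weight L q e) (fun ω => Real.exp (-K) * Real.exp (hitCount M U w b ω)) := by
        refine expect_mono hP fun ω => ?_
        split_ifs with h
        · rw [← Real.exp_add]
          exact Real.one_le_exp (by linarith)
        · positivity
    _ ≤ _ := by
        rw [expect_const_mul, sub_eq_neg_add, Real.exp_add]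
        exact mul_le_mul_of_nonneg_left h3 (Real.exp_pos _).le

end Degree

section Concentration

set_option linter.unusedSectionVars false

open scoped Classical

variable {V κ : Type*} [Fintype V] [DecidableEq V] [Fintype κ] [DecidableEq κ]
  {M : V → κ → V → κ → Prop} {L : V → Finset κ} {q : ℝ} {e : V × κ → ℝ}

theorem sum_ite_le_add_card {β : Type*} (s B : Finset β) (p r : β → Prop)
    (h : ∀ a ∈ s, p a → a ∉ B → r a) :
    ∑ a ∈ s, (if p a then (1 : ℝ) else 0) ≤ ∑ a ∈ s, (if r a then (1 : ℝ) else 0) + B.card := by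
  have h1 : ∑ a ∈ s, (if a ∈ B then (1 : ℝ) else 0) ≤ B.card := by
    rw [← Finset.sum_filter, Finset.sum_const, nsmul_eq_mul, mul_one]
    exact_mod_cast Finset.card_le_card fun a ha => (Finset.mem_filter.1 ha).2
  refine le_trans ?_ (add_le_add le_rfl h1)
  rw [← Finset.sum_add_distrib]
  refine Finset.sum_le_sum fun a ha => ?_
  have := h a ha
  by_cases h2 : p a <;> by_cases h3 : a ∈ B <;> by_cases h4 : r a <;> simp_all

theorem remainCount_le_piecewise {S U : Finset V} {τ : V → κ} {K : ℝ} (hK : 0 ≤ K)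
    {ω : V ⊕ V × κ → Option κ} (hω : ∀ w ∈ U, ∀ b, (hitCount M U w b ω : ℝ) ≤ K)
    {T : Finset (V ⊕ V × κ)} (hT : T ⊆ U.image .inl) :
    remainCount M S U τ ω ≤
      remainCount M S U τ (T.piecewise (fun _ => none) ω) + (K + 1) * T.card := by
  let U' : Finset V := U.filter fun u => Sum.inl u ∈ T
  let H : V → Finset V := fun w => U.filter fun u =>
    ∃ b, ω (.inl w) = some b ∧ ∃ a, ω (.inl u) = some a ∧ M w b u a
  have hU' : U'.card ≤ T.card :=
    Finset.card_le_card_of_injOn Sum.inl (fun u hu => (Finset.mem_filter.1 hu).2)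
      Sum.inl_injective.injOn
  have hH : ∀ w ∈ U', ((H w).card : ℝ) ≤ K := fun w hw => by
    rcases hx : ω (.inl w) with _ | b
    · simpa [H, hx] using hK
    · refine le_trans (le_of_eq ?_) (hω w (Finset.mem_filter.1 hw).1 b)
      simp [H, hx, hitCount]
  have hB : ((U' ∪ U'.biUnion H).card : ℝ) ≤ (K + 1) * T.card := by
    have h1 : ((U'.biUnion H).card : ℝ) ≤ U'.card * K := by
      refine (Nat.cast_le.2 Finset.card_biUnion_le).trans ?_
      push_cast
      exact (Finset.sum_le_sum hH).trans (by simp)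
    have h2 : ((U' ∪ U'.biUnion H).card : ℝ) ≤ U'.card + (U'.biUnion H).card := by
      exact_mod_cast Finset.card_union_le _ _
    have h3 : (U'.card : ℝ) ≤ T.card := by exact_mod_cast hU'
    nlinarith
  refine le_trans (sum_ite_le_add_card U (U' ∪ U'.biUnion H) _
    (fun u => Remains M S u (τ u) (T.piecewise (fun _ => none) ω)) ?_) (add_le_add le_rfl hB)
  intro u hu hR huB
  have hinr : ∀ j, (Sum.inr j : V ⊕ V × κ) ∉ T := fun j hj => by
    simpa using hT hj
  rcases hR with ⟨h1, h2, h3⟩ | ⟨a, ha, w, -, b, hb, hM⟩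
  · refine Or.inl ⟨?_, by simp [hinr, h2], ?_⟩
    · by_cases h : (Sum.inl u : V ⊕ V × κ) ∈ T <;> simp [h, h1]
    · rintro ⟨w, hw, b, hb, hM⟩
      refine h3 ⟨w, hw, b, ?_, hM⟩
      by_cases h : (Sum.inl w : V ⊕ V × κ) ∈ T
      · simp [h] at hb
      · simpa [h] using hb
  · rw [Finset.mem_union, not_or] at huB
    have huT : (Sum.inl u : V ⊕ V × κ) ∉ T := fun h => huB.1 (by simp [U', hu, h])
    have hwT : (Sum.inl w : V ⊕ V × κ) ∉ T := fun h => huB.2 <| by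
      have hwU : w ∈ U := by simpa using hT h
      simp only [Finset.mem_biUnion, U', H, Finset.mem_filter]
      exact ⟨w, ⟨hwU, h⟩, hu, b, hb, a, ha, hM⟩
    exact Or.inr ⟨a, by simp [huT, ha], w, by simp, b, by simp [hwT, hb], hM⟩

theorem remainCount_update_none_le {S U : Finset V} {τ : V → κ} (hUS : U ⊆ S)
    (ω : V ⊕ V × κ → Option κ) {w : V} (hw : w ∈ U) :
    remainCount M S U τ (Function.update ω (.inl w) none) ≤ remainCount M S U τ ω + 1 := by
  refine (sum_ite_le_add_card U {w} _ (fun u => Remains M S u (τ u) ω) ?_).trans (by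
    simp [remainCount])
  intro u _ hR huw
  rw [Finset.mem_singleton] at huw
  rcases hR with ⟨h1, h2, h3⟩ | ⟨a, ha, h⟩
  · refine Or.inl ⟨by simpa [huw] using h1, by simpa using h2, fun ⟨w', hw', b, hb, hM⟩ =>
      h3 ⟨w', hw', b, ?_, hM⟩⟩
    have : w' ≠ w := fun h => (Finset.mem_compl.1 hw') (h ▸ hUS hw)
    simpa [this] using hb
  · exact Or.inr ⟨a, by simpa [huw] using ha, hitFrom_update_none h⟩

theorem prob_remainCount_le (hM : IsCorrespondence M L)
    (hP : IsWeight (weight L q e)) (hq : 0 ≤ q) {S U : Finset V} {τ : V → κ}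
    (hLq : ∀ v, (L v).card * q ≤ 1) {n : ℕ} (hn : ∀ v, (L v).card ≤ n) {Δ C t K : ℝ} (hC : 1 ≤ C)
    (hΔ : ∀ v c, (colorDegree M univ v c : ℝ) ≤ Δ) (hqΔ : q * Δ ≤ C) (hUS : U ⊆ S)
    (hS : ∀ w ∉ S, ((S.filter fun u => ∃ b c, M w b u c).card : ℝ) ≤ C) (hUq : U.card * q ≤ 1)
    (l : ℝ) (ht : 0 ≤ t) (htC : t * (2 * C) ≤ 1) (hK : 0 ≤ K) (htK : t * (K + 1) ≤ 1) :
    prob (weight L q e) (fun ω => expect (weight L q e) (remainCount M S U τ) + 2 * l ≤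
      remainCount M S U τ ω) ≤
      U.card * (n * Real.exp (2 - K)) + Real.exp (-(t * l) + t ^ 2 * (U.card * (K + 1) ^ 2)) +
        Real.exp (-(t * l) + t ^ 2 * ((4 * C ^ 2 + 1) * U.card)) := by
  have h1 := prob_expect_condExpect_remainCount_le hM hP hq (τ := τ) hLq hC hΔ hqΔ hUS hS l ht htC
  have h2 := prob_condExpect_add_le_of_typical hP none l ht (by linarith) htK
    (remainCount M S U τ) (U.image .inl)
    (fun ω => ∀ w ∈ U, ∀ b, (hitCount M U w b ω : ℝ) ≤ K)
    (fun ω hω T hT => remainCount_le_piecewise hK hω hT) (fun ω i hi => by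
      obtain ⟨w, hw, rfl⟩ := Finset.mem_image.1 hi
      exact (remainCount_update_none_le hUS ω hw).trans (by linarith))
  have h3 : prob (weight L q e) (fun ω => ¬ ∀ w ∈ U, ∀ b, (hitCount M U w b ω : ℝ) ≤ K) ≤
      U.card * (n * Real.exp (2 - K)) := by
    calc _ ≤ prob (weight L q e) (fun ω => ∃ w ∈ U, ∃ b ∈ L w, K < hitCount M U w b ω) := by
          refine prob_mono hP fun ω hω => ?_
          push Not at hω
          obtain ⟨w, hw, b, hb⟩ := hω
          refine ⟨w, hw, b, ?_, hb⟩
          by_contra hbL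
          have : hitCount M U w b ω = 0 := by
            rw [hitCount, Finset.card_eq_zero, Finset.filter_eq_empty_iff]
            rintro u - ⟨a, -, ha⟩
            exact hbL (hM.mem_list (hM.symm ha))
          rw [this] at hb
          exact hK.not_gt (by simpa using hb)
      _ ≤ ∑ w ∈ U, (n * Real.exp (2 - K)) := by
          refine (prob_exists_le hP _ _).trans (Finset.sum_le_sum fun w _ => ?_)
          refine (prob_exists_le hP _ _).trans ((Finset.sum_le_sum fun b _ =>
            prob_lt_hitCount_le hM hP hq U hUq w b K).trans ?_)
          rw [Finset.sum_const, nsmul_eq_mul]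
          exact mul_le_mul_of_nonneg_right (Nat.cast_le.2 (hn w)) (Real.exp_pos _).le
      _ = _ := by simp
  rw [Finset.card_image_of_injective _ Sum.inl_injective] at h2
  calc _ ≤ prob (weight L q e) (fun ω =>
        (condExpect (weight L q e) (U.image .inl) (remainCount M S U τ) ω + l ≤
          remainCount M S U τ ω) ∨
        expect (weight L q e) (remainCount M S U τ) + l ≤
          condExpect (weight L q e) (U.image .inl) (remainCount M S U τ) ω) := by
        refine prob_mono hP fun ω hω => ?_
        by_contra h
        push Not at h
        linarith [h.1, h.2]
    _ ≤ _ := (prob_or_le hP _ _).trans (add_le_add (h2.trans (add_le_add h3 le_rfl)) h1)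

end Concentration

section PartialColoring

set_option linter.unusedSectionVars false

open scoped Classical

variable {V κ : Type*} [Fintype V] [DecidableEq V] [Fintype κ] [DecidableEq κ]
  {M : V → κ → V → κ → Prop} {L : V → Finset κ} {q : ℝ} {e : V × κ → ℝ}

theorem colorDegree_compl_add (S : Finset V) (v : V) (c : κ) :
    colorDegree M Sᶜ v c + colorDegree M S v c = colorDegree M univ v c := by
  rw [colorDegree, colorDegree, colorDegree, ← Finset.card_union_of_disjoint
    (Finset.disjoint_filter_filter disjoint_compl_left), ← Finset.filter_union,
    Finset.union_comm, Finset.union_compl]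

theorem expect_remainCount_le (hM : IsCorrespondence M L) (hP : IsWeight (weight L q e))
    (hq : 0 ≤ q) {x p C : ℝ} {D : ℕ} (hx : 0 < x) (hx1 : x ≤ 1) (hxq : x ≤ 1 - q)
    (hC : 1 ≤ C) (hp : 0 ≤ p) (hp1 : p ≤ 1)
    (hΔ : ∀ v c, (colorDegree M univ v c : ℝ) ≤ D * C)
    (he : ∀ v c, e (v, c) * (1 - q) ^ colorDegree M univ v c = x ^ (D * C))
    {S U : Finset V} {τ : V → κ} (hL : ∀ u ∈ U, (L u).card * q = p)
    (hS : ∀ u ∈ U, colorDegree M S u (τ u) ≤ D) (hU : U.card ≤ D) :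
    expect (weight L q e) (remainCount M S U τ) ≤
      ((1 - p) * x ^ (D * (C - 1)) + p * (1 - x ^ (D * C))) * D := by
  have hy : 0 < 1 - q := hx.trans_le hxq
  have hpow : ∀ (k : ℕ) (r : ℝ), (k : ℝ) ≤ r → x ^ r ≤ (1 - q) ^ k := fun k r hk =>
    (Real.rpow_le_rpow_of_exponent_ge hx hx1 hk).trans (by
      rw [Real.rpow_natCast]
      exact pow_le_pow_left₀ hx.le hxq k)
  have hr : 0 ≤ (1 - p) * x ^ (D * (C - 1)) + p * (1 - x ^ (D * C)) := by
    have h1 : x ^ (D * C : ℝ) ≤ 1 := Real.rpow_le_one hx.le hx1 (by positivity)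
    have h2 : 0 < x ^ (D * (C - 1) : ℝ) := Real.rpow_pos_of_pos hx _
    exact add_nonneg (mul_nonneg (by linarith) h2.le) (mul_nonneg hp (by linarith))
  have hterm : ∀ u ∈ U, expect (weight L q e)
      (fun ω => if Remains M S u (τ u) ω then 1 else 0) ≤
      (1 - p) * x ^ (D * (C - 1)) + p * (1 - x ^ (D * C)) := fun u hu => by
    refine (expect_remains_le hM hP S u (τ u)).trans (add_le_add ?_ ?_)
    · rw [hL u hu]
      refine mul_le_mul_of_nonneg_left ?_ (by linarith)
      have h1 := he u (τ u)
      rw [← colorDegree_compl_add S, pow_add, ← mul_assoc] at h1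
      have h2 : x ^ (D * C : ℝ) = x ^ (D * (C - 1) : ℝ) * x ^ (D : ℝ) := by
        rw [← Real.rpow_add hx]; congr 1; ring
      have h3 := hpow _ D (Nat.cast_le.2 (hS u hu))
      rw [h2] at h1
      have h4 : 0 < x ^ (D * (C - 1) : ℝ) := Real.rpow_pos_of_pos hx _
      have h5 : 0 < (1 - q) ^ colorDegree M S u (τ u) := pow_pos hy _
      rw [← mul_le_mul_iff_left₀ h5, h1]
      exact mul_le_mul_of_nonneg_left h3 h4.le
    · calc _ ≤ q * ∑ a ∈ L u, (1 - x ^ (D * C : ℝ)) := by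
            refine mul_le_mul_of_nonneg_left (Finset.sum_le_sum fun a _ => ?_) hq
            have := hpow _ _ (hΔ u a)
            linarith
        _ = _ := by rw [Finset.sum_const, nsmul_eq_mul, ← hL u hu]; ring
  rw [show remainCount M S U τ = fun ω => ∑ u ∈ U, if Remains M S u (τ u) ω then (1 : ℝ) else 0
    from rfl, expect_sum]
  refine (Finset.sum_le_sum hterm).trans ?_
  rw [Finset.sum_const, nsmul_eq_mul, mul_comm]
  exact mul_le_mul_of_nonneg_left (Nat.cast_le.2 hU) hr

/-- The vertices at distance at most one from `v` in the cover graph. -/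
noncomputable def ball (M : V → κ → V → κ → Prop) (v : V) : Finset V :=
  insert v (univ.filter fun w => ∃ b c, M w b v c)

theorem mem_ball_comm (hM : IsCorrespondence M L) {v w : V} : w ∈ ball M v ↔ v ∈ ball M w := by
  simp only [ball, Finset.mem_insert, Finset.mem_filter, Finset.mem_univ, true_and, eq_comm]
  exact or_congr Iff.rfl ⟨fun ⟨b, c, h⟩ => ⟨c, b, hM.symm h⟩, fun ⟨b, c, h⟩ => ⟨c, b, hM.symm h⟩⟩

theorem card_ball_le (hM : IsCorrespondence M L) {n : ℕ} (hn : ∀ v, (L v).card ≤ n) {Δ : ℝ}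
    (hΔ0 : 0 ≤ Δ) (hΔ : ∀ v c, (colorDegree M univ v c : ℝ) ≤ Δ) (v : V) :
    ((ball M v).card : ℝ) ≤ n * Δ + 1 := by
  have h1 : (univ.filter fun w => ∃ b c, M w b v c) ⊆
      (L v).biUnion fun c => univ.filter fun w => ∃ b, M w b v c := fun w hw => by
    obtain ⟨b, c, h⟩ := (Finset.mem_filter.1 hw).2
    simp only [Finset.mem_biUnion, Finset.mem_filter, Finset.mem_univ, true_and]
    exact ⟨c, hM.mem_list h, b, h⟩
  have h2 : ((univ.filter fun w => ∃ b c, M w b v c).card : ℝ) ≤ (L v).card * Δ := by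
    refine (Nat.cast_le.2 ((Finset.card_le_card h1).trans Finset.card_biUnion_le)).trans ?_
    push_cast
    exact (Finset.sum_le_sum fun c _ => hΔ v c).trans (by simp)
  have h3 : ((ball M v).card : ℝ) ≤ (univ.filter fun w => ∃ b c, M w b v c).card + 1 := by
    exact_mod_cast Finset.card_insert_le _ _
  have h4 : ((L v).card : ℝ) ≤ n := Nat.cast_le.2 (hn v)
  nlinarith

/-- The coordinates based at distance at most two from `v`. -/
noncomputable def localCoords (M : V → κ → V → κ → Prop) (v : V) : Finset (V ⊕ V × κ) :=
  univ.filter fun j => Sum.elim id Prod.fst j ∈ (ball M v).biUnion (ball M)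

theorem card_not_disjoint_localCoords_le (hM : IsCorrespondence M L) {R : ℕ}
    (hR : ∀ v, (ball M v).card ≤ R) (v : V) :
    (univ.filter fun w => ¬ Disjoint (localCoords M v) (localCoords M w)).card ≤ R ^ 4 := by
  have hstep : ∀ (A : Finset V) (k : ℕ), A.card ≤ k → (A.biUnion (ball M)).card ≤ k * R :=
    fun A k hA => (Finset.card_biUnion_le_card_mul _ _ _ fun u _ => hR u).trans
      (Nat.mul_le_mul_right _ hA)
  have h := hstep _ _ (hstep _ _ (hstep _ _ (hR v)))
  refine (Finset.card_le_card fun w hw => ?_).trans (h.trans_eq (by ring))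
  obtain ⟨j, hj, hj'⟩ := Finset.not_disjoint_iff.1 (Finset.mem_filter.1 hw).2
  simp only [localCoords, Finset.mem_filter, Finset.mem_univ, true_and, Finset.mem_biUnion]
    at hj hj' ⊢
  obtain ⟨y, hy, hjy⟩ := hj'
  exact ⟨y, ⟨_, hj, (mem_ball_comm hM).1 hjy⟩, (mem_ball_comm hM).1 hy⟩

theorem hitFrom_congr {R : Finset V} {v : V} {c : κ} {ω ω' : V ⊕ V × κ → Option κ}
    (h : ∀ w ∈ ball M v, ω (.inl w) = ω' (.inl w)) : HitFrom M R ω v c ↔ HitFrom M R ω' v c := by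
  refine exists_congr fun w => and_congr_right fun _ => exists_congr fun b => ?_
  rw [and_congr_left_iff]
  intro hM
  rw [h w]
  simp only [ball, Finset.mem_insert, Finset.mem_filter, Finset.mem_univ, true_and]
  exact Or.inr ⟨b, c, hM⟩

theorem remains_congr {S : Finset V} {u : V} {τ : κ} {ω ω' : V ⊕ V × κ → Option κ}
    (h : ∀ w ∈ ball M u, ω (.inl w) = ω' (.inl w)) (h' : ω (.inr (u, τ)) = ω' (.inr (u, τ))) :
    Remains M S u τ ω ↔ Remains M S u τ ω' := by
  simp only [Remains, hitFrom_congr h, h', h u (Finset.mem_insert_self _ _)]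

/-- The neighbors of `v` through the color `c` in `S`. -/
noncomputable def colorNeighbors (M : V → κ → V → κ → Prop) (S : Finset V) (v : V) (c : κ) :
    Finset V :=
  S.filter fun u => ∃ b, M u b v c

/-- The color of `u` in conflict with the color `c` of `v`. -/
noncomputable def partnerColor (M : V → κ → V → κ → Prop) (v : V) (c : κ) (u : V) : κ :=
  if h : ∃ b, M u b v c then h.choose else c

theorem partnerColor_eq (hM : IsCorrespondence M L) {u v : V} {b c : κ} (h : M u b v c) :
    partnerColor M v c u = b := by
  have h' : ∃ b, M u b v c := ⟨b, h⟩
  rw [partnerColor, dif_pos h']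
  exact hM.unique (hM.symm h'.choose_spec) (hM.symm h)

end PartialColoring

section Outcome

set_option linter.unusedSectionVars false

open scoped Classical

variable {V κ : Type*} [Fintype V] [DecidableEq V] [Fintype κ] [DecidableEq κ]
  {M : V → κ → V → κ → Prop} {L : V → Finset κ} {q : ℝ}

theorem exists_good_outcome {ι : Type*} [Fintype ι] (hM : IsCorrespondence M L) (S : ι → Finset V)
    {n D R : ℕ} {C x p t K l B : ℝ} (hC : 1 ≤ C) (hq : 0 ≤ q) (hx : 0 < x) (hx1 : x ≤ 1)
    (hxq : x ≤ 1 - q) (hp1 : p ≤ 1) (hnq : n * q = p) (hDq : D * q ≤ 1)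
    (hL : ∀ i, ∀ v ∈ S i, (L v).card = n) (hL' : ∀ v, (∀ i, v ∉ S i) → L v = ∅)
    (hS : ∀ i, ∀ v ∈ S i, ∀ c, colorDegree M (S i) v c ≤ D)
    (hSc : ∀ i, ∀ w ∉ S i, (((S i).filter fun u => ∃ b c, M w b u c).card : ℝ) ≤ C)
    (hv : ∀ i, ∀ v ∈ S i, ((univ.filter fun j => v ∈ S j).card : ℝ) ≤ C)
    (hΔ : ∀ v c, (colorDegree M univ v c : ℝ) ≤ D * C)
    (ht : 0 ≤ t) (htC : t * (2 * C) ≤ 1) (hK : 0 ≤ K) (htK : t * (K + 1) ≤ 1)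
    (hR : n * (D * C) + 1 ≤ R)
    (hB : Real.exp (-(t * (2 * l)) + t ^ 2 * (D * C + n)) + C * (n * (D * (n * Real.exp (2 - K)) +
      Real.exp (-(t * l) + t ^ 2 * (D * (K + 1) ^ 2)) +
      Real.exp (-(t * l) + t ^ 2 * ((4 * C ^ 2 + 1) * D)))) ≤ B) (hBR : 4 * B * R ^ 4 ≤ 1) :
    ∃ ω : V ⊕ V × κ → Option κ, (∀ v a, ω (.inl v) = some a → a ∈ L v) ∧ ∀ i, ∀ v ∈ S i,
      n * x ^ (D * C) - 2 * l < (((L v).filter fun c => Survives M v c ω).card : ℝ) ∧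
      ∀ c ∈ L v, remainCount M (S i) (colorNeighbors M (S i) v c) (partnerColor M v c) ω <
        ((1 - p) * x ^ (D * (C - 1)) + p * (1 - x ^ (D * C))) * D + 2 * l := by
  have hy : 0 < 1 - q := hx.trans_le hxq
  have hp : 0 ≤ p := hnq ▸ mul_nonneg (Nat.cast_nonneg _) hq
  have hn : ∀ v, (L v).card ≤ n := fun v => by
    by_cases h : ∃ i, v ∈ S i
    · obtain ⟨i, hi⟩ := h
      exact (hL i v hi).le
    · simp [hL' v (not_exists.1 h)]
  have hLq : ∀ v, (L v).card * q ≤ 1 := fun v =>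
    (mul_le_mul_of_nonneg_right (Nat.cast_le.2 (hn v)) hq).trans (hnq.trans_le hp1)
  have hpow : ∀ v c, x ^ (D * C : ℝ) ≤ (1 - q) ^ colorDegree M univ v c := fun v c =>
    (Real.rpow_le_rpow_of_exponent_ge hx hx1 (hΔ v c)).trans (by
      rw [Real.rpow_natCast]
      exact pow_le_pow_left₀ hx.le hxq _)
  let e : V × κ → ℝ := fun j => x ^ (D * C : ℝ) / (1 - q) ^ colorDegree M univ j.1 j.2
  have he : ∀ v c, e (v, c) * (1 - q) ^ colorDegree M univ v c = x ^ (D * C : ℝ) := fun v c =>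
    div_mul_cancel₀ _ (pow_pos hy _).ne'
  have hP : IsWeight (weight L q e) := isWeight_weight hq hLq
    (fun j => div_nonneg (Real.rpow_nonneg hx.le _) (pow_pos hy _).le)
    fun j => div_le_one_of_le₀ (hpow _ _) (pow_pos hy _).le
  have hqΔ : q * (D * C) ≤ C := by nlinarith
  let d : ℝ := ((1 - p) * x ^ (D * (C - 1) : ℝ) + p * (1 - x ^ (D * C : ℝ))) * D
  let Z : ι → V → κ → (V ⊕ V × κ → Option κ) → ℝ := fun i v c =>
    remainCount M (S i) (colorNeighbors M (S i) v c) (partnerColor M v c)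
  let E : V → (V ⊕ V × κ → Option κ) → Prop := fun v ω => (∃ a ∈ (L v)ᶜ, ω (.inl v) = some a) ∨
    (∃ i, v ∈ S i) ∧
    ((((L v).filter fun c => Survives M v c ω).card : ℝ) ≤ (L v).card * x ^ (D * C : ℝ) - 2 * l ∨
      ∃ i ∈ univ.filter (fun i => v ∈ S i), ∃ c ∈ L v, d + 2 * l ≤ Z i v c ω)
  have hloc : ∀ v ω ω', (∀ i ∈ localCoords M v, ω i = ω' i) → (E v ω ↔ E v ω') := by
    intro v ω ω' h
    have hself : ∀ v, v ∈ ball M v := fun v => Finset.mem_insert_self _ _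
    have h1 : ∀ u ∈ ball M v, ∀ w ∈ ball M u, ω (.inl w) = ω' (.inl w) := fun u hu w hw =>
      h _ (by simpa [localCoords] using ⟨u, hu, hw⟩)
    have h2 : ∀ u ∈ ball M v, ∀ c, ω (.inr (u, c)) = ω' (.inr (u, c)) := fun u hu c =>
      h _ (by simpa [localCoords] using ⟨u, hu, hself u⟩)
    have h3 : ∀ c, Survives M v c ω ↔ Survives M v c ω' := fun c => by
      rw [Survives, Survives, h2 v (hself v), hitFrom_congr (h1 v (hself v))]
    have h4 : ∀ i c, Z i v c ω = Z i v c ω' := fun i c => by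
      refine Finset.sum_congr rfl fun u hu => ?_
      have hu' : u ∈ ball M v := by
        obtain ⟨b, hb⟩ := (Finset.mem_filter.1 hu).2
        exact Finset.mem_insert_of_mem (by simpa using ⟨b, c, hb⟩)
      exact if_congr (remains_congr (h1 u hu') (h2 u hu' _)) rfl rfl
    simp only [E, h3, h4, h1 v (hself v) v (hself v)]
  have hB0 : 0 ≤ B := le_trans (by positivity) hB
  have hprob : ∀ v, prob (weight L q e) (E v) ≤ B := by
    intro v
    have h0 : prob (weight L q e) (fun ω => ∃ a ∈ (L v)ᶜ, ω (.inl v) = some a) ≤ 0 := by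
      refine (prob_exists_le hP _ _).trans (Finset.sum_nonpos fun a ha => ?_)
      have h := expect_coord hP (.inl v) fun x => if x = some a then (1 : ℝ) else 0
      rw [sum_weight_inl] at h
      have ha' : a ∉ L v := Finset.mem_compl.1 ha
      refine le_of_eq (Eq.trans ?_ (h.trans (by simp [ha'])))
      unfold prob
      congr!
    refine (prob_or_le hP _ _).trans ((add_le_add h0 le_rfl).trans ?_)
    rw [zero_add]
    by_cases hvS : ∃ i, v ∈ S i
    swap
    · refine le_of_eq_of_le ?_ hB0
      simp [prob, hvS, expect_const hP]
    obtain ⟨i₀, hi₀⟩ := hvS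
    refine le_trans (prob_mono hP fun ω hω => hω.2) ((prob_or_le hP _ _).trans
      (le_trans (add_le_add ?_ ?_) hB))
    · have h := prob_card_survives_le hM hP hq (2 * l) ht (by nlinarith) v (fun c _ => he v c)
        fun c _ => hΔ v c
      refine h.trans (Real.exp_le_exp.2 ?_)
      rw [hL i₀ v hi₀, ← mul_assoc (n : ℝ) q, hnq]
      have h5 : p * (D * C) ≤ D * C := by
        have : (0 : ℝ) ≤ D * C := by positivity
        nlinarith
      have := mul_le_mul_of_nonneg_left h5 (sq_nonneg t)
      linarith
    · refine (prob_exists_le hP _ _).trans ?_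
      have hZ : ∀ i ∈ univ.filter (fun i => v ∈ S i), ∀ c ∈ L v,
          prob (weight L q e) (fun ω => d + 2 * l ≤ Z i v c ω) ≤
          D * (n * Real.exp (2 - K)) + Real.exp (-(t * l) + t ^ 2 * (D * (K + 1) ^ 2)) +
            Real.exp (-(t * l) + t ^ 2 * ((4 * C ^ 2 + 1) * D)) := by
        intro i hi c hc
        have hvi : v ∈ S i := (Finset.mem_filter.1 hi).2
        have hUD : (colorNeighbors M (S i) v c).card ≤ D := hS i v hvi c
        have hUD' : ((colorNeighbors M (S i) v c).card : ℝ) ≤ D := Nat.cast_le.2 hUD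
        have hUS : colorNeighbors M (S i) v c ⊆ S i := Finset.filter_subset _ _
        have h1 := expect_remainCount_le hM hP hq (τ := partnerColor M v c) hx hx1 hxq hC hp hp1
          hΔ he (fun u hu => by rw [hL i u (hUS hu), hnq]) (fun u hu => hS i u (hUS hu) _) hUD
        have h2 := prob_remainCount_le hM hP hq (τ := partnerColor M v c) hLq hn hC hΔ hqΔ hUS
          (hSc i) ((mul_le_mul_of_nonneg_right hUD' hq).trans hDq) l ht htC hK htK
        refine (prob_mono hP fun ω hω => (add_le_add h1 le_rfl).trans hω).trans (h2.trans ?_)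
        gcongr
      refine (Finset.sum_le_sum fun i hi => (prob_exists_le hP _ _).trans
        (Finset.sum_le_sum (hZ i hi))).trans ?_
      rw [Finset.sum_const, Finset.sum_const, nsmul_eq_mul, nsmul_eq_mul, hL i₀ v hi₀]
      exact mul_le_mul_of_nonneg_right (hv i₀ v hi₀) (by positivity)
  have hball : ∀ v, (ball M v).card ≤ R := fun v => by
    exact_mod_cast (card_ball_le hM hn (by positivity) hΔ v).trans hR
  have hR1 : (1 : ℝ) ≤ R := le_trans (by
    have : (0 : ℝ) ≤ n * (D * C) := by positivity
    linarith) hR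
  obtain ⟨ω, hω⟩ := exists_forall_not_of_prob_le hP E (localCoords M) hloc hprob
    (card_not_disjoint_localCoords_le hM hball) (by exact_mod_cast hBR) (by
      have : (1 : ℝ) ≤ (R : ℝ) ^ 4 := one_le_pow₀ hR1
      nlinarith)
  refine ⟨ω, fun v a ha => ?_, fun i v hi => ⟨?_, fun c hc => ?_⟩⟩
  · by_contra h
    exact hω v (Or.inl ⟨a, Finset.mem_compl.2 h, ha⟩)
  · by_contra h
    exact hω v (Or.inr ⟨⟨i, hi⟩, Or.inl (by rw [hL i v hi]; exact not_lt.1 h)⟩)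
  · by_contra h
    exact hω v (Or.inr ⟨⟨i, hi⟩, Or.inr ⟨i, by simpa using hi, c, hc, not_lt.1 h⟩⟩)

theorem exists_partial_coloring {ι : Type*} [Fintype ι] (hM : IsCorrespondence M L)
    {S : ι → Finset V} (hL : ∀ v, (∀ i, v ∉ S i) → L v = ∅) {ω : V ⊕ V × κ → Option κ}
    (hω : ∀ v a, ω (.inl v) = some a → a ∈ L v) {N : ℕ} {d : ℝ}
    (h : ∀ i, ∀ v ∈ S i, N ≤ ((L v).filter fun c => Survives M v c ω).card ∧
      ∀ c ∈ L v, remainCount M (S i) (colorNeighbors M (S i) v c) (partnerColor M v c) ω ≤ d) :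
    ∃ (X : Finset V) (φ : V → Option κ) (L' : V → Finset κ),
      (∀ v ∈ X, ∃ i, v ∈ S i) ∧ (∀ v ∈ X, ∃ a ∈ L v, φ v = some a) ∧
      (∀ u ∈ X, ∀ v ∈ X, ∀ a b, φ u = some a → φ v = some b → ¬ M u a v b) ∧
      (∀ v, L' v ⊆ L v) ∧
      (∀ i, ∀ v ∈ S i, (L' v).card = N ∧ ∀ c ∈ L' v, ∀ u ∈ X, ∀ a, φ u = some a → ¬ M u a v c) ∧
      (∀ i, ∀ v ∈ S i, ∀ c ∈ L' v,
        (((S i).filter fun u => u ∉ X ∧ ∃ b ∈ L' u, M u b v c).card : ℝ) ≤ d) := by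
  have hsub : ∀ v, ∃ A ⊆ (L v).filter fun c => Survives M v c ω,
      (∀ i, v ∈ S i → A.card = N) := fun v => by
    by_cases hv : ∃ i, v ∈ S i
    · obtain ⟨i, hi⟩ := hv
      obtain ⟨A, hA, hAN⟩ := Finset.exists_subset_card_eq (h i v hi).1
      exact ⟨A, hA, fun _ _ => hAN⟩
    · exact ⟨∅, by simp, fun i hi => (hv ⟨i, hi⟩).elim⟩
  choose L' hL' hcard using hsub
  have hS : ∀ v, ∀ c ∈ L' v, Survives M v c ω := fun v c hc => (Finset.mem_filter.1 (hL' v hc)).2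
  refine ⟨univ.filter fun v => ∃ a, ω (.inl v) = some a ∧ ¬ HitFrom M univ ω v a,
    fun v => ω (.inl v), L', ?_, ?_, ?_, fun v => (hL' v).trans (Finset.filter_subset _ _), ?_, ?_⟩
  · intro v hv
    obtain ⟨a, ha, -⟩ := (Finset.mem_filter.1 hv).2
    by_contra hvS
    have := hω v a ha
    rw [hL v (not_exists.1 hvS)] at this
    simp at this
  · intro v hv
    obtain ⟨a, ha, -⟩ := (Finset.mem_filter.1 hv).2
    exact ⟨a, hω v a ha, ha⟩
  · intro u _ v hv a b ha hb hMab
    obtain ⟨b', hb', hn⟩ := (Finset.mem_filter.1 hv).2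
    replace hb' : some b = some b' := hb.symm.trans hb'
    rw [Option.some.injEq] at hb'
    subst hb'
    exact hn ⟨u, Finset.mem_univ _, a, ha, hMab⟩
  · intro i v hi
    exact ⟨hcard v i hi, fun c hc u _ a ha hMa =>
      (hS v c hc).2 ⟨u, Finset.mem_univ _, a, ha, hMa⟩⟩
  · intro i v hi c hc
    refine le_trans ?_ ((h i v hi).2 c (Finset.mem_filter.1 (hL' v hc)).1)
    rw [remainCount, ← Finset.sum_filter, Finset.sum_const, nsmul_eq_mul, mul_one]
    refine Nat.cast_le.2 (Finset.card_le_card fun u hu => ?_)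
    obtain ⟨hui, huX, b, hb, hMb⟩ := Finset.mem_filter.1 hu
    refine Finset.mem_filter.2 ⟨Finset.mem_filter.2 ⟨hui, b, hMb⟩, ?_⟩
    rw [partnerColor_eq hM hMb]
    rcases hx : ω (.inl u) with _ | a
    · refine Or.inl ⟨hx, (hS u b hb).1, fun ⟨w, _, h'⟩ => (hS u b hb).2 ⟨w, Finset.mem_univ _, h'⟩⟩
    · refine Or.inr ⟨a, hx, ?_⟩
      by_contra hn
      exact huX (Finset.mem_filter.2 ⟨Finset.mem_univ _, a, hx, hn⟩)

end Outcome

section Parameters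

theorem failure_le {C y D n : ℝ} (hC : 1 ≤ C) (hy4 : 4 ≤ y) (hD10 : D = y ^ 10)
    (hn0 : 0 ≤ n) (hn : n ≤ 11 * C * D) :
    Real.exp (-((y ^ 5)⁻¹ * (2 * (y ^ 8 / 2))) + ((y ^ 5)⁻¹) ^ 2 * (D * C + n)) +
      C * (n * (D * (n * Real.exp (2 - y)) +
        Real.exp (-((y ^ 5)⁻¹ * (y ^ 8 / 2)) + ((y ^ 5)⁻¹) ^ 2 * (D * (y + 1) ^ 2)) +
        Real.exp (-((y ^ 5)⁻¹ * (y ^ 8 / 2)) +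
          ((y ^ 5)⁻¹) ^ 2 * ((4 * C ^ 2 + 1) * D)))) ≤
      Real.exp (12 * C + 4 * C ^ 2 + 2) * (1 + C * (11 * C * (11 * C + 2))) *
        (y ^ 30 * Real.exp (-y)) := by
  have hy0 : 0 < y := by linarith
  have hy1 : 1 ≤ y := by linarith
  have hy3 : 16 * y ≤ y ^ 3 := by
    have : 4 ^ 2 ≤ y ^ 2 := pow_le_pow_left₀ (by norm_num) hy4 2
    nlinarith
  have hD0 : 0 ≤ D := hD10 ▸ by positivity
  have ht8 : (y ^ 5)⁻¹ * (y ^ 8 / 2) = y ^ 3 / 2 := by field_simp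
  have ht2 : ((y ^ 5)⁻¹) ^ 2 * D = 1 := by rw [hD10]; field_simp
  have hexp_le : ∀ r s : ℝ, r ≤ s - y → s ≤ 12 * C + 4 * C ^ 2 + 2 →
      Real.exp r ≤ Real.exp (12 * C + 4 * C ^ 2 + 2) * Real.exp (-y) := fun r s h h' => by
    rw [← Real.exp_add]
    exact Real.exp_le_exp.2 (by linarith)
  have e1 : Real.exp (-((y ^ 5)⁻¹ * (2 * (y ^ 8 / 2))) + ((y ^ 5)⁻¹) ^ 2 * (D * C + n)) ≤
      Real.exp (12 * C + 4 * C ^ 2 + 2) * Real.exp (-y) := by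
    refine hexp_le _ (12 * C) ?_ (by nlinarith)
    have h5 : ((y ^ 5)⁻¹) ^ 2 * (n : ℝ) ≤ ((y ^ 5)⁻¹) ^ 2 * (11 * C * D) := by gcongr
    have h6 : ((y ^ 5)⁻¹) ^ 2 * (11 * C * D) = 11 * C := by linear_combination 11 * C * ht2
    have h7 : ((y ^ 5)⁻¹) ^ 2 * (D * C) = C := by linear_combination C * ht2
    have h8 : (y ^ 5)⁻¹ * (2 * (y ^ 8 / 2)) = y ^ 3 := by linear_combination 2 * ht8
    rw [mul_add]
    linarith
  have e2 : Real.exp (2 - y) ≤ Real.exp (12 * C + 4 * C ^ 2 + 2) * Real.exp (-y) :=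
    hexp_le _ 2 le_rfl (by nlinarith)
  have e3 : Real.exp (-((y ^ 5)⁻¹ * (y ^ 8 / 2)) + ((y ^ 5)⁻¹) ^ 2 * (D * (y + 1) ^ 2)) ≤
      Real.exp (12 * C + 4 * C ^ 2 + 2) * Real.exp (-y) := by
    refine hexp_le _ 0 ?_ (by nlinarith)
    rw [ht8, ← mul_assoc, ht2]
    nlinarith
  have e4 : Real.exp (-((y ^ 5)⁻¹ * (y ^ 8 / 2)) + ((y ^ 5)⁻¹) ^ 2 * ((4 * C ^ 2 + 1) * D)) ≤
      Real.exp (12 * C + 4 * C ^ 2 + 2) * Real.exp (-y) := by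
    refine hexp_le _ (4 * C ^ 2 + 1) ?_ (by nlinarith)
    rw [ht8, mul_comm (4 * C ^ 2 + 1), ← mul_assoc, ht2]
    linarith
  set E : ℝ := Real.exp (12 * C + 4 * C ^ 2 + 2) * Real.exp (-y) with hE
  have hE0 : 0 < E := by positivity
  have hp20 : (1 : ℝ) ≤ y ^ 20 := one_le_pow₀ hy1
  have hp30 : (1 : ℝ) ≤ y ^ 30 := one_le_pow₀ hy1
  calc _ ≤ E + C * (11 * C * D * (D * (11 * C * D * E) + E + E)) := by gcongr
    _ = E * (1 + C * (11 * C * (11 * C * y ^ 30 + 2 * y ^ 10))) := by rw [hD10]; ring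
    _ ≤ E * (y ^ 30 + C * (11 * C * (11 * C * y ^ 30 + 2 * y ^ 30))) := by
        gcongr; linarith
    _ = _ := by rw [hE]; ring

open Filter in
theorem exists_parameters {C : ℝ} (hC : 1 ≤ C) : ∃ D₀ : ℕ, ∀ D : ℕ, D₀ ≤ D →
    1 ≤ D ∧ 2 * C ≤ Real.log D ∧ 2 ≤ (D : ℝ) ^ ((1 : ℝ) / 5) ∧
    ∃ t K B : ℝ, 0 ≤ t ∧ t * (2 * C) ≤ 1 ∧ 0 ≤ K ∧ t * (K + 1) ≤ 1 ∧
      ∀ n R : ℕ, (n : ℝ) ≤ 11 * C * D → (R : ℝ) ≤ 13 * C ^ 2 * D ^ 2 → 4 * B * R ^ 4 ≤ 1 ∧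
        Real.exp (-(t * (2 * ((D : ℝ) ^ ((4 : ℝ) / 5) / 2))) + t ^ 2 * (D * C + n)) +
          C * (n * (D * (n * Real.exp (2 - K)) +
            Real.exp (-(t * ((D : ℝ) ^ ((4 : ℝ) / 5) / 2)) + t ^ 2 * (D * (K + 1) ^ 2)) +
            Real.exp (-(t * ((D : ℝ) ^ ((4 : ℝ) / 5) / 2)) +
              t ^ 2 * ((4 * C ^ 2 + 1) * D)))) ≤ B := by
  set A : ℝ := Real.exp (12 * C + 4 * C ^ 2 + 2) * (1 + C * (11 * C * (11 * C + 2))) with hA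
  have hA0 : 0 ≤ A := by positivity
  have hy : Tendsto (fun D : ℕ => (D : ℝ) ^ ((1 : ℝ) / 10)) atTop atTop :=
    (tendsto_rpow_atTop (by norm_num)).comp tendsto_natCast_atTop_atTop
  have hlog : Tendsto (fun D : ℕ => Real.log D) atTop atTop :=
    Real.tendsto_log_atTop.comp tendsto_natCast_atTop_atTop
  have hexp : Tendsto (fun y : ℝ => 4 * A * (13 * C ^ 2) ^ 4 * (y ^ 110 * Real.exp (-y))) atTop
      (nhds 0) := by
    simpa using (Real.tendsto_pow_mul_exp_neg_atTop_nhds_zero 110).const_mul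
      (4 * A * (13 * C ^ 2) ^ 4)
  have hev := (eventually_ge_atTop 1).and ((hlog.eventually_ge_atTop (2 * C)).and
    ((hy.eventually_ge_atTop (4 + 2 * C)).and
      ((hexp.comp hy).eventually_le_const zero_lt_one)))
  obtain ⟨D₀, hD₀⟩ := eventually_atTop.1 hev
  refine ⟨D₀, fun D hD => ?_⟩
  obtain ⟨h1, h2, h3, h4⟩ := hD₀ D hD
  set y : ℝ := (D : ℝ) ^ ((1 : ℝ) / 10) with hydef
  have hD0 : (0 : ℝ) ≤ D := Nat.cast_nonneg D
  have hDy : ∀ k : ℕ, (D : ℝ) ^ ((k : ℝ) / 10) = y ^ k := fun k => by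
    rw [hydef, ← Real.rpow_natCast, ← Real.rpow_mul hD0]
    congr 1; ring
  have hD10 : (D : ℝ) = y ^ 10 := by
    rw [← hDy]; norm_num
  have hD5 : (D : ℝ) ^ ((1 : ℝ) / 5) = y ^ 2 := by
    rw [← hDy]; norm_num
  have hD8 : (D : ℝ) ^ ((4 : ℝ) / 5) = y ^ 8 := by
    rw [← hDy]; norm_num
  have hy4 : 4 ≤ y := by linarith
  have hy0 : 0 < y := by linarith
  have hy1 : 1 ≤ y := by linarith
  have hy5 : y ≤ y ^ 5 := le_self_pow₀ hy1 (by norm_num)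
  have hy45 : y + 1 ≤ y ^ 5 := by
    have : y ^ 2 ≤ y ^ 5 := pow_le_pow_right₀ hy1 (by norm_num)
    nlinarith
  refine ⟨h1, h2, by rw [hD5]; nlinarith, (y ^ 5)⁻¹, y, A * (y ^ 30 * Real.exp (-y)),
    by positivity, ?_, hy0.le, ?_, fun n R hn hR => ⟨?_, ?_⟩⟩
  · rw [inv_mul_le_iff₀ (by positivity)]; linarith
  · rw [inv_mul_le_iff₀ (by positivity)]; linarith
  · refine le_trans ?_ h4
    calc 4 * (A * (y ^ 30 * Real.exp (-y))) * R ^ 4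
        ≤ 4 * (A * (y ^ 30 * Real.exp (-y))) * (13 * C ^ 2 * D ^ 2) ^ 4 := by gcongr
      _ = _ := by rw [hD10]; simp only [Function.comp, ← hydef]; ring
  · rw [hD8]
    exact failure_le hC hy4 hD10 (Nat.cast_nonneg n) hn

end Parameters

section Existence

open scoped Classical

theorem exists_nibble {C : ℝ} (hC : 1 ≤ C) : ∃ D₀ : ℕ, ∀ D : ℕ, D₀ ≤ D →
    ∀ (V κ ι : Type) [Fintype V] [DecidableEq V] [Fintype κ] [DecidableEq κ] [Fintype ι]
      (M : V → κ → V → κ → Prop) (L : V → Finset κ) (S : ι → Finset V) (Λ p : ℝ),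
      IsCorrespondence M L →
      (∀ i, ∀ v ∈ S i, ((L v).card : ℤ) = ⌈Λ⌉) → (∀ v, (∀ i, v ∉ S i) → L v = ∅) →
      (∀ i, ∀ v ∈ S i, ∀ c, colorDegree M (S i) v c ≤ D) →
      (∀ i, ∀ w ∉ S i, (((S i).filter fun u => ∃ b c, M w b u c).card : ℝ) ≤ C) →
      (∀ i, ∀ v ∈ S i, ((univ.filter fun j => v ∈ S j).card : ℝ) ≤ C) →
      (∀ v c, (colorDegree M univ v c : ℝ) ≤ D * C) →
      D ≤ Λ → Λ ≤ 10 * C * D → 0 ≤ p → p ≤ (Real.log D)⁻¹ →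
      ∃ (X : Finset V) (φ : V → Option κ) (L' : V → Finset κ),
        (∀ v ∈ X, ∃ i, v ∈ S i) ∧ (∀ v ∈ X, ∃ a ∈ L v, φ v = some a) ∧
        (∀ u ∈ X, ∀ v ∈ X, ∀ a b, φ u = some a → φ v = some b → ¬ M u a v b) ∧
        (∀ v, L' v ⊆ L v) ∧
        (∀ i, ∀ v ∈ S i, ((L' v).card : ℤ) = ⌈lamNew Λ D C p - Λ ^ ((4 : ℝ) / 5)⌉ ∧
          ∀ c ∈ L' v, ∀ u ∈ X, ∀ a, φ u = some a → ¬ M u a v c) ∧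
        (∀ i, ∀ v ∈ S i, ∀ c ∈ L' v,
          (((S i).filter fun u => u ∉ X ∧ ∃ b ∈ L' u, M u b v c).card : ℝ) ≤
            degNew Λ D C p + (D : ℝ) ^ ((4 : ℝ) / 5)) := by
  obtain ⟨D₀, hD₀⟩ := exists_parameters hC
  refine ⟨D₀, fun D hD V κ ι _ _ _ _ _ M L S Λ p hM hL hL' hS hSc hv hΔ hDΛ hΛ hp0 hp => ?_⟩
  obtain ⟨hD1, hlog, hD5, t, K, B, ht, htC, hK, htK, hpar⟩ := hD₀ D hD
  have hD1' : (1 : ℝ) ≤ D := by exact_mod_cast hD1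
  have hΛ1 : 1 ≤ Λ := hD1'.trans hDΛ
  have hΛ0 : 0 < Λ := by linarith
  have hpC : p * C ≤ 1 / 2 := by
    have h1 : (Real.log D)⁻¹ ≤ (2 * C)⁻¹ := inv_anti₀ (by linarith) hlog
    calc p * C ≤ (2 * C)⁻¹ * C := mul_le_mul_of_nonneg_right (hp.trans h1) (by linarith)
      _ = 1 / 2 := by field_simp
  have hp2 : p ≤ 1 / 2 := le_trans (le_mul_of_one_le_right hp0 hC) hpC
  set n : ℕ := ⌈Λ⌉₊ with hn
  have hnΛ : Λ ≤ n := Nat.le_ceil Λ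
  have hn0 : (0 : ℝ) < n := hΛ0.trans_le hnΛ
  have hn_le : (n : ℝ) ≤ 11 * C * D := by
    have h1 : (n : ℝ) < Λ + 1 := Nat.ceil_lt_add_one hΛ0.le
    have h2 : 1 ≤ C * D := one_le_mul_of_one_le_of_one_le hC hD1'
    linarith
  have hLn : ∀ i, ∀ v ∈ S i, (L v).card = n := fun i v hi => by
    have h1 := hL i v hi
    rw [← Int.natCast_ceil_eq_ceil hΛ0.le] at h1
    exact_mod_cast h1
  set x : ℝ := 1 - p / Λ with hx
  have hpΛ : p / Λ ≤ p := div_le_self hp0 hΛ1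
  have hpΛ0 : 0 ≤ p / Λ := div_nonneg hp0 hΛ0.le
  have hx0 : 0 < x := by linarith
  have hx1 : x ≤ 1 := by linarith
  have hxs : 1 / 2 ≤ x ^ (D * C : ℝ) := by
    have h1 := one_add_mul_self_le_rpow_one_add (s := -(p / Λ)) (p := D * C) (by linarith)
      (one_le_mul_of_one_le_of_one_le hD1' hC)
    rw [← sub_eq_add_neg] at h1
    refine le_trans ?_ h1
    have h2 : D * (p / Λ) ≤ p := by
      rw [← mul_div_assoc, div_le_iff₀ hΛ0, mul_comm]
      exact mul_le_mul_of_nonneg_left hDΛ hp0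
    nlinarith
  have hlam : 0 ≤ lamNew Λ D C p - Λ ^ ((4 : ℝ) / 5) := by
    have h1 : 2 ≤ Λ ^ ((1 : ℝ) / 5) :=
      hD5.trans (Real.rpow_le_rpow (by linarith) hDΛ (by norm_num))
    have h2 : Λ = Λ ^ ((4 : ℝ) / 5) * Λ ^ ((1 : ℝ) / 5) := by
      rw [← Real.rpow_add hΛ0]; norm_num
    have h3 : 0 < Λ ^ ((4 : ℝ) / 5) := Real.rpow_pos_of_pos hΛ0 _
    have h4 : 1 / 2 * Λ ≤ lamNew Λ D C p := mul_le_mul_of_nonneg_right hxs hΛ0.le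
    nlinarith
  obtain ⟨hBR, hB⟩ := hpar n (⌈(n : ℝ) * (D * C)⌉₊ + 1) hn_le (by
    have h1 : (⌈(n : ℝ) * (D * C)⌉₊ : ℝ) < n * (D * C) + 1 := Nat.ceil_lt_add_one (by positivity)
    have h2 : (n : ℝ) * (D * C) ≤ 11 * C * D * (D * C) := by gcongr
    have h3 : 1 ≤ C ^ 2 * (D : ℝ) ^ 2 :=
      one_le_mul_of_one_le_of_one_le (one_le_pow₀ hC) (one_le_pow₀ hD1')
    push_cast
    nlinarith)
  obtain ⟨ω, hω, hgood⟩ := exists_good_outcome hM S (q := p / n) hC (div_nonneg hp0 hn0.le) hx0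
    hx1 (sub_le_sub_left (div_le_div_of_nonneg_left hp0 hΛ0 hnΛ) 1) (by linarith)
    (mul_div_cancel₀ _ hn0.ne') (by
      rw [← mul_div_assoc, div_le_one hn0]
      nlinarith) hLn hL' hS hSc hv hΔ ht htC hK htK
    (by push_cast; linarith [Nat.le_ceil ((n : ℝ) * (D * C))]) hB hBR
  have hl : 2 * ((D : ℝ) ^ ((4 : ℝ) / 5) / 2) = (D : ℝ) ^ ((4 : ℝ) / 5) := by ring
  rw [hl] at hgood
  have hN : ∀ i, ∀ v ∈ S i, ⌈lamNew Λ D C p - Λ ^ ((4 : ℝ) / 5)⌉₊ ≤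
      ((L v).filter fun c => Survives M v c ω).card := fun i v hi => by
    refine Nat.ceil_le.2 (le_trans ?_ (hgood i v hi).1.le)
    have h1 : (D : ℝ) ^ ((4 : ℝ) / 5) ≤ Λ ^ ((4 : ℝ) / 5) :=
      Real.rpow_le_rpow (by linarith) hDΛ (by norm_num)
    have h2 : lamNew Λ D C p ≤ n * x ^ (D * C : ℝ) := by
      rw [lamNew, mul_comm]
      exact mul_le_mul_of_nonneg_right hnΛ (by linarith)
    linarith
  obtain ⟨X, φ, L'', h1, h2, h3, h4, h5, h6⟩ := exists_partial_coloring hM hL' hω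
    (d := degNew Λ D C p + (D : ℝ) ^ ((4 : ℝ) / 5)) fun i v hi =>
      ⟨hN i v hi, fun c hc => ((hgood i v hi).2 c hc).le⟩
  refine ⟨X, φ, L'', h1, h2, h3, h4, fun i v hi => ⟨?_, (h5 i v hi).2⟩, h6⟩
  rw [(h5 i v hi).1, Int.natCast_ceil_eq_ceil hlam]

end Existence

end Nibble

/-- **The nibble lemma (correspondence version).**
A correspondence assignment is modelled by a list assignment `L` together with a
symmetric relation `M` on pairs `(vertex, color)` supported on edges of `G = ⋃ᵢ Gᵢ`,
which is a matching on each edge.  For `C, ε > 0` and sufficiently large `D`: if the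
`Gᵢ` are nearly disjoint, every vertex lies in at most `C` of them, all color degrees
in each `Gᵢ` are at most `D`, lists have size exactly `⌈Λ⌉` with `(1 + ε)D ≤ Λ ≤ 10CD`,
and `(log D)⁻¹ ≥ p ≥ (log D)⁻²`, then there exist `X ⊆ V(G)`, an
`(L|_X, M|_{E(G[X])})`-coloring `φ` of `G[X]`, and a list assignment `L'` for `G - X`
with `L'(v) ⊆ {c ∈ L(v) : (v, c) ∉ ⋃_{u ∈ X} N_{G,(L,M)}(u, φ(u))}`, such that
(1) `|L'(v)| = ⌈λ'(Λ,D,C,p) - Λ^{4/5}⌉` for every `v ∈ V(G) \ X`, and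
(2) `Δ(Gᵢ - X, (L'|, M|)) ≤ D'(Λ,D,C,p) + D^{4/5}` for every `i`. -/
theorem nibble_lemma_correspondence (C ε : ℝ) (hC : 0 < C) (hε : 0 < ε) :
    ∃ D₄ : ℕ, ∀ D : ℕ, D₄ ≤ D →
      ∀ (V : Type) [Fintype V] [DecidableEq V] (m : ℕ) (G : Fin m → SimpleGraph V)
        [∀ i, DecidableRel (G i).Adj] (S : Fin m → Finset V) (L : V → Finset ℕ)
        (M : V × ℕ → V × ℕ → Prop) [DecidableRel M] (Λ p : ℝ),
        (∀ i u v, (G i).Adj u v → u ∈ S i ∧ v ∈ S i) →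
        (∀ i j, i ≠ j → (S i ∩ S j).card ≤ 1) →
        (∀ v ∈ (univ : Finset (Fin m)).biUnion S,
          ((univ.filter fun i => v ∈ S i).card : ℝ) ≤ C) →
        -- `M` is supported on edges of `G` with colors from the lists
        (∀ q r, M q r → (⨆ i, G i).Adj q.1 r.1 ∧ q.2 ∈ L q.1 ∧ r.2 ∈ L r.1) →
        -- `M` is symmetric
        (∀ q r, M q r → M r q) →
        -- `M(e)` is a matching for every edge `e`
        (∀ q r r', M q r → M q r' → r.1 = r'.1 → r.2 = r'.2) →
        -- color degree at most `D` within each `Gᵢ`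
        (∀ i, ∀ v ∈ S i, ∀ c ∈ L v,
          (((G i).neighborFinset v).filter fun u => ∃ c' ∈ L u, M (v, c) (u, c')).card ≤ D) →
        (∀ v ∈ (univ : Finset (Fin m)).biUnion S, ((L v).card : ℤ) = ⌈Λ⌉) →
        (1 + ε) * D ≤ Λ → Λ ≤ 10 * C * D →
        p ≤ (Real.log D)⁻¹ → ((Real.log D) ^ 2)⁻¹ ≤ p →
        ∃ (X : Finset V) (φ : V → ℕ) (L' : V → Finset ℕ),
          X ⊆ (univ : Finset (Fin m)).biUnion S ∧
          (∀ v ∈ X, φ v ∈ L v) ∧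
          (∀ u v, u ∈ X → v ∈ X → (⨆ i, G i).Adj u v → ¬ M (u, φ u) (v, φ v)) ∧
          (∀ v ∈ (univ : Finset (Fin m)).biUnion S, v ∉ X →
            L' v ⊆ L v ∧ ∀ c ∈ L' v, ∀ u ∈ X, ¬ M (u, φ u) (v, c)) ∧
          (∀ v ∈ (univ : Finset (Fin m)).biUnion S, v ∉ X →
            ((L' v).card : ℤ) = ⌈lamNew Λ D C p - Λ ^ ((4 : ℝ) / 5)⌉) ∧
          (∀ i, ∀ v ∈ S i, v ∉ X → ∀ c ∈ L' v,
            ((((G i).neighborFinset v).filter fun u =>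
                u ∉ X ∧ ∃ c' ∈ L' u, M (v, c) (u, c')).card : ℝ)
              ≤ degNew Λ D C p + (D : ℝ) ^ ((4 : ℝ) / 5)) := by
  classical
  by_cases hC1 : 1 ≤ C
  swap
  · refine ⟨0, fun D _ V _ _ m G _ S L M _ Λ p _ _ hv _ _ _ _ _ _ _ _ _ => ?_⟩
    have hemp : ∀ i v, v ∉ S i := fun i v hi => hC1 <| by
      refine le_trans ?_ (hv v (Finset.mem_biUnion.2 ⟨i, Finset.mem_univ _, hi⟩))
      exact_mod_cast Finset.card_pos.2 ⟨i, by simpa using hi⟩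
    exact ⟨∅, fun _ => 0, fun _ => ∅, by simp, by simp, by simp, by simp [hemp], by simp [hemp],
      fun i v hi => (hemp i v hi).elim⟩
  obtain ⟨D₀, hD₀⟩ := Nibble.exists_nibble hC1
  refine ⟨D₀, fun D hD V _ _ m G _ S L M _ Λ p hG hS hv hM hsymm hmatch hdeg hL hΛ1 hΛ2 hp1 hp2 =>
    ?_⟩
  have hW : ∀ {i v}, v ∈ S i → v ∈ (univ : Finset (Fin m)).biUnion S := fun {i v} hi =>
    Finset.mem_biUnion.2 ⟨i, Finset.mem_univ _, hi⟩
  have hadj : ∀ {q r}, M q r → ∃ i, (G i).Adj q.1 r.1 := fun {q r} h => by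
    simpa using (hM q r h).1
  have hadjS : ∀ {q r} i, M q r → q.1 ∈ S i → r.1 ∈ S i → (G i).Adj q.1 r.1 := by
    intro q r i h hq hr
    obtain ⟨j, hj⟩ := hadj h
    obtain rfl | hij := eq_or_ne i j
    · exact hj
    · obtain ⟨hq', hr'⟩ := hG j _ _ hj
      exact absurd (Finset.card_le_one.1 (hS i j hij) _ (Finset.mem_inter.2 ⟨hq, hq'⟩) _
        (Finset.mem_inter.2 ⟨hr, hr'⟩)) hj.ne
  have hcd : ∀ i, ∀ v ∈ S i, ∀ c, ((S i).filter fun u => ∃ b, M (u, b) (v, c)).card ≤ D := by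
    intro i v hi c
    by_cases hc : c ∈ L v
    · refine (Finset.card_le_card fun u hu => ?_).trans (hdeg i v hi c hc)
      obtain ⟨hui, b, hb⟩ := Finset.mem_filter.1 hu
      rw [Finset.mem_filter, SimpleGraph.mem_neighborFinset]
      exact ⟨(hadjS i hb hui hi).symm, b, (hM _ _ hb).2.1, hsymm _ _ hb⟩
    · rw [Finset.filter_false_of_mem fun u _ ⟨b, hb⟩ => hc (hM _ _ hb).2.2]
      simp
  obtain ⟨K, hκ⟩ : ∃ K : Finset ℕ, ∀ v, ∀ c ∈ L v, c ∈ K :=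
    ⟨univ.biUnion L, fun v c h => Finset.mem_biUnion.2 ⟨v, Finset.mem_univ _, h⟩⟩
  obtain ⟨M', hMM⟩ : ∃ M' : V → K → V → K → Prop, ∀ {v a w b}, M' v a w b ↔ M (v, a.1) (w, b.1) :=
    ⟨fun v a w b => M (v, a.1) (w, b.1), Iff.rfl⟩
  set W : Finset V := (univ : Finset (Fin m)).biUnion S
  obtain ⟨L₀, hL₀⟩ : ∃ L₀ : V → Finset K, ∀ v a, a ∈ L₀ v ↔ v ∈ W ∧ a.1 ∈ L v :=
    ⟨fun v => univ.filter fun a => v ∈ W ∧ a.1 ∈ L v, fun v a => by simp⟩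
  have hmap : ∀ v ∈ W, (L₀ v).map (Function.Embedding.subtype _) = L v := fun v hvW => by
    ext c
    simp only [Finset.mem_map, hL₀, hvW, true_and, Function.Embedding.coe_subtype]
    exact ⟨fun ⟨a, ha, h⟩ => h ▸ ha, fun h => ⟨⟨c, hκ v c h⟩, h, rfl⟩⟩
  have hM' : Nibble.IsCorrespondence M' L₀ :=
    { symm := fun h => hMM.2 (hsymm _ _ (hMM.1 h))
      irrefl := fun v c b h => (hadj (hMM.1 h)).elim fun i hi => hi.ne rfl
      mem_list := fun {v c w b} h => (hL₀ w b).2 ⟨(hadj (hMM.1 h)).elim fun i hi =>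
        hW (hG i _ _ hi).2, (hM _ _ (hMM.1 h)).2.2⟩
      unique := fun h h' => Subtype.ext (hmatch _ _ _ (hMM.1 h) (hMM.1 h') rfl) }
  have hcd' : ∀ i, ∀ v ∈ S i, ∀ c, Nibble.colorDegree M' (S i) v c ≤ D := fun i v hi c =>
    (Finset.card_le_card fun u hu => by
      obtain ⟨hui, b, hb⟩ := Finset.mem_filter.1 hu
      exact Finset.mem_filter.2 ⟨hui, b, hMM.1 hb⟩).trans (hcd i v hi c)
  have hv' : ∀ v, ((univ.filter fun j => v ∈ S j).card : ℝ) ≤ C := fun v => by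
    by_cases h : v ∈ W
    · exact hv v h
    · rw [Finset.filter_false_of_mem fun i _ hi => h (hW hi)]
      simpa using hC.le
  have hout : ∀ i, ∀ w ∉ S i, (((S i).filter fun u => ∃ b c, M' w b u c).card : ℝ) ≤ C := by
    intro i w hw
    refine le_trans (Nat.cast_le.2 ?_) (hv' w)
    refine (Finset.card_le_card (t := (univ.filter fun j => w ∈ S j).biUnion fun j => S i ∩ S j)
      fun u hu => ?_).trans ((Finset.card_biUnion_le_card_mul _ _ 1 fun j hj => hS i j ?_).trans
        (mul_one _).le)
    · obtain ⟨hui, b, c, h⟩ := Finset.mem_filter.1 hu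
      obtain ⟨j, hj⟩ := hadj (hMM.1 h)
      obtain ⟨hwj, huj⟩ := hG j _ _ hj
      exact Finset.mem_biUnion.2 ⟨j, by simpa using hwj, Finset.mem_inter.2 ⟨hui, huj⟩⟩
    · rintro rfl
      exact hw (by simpa using hj)
  have htotal : ∀ v c, (Nibble.colorDegree M' univ v c : ℝ) ≤ D * C := by
    intro v c
    have h : Nibble.colorDegree M' univ v c ≤ (univ.filter fun j => v ∈ S j).card * D := by
      refine (Finset.card_le_card (t := (univ.filter fun j => v ∈ S j).biUnion fun j =>
        (S j).filter fun u => ∃ b, M (u, b) (v, c)) fun u hu => ?_).trans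
          (Finset.card_biUnion_le_card_mul _ _ D fun j hj => hcd j v (by simpa using hj) c)
      obtain ⟨-, b, h⟩ := Finset.mem_filter.1 hu
      rw [hMM] at h
      obtain ⟨j, hj⟩ := hadj h
      obtain ⟨huj, hvj⟩ := hG j _ _ hj
      exact Finset.mem_biUnion.2 ⟨j, by simpa using hvj, Finset.mem_filter.2 ⟨huj, b, h⟩⟩
    calc (Nibble.colorDegree M' univ v c : ℝ) ≤ (univ.filter fun j => v ∈ S j).card * D := by
          exact_mod_cast h
      _ ≤ C * D := mul_le_mul_of_nonneg_right (hv' v) (Nat.cast_nonneg _)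
      _ = D * C := mul_comm _ _
  obtain ⟨X, φ, L', h1, h2, h3, h4, h5, h6⟩ := hD₀ D hD V K (Fin m) M' L₀ S Λ p hM'
    (fun i v hi => by rw [← hL v (hW hi), ← hmap v (hW hi), Finset.card_map])
    (fun v h => Finset.eq_empty_of_forall_notMem fun a ha => by
      obtain ⟨i, -, hi⟩ := Finset.mem_biUnion.1 ((hL₀ v a).1 ha).1
      exact h i hi)
    hcd' hout (fun i v _ => hv' v) htotal
    (le_trans (le_mul_of_one_le_left (Nat.cast_nonneg D) (by linarith)) hΛ1) hΛ2
    (le_trans (by positivity) hp2) hp1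
  obtain ⟨ψ, hψ⟩ : ∃ ψ : V → ℕ, ∀ v ∈ X, ∃ a ∈ L₀ v, φ v = some a ∧ ψ v = a.1 :=
    ⟨fun v => ((φ v).map Subtype.val).getD 0, fun v hvX => by
      obtain ⟨a, ha, hφa⟩ := h2 v hvX
      exact ⟨a, ha, hφa, by simp [hφa]⟩⟩
  refine ⟨X, ψ, fun v => (L' v).map (Function.Embedding.subtype _), fun v hvX => ?_, fun v hvX => ?_,
    fun u v hu hvX _ h => ?_, fun v hvW _ => ⟨?_, fun c hc u hu h => ?_⟩, fun v hvW _ => ?_,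
    fun i v hi _ c hc => ?_⟩
  · exact (h1 v hvX).elim fun i hi => hW hi
  · obtain ⟨a, ha, -, hψa⟩ := hψ v hvX
    rw [hψa]
    exact ((hL₀ v a).1 ha).2
  · obtain ⟨a, -, ha, hψa⟩ := hψ u hu
    obtain ⟨b, -, hb, hψb⟩ := hψ v hvX
    rw [hψa, hψb] at h
    exact h3 u hu v hvX a b ha hb (hMM.2 h)
  · rw [← hmap v hvW]
    exact Finset.map_subset_map.2 (h4 v)
  · obtain ⟨i, -, hi⟩ := Finset.mem_biUnion.1 hvW
    obtain ⟨c, hc', rfl⟩ := Finset.mem_map.1 hc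
    obtain ⟨a, -, ha, hψa⟩ := hψ u hu
    rw [hψa] at h
    exact (h5 i v hi).2 c hc' u hu a ha (hMM.2 h)
  · obtain ⟨i, -, hi⟩ := Finset.mem_biUnion.1 hvW
    rw [Finset.card_map]
    exact (h5 i v hi).1
  · obtain ⟨c, hc', rfl⟩ := Finset.mem_map.1 hc
    refine le_trans (Nat.cast_le.2 (Finset.card_le_card fun u hu => ?_)) (h6 i v hi c hc')
    obtain ⟨hadj', huX, b, hb, h⟩ := Finset.mem_filter.1 hu
    obtain ⟨b, hb', rfl⟩ := Finset.mem_map.1 hb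
    rw [SimpleGraph.mem_neighborFinset] at hadj'
    exact Finset.mem_filter.2 ⟨(hG i _ _ hadj').2, huX, b, hb', hMM.2 (hsymm _ _ h)⟩
end
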